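/- Define F̄(m) to be the poset of 'good forests' on m labelled leaves — forests with no isolated vertices in which every internal vertex has even degree at least 4 — ordered by the compositional relation (F' ≤ F if F' is obtained from F by replacing each internal vertex v of F by a good forest on deg(v) leaves, composed appropriately), together with an adjoined minimum element ⊘. Then the Möbius function of this poset satisfies, for every good forest F, μ_{F̄}(⊘, F) = (−1)^{|V^□(F)|+1} · ∏_{v ∈ V^□(F)} (deg(v) − 2)!, where V^□(F) is the set of internal vertices of F. -/

import Mathlib

open scoped BigOperators Classical

/-- A *good forest* on `m` labelled leaves: a forest (acyclic simple graph) whose vertices are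
the `m` labelled leaves (`Sum.inl`, each of degree exactly `1`, so no isolated vertices) together
with `n` internal vertices (`Sum.inr`), each of even degree at least `4`. -/
structure GoodForest (m : ℕ) where
  /-- number of internal (`□`) vertices -/
  n : ℕ
  /-- the forest -/
  G : SimpleGraph (Fin m ⊕ Fin n)
  acyclic : G.IsAcyclic
  leaf_degree : ∀ i : Fin m, (G.neighborSet (Sum.inl i)).ncard = 1
  internal_degree_even : ∀ j : Fin n, Even ((G.neighborSet (Sum.inr j)).ncard)
  internal_degree_ge : ∀ j : Fin n, 4 ≤ (G.neighborSet (Sum.inr j)).ncard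

namespace GoodForest

variable {m : ℕ}

/-- The degree of an internal vertex of a good forest. -/
noncomputable def deg (F : GoodForest m) (j : Fin F.n) : ℕ :=
  (F.G.neighborSet (Sum.inr j)).ncard

/-- Two good forests are isomorphic fixing the leaf labels. -/
def LabelIso (F F' : GoodForest m) : Prop :=
  ∃ φ : F.G ≃g F'.G, ∀ i : Fin m, φ (Sum.inl i) = Sum.inl i

section Composition

variable (F : GoodForest m) (H : (j : Fin F.n) → GoodForest (F.deg j))
  (ε : (j : Fin F.n) → (F.G.neighborSet (Sum.inr j)) ≃ Fin (F.deg j))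

/-- Vertices of the auxiliary "gluing" graph used to define the composition `F[(H_j)_j]`:
the leaves of `F`, and for each internal vertex `j` of `F` the full vertex set of the inserted
forest `H j` (its `deg j` leaves, which serve as gluing points, and its internal vertices). -/
abbrev GlueV : Type :=
  Fin m ⊕ (Σ j : Fin F.n, (Fin (F.deg j) ⊕ Fin (H j).n))

/-- Vertices of the composition `F[(H_j)_j]`: the `m` leaves together with the internal
vertices of the inserted forests. -/
abbrev CompV : Type :=
  Fin m ⊕ (Σ j : Fin F.n, Fin (H j).n)

/-- The gluing graph: the disjoint union of the inserted forests `H j`, where for every edge of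
`F` the corresponding leaves of the inserted forests (as indexed by the labellings `ε j` of the
edges at each internal vertex) are joined, edges of `F` between a leaf and an internal vertex
join that leaf to the corresponding inserted leaf, and pair edges of `F` between two leaves are
kept. -/
def glueGraph : SimpleGraph (GlueV F H) :=
  SimpleGraph.fromRel fun a b =>
    (∃ (j : Fin F.n) (x y : Fin (F.deg j) ⊕ Fin (H j).n),
        (H j).G.Adj x y ∧ a = Sum.inr ⟨j, x⟩ ∧ b = Sum.inr ⟨j, y⟩) ∨
    (∃ (j j' : Fin F.n) (h : F.G.Adj (Sum.inr j) (Sum.inr j')),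
        a = Sum.inr ⟨j, Sum.inl (ε j ⟨Sum.inr j', h⟩)⟩ ∧
        b = Sum.inr ⟨j', Sum.inl (ε j' ⟨Sum.inr j, h.symm⟩)⟩) ∨
    (∃ (i : Fin m) (j : Fin F.n) (h : F.G.Adj (Sum.inr j) (Sum.inl i)),
        a = Sum.inl i ∧ b = Sum.inr ⟨j, Sum.inl (ε j ⟨Sum.inl i, h⟩)⟩) ∨
    (∃ i i' : Fin m, F.G.Adj (Sum.inl i) (Sum.inl i') ∧ a = Sum.inl i ∧ b = Sum.inl i')

/-- Embedding of the vertices of the composition into the gluing graph. -/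
def embedV : CompV F H → GlueV F H
  | Sum.inl i => Sum.inl i
  | Sum.inr ⟨j, x⟩ => Sum.inr ⟨j, Sum.inr x⟩

/-- The gluing points (inserted leaves), which get smoothed away in the composition. -/
def IsGluePoint : GlueV F H → Prop := fun a =>
  ∃ (j : Fin F.n) (c : Fin (F.deg j)), a = Sum.inr ⟨j, Sum.inl c⟩

/-- The composition `F[(H_j)_j]`: each internal vertex `j` of `F` is replaced by the good forest
`H j` on `deg j` leaves, gluing along the edges incident to `j`; two retained vertices are
adjacent when they are joined in the gluing graph by a (nontrivial) walk all of whose vertices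
other than the endpoints are gluing points. -/
def compose : SimpleGraph (CompV F H) :=
  SimpleGraph.fromRel fun b b' =>
    ∃ p : (glueGraph F H ε).Walk (embedV F H b) (embedV F H b'),
      0 < p.length ∧
      ∀ v ∈ p.support, v = embedV F H b ∨ v = embedV F H b' ∨ IsGluePoint F H v

end Composition

/-- The compositional partial order on good forests on `m` leaves: `F' ≤ F` iff for each
internal vertex `v` of `F` there is a good forest `F_v` on `deg v` leaves such that `F'` is
isomorphic (fixing the leaf labels) to the composition `F[(F_v)_v]`. -/
def CompLE (F' F : GoodForest m) : Prop :=
  ∃ (H : (j : Fin F.n) → GoodForest (F.deg j))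
    (ε : (j : Fin F.n) → (F.G.neighborSet (Sum.inr j)) ≃ Fin (F.deg j))
    (φ : F'.G ≃g compose F H ε),
    ∀ i : Fin m, φ (Sum.inl i) = Sum.inl i

/-- The claimed value of the Möbius function of the augmented poset `F̄(m)` from the adjoined
bottom element `⊘` to the good forest `F`:
`μ(⊘, F) = (−1)^{|V^□(F)|+1} ∏_{v ∈ V^□(F)} (deg(v) − 2)!`. -/
noncomputable def mobiusValue (F : GoodForest m) : ℤ :=
  (-1) ^ (F.n + 1) * ∏ j : Fin F.n, ((F.deg j - 2).factorial : ℤ)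

end GoodForest

namespace GFM

section Cuts

variable {V : Type} {G : SimpleGraph V}

/-- dart leaving the vertex set `S` -/
def Cross (G : SimpleGraph V) (S : Set V) (x y : V) : Prop := G.Adj x y ∧ x ∈ S ∧ y ∉ S

/-- at most one edge leaves `S` -/
def Cut1 (G : SimpleGraph V) (S : Set V) : Prop :=
  ∀ x y x' y', Cross G S x y → Cross G S x' y' → x = x' ∧ y = y'

/-- no edge leaves `S` -/
def Clo (G : SimpleGraph V) (S : Set V) : Prop := ∀ x y, G.Adj x y → x ∈ S → y ∈ S

theorem Clo.mem_iff {S : Set V} (h : Clo G S) {x y : V} (a : G.Adj x y) : x ∈ S ↔ y ∈ S :=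
  ⟨h x y a, h y x a.symm⟩

theorem Clo.compl {S : Set V} (h : Clo G S) : Clo G Sᶜ := fun x y a hx hy =>
  hx (h y x a.symm hy)

theorem Clo.cut1 {S : Set V} (h : Clo G S) : Cut1 G S := fun x y _ _ h1 =>
  absurd (h x y h1.1 h1.2.1) h1.2.2

theorem Clo.reach {S : Set V} (h : Clo G S) {x y : V} (hx : x ∈ S) (r : G.Reachable x y) :
    y ∈ S := by
  obtain ⟨p⟩ := r
  induction p with
  | nil => exact hx
  | cons a p ih => exact ih (h _ _ a hx)

theorem clo_comp (x : V) : Clo G {u | G.Reachable x u} := fun _ _ a h =>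
  h.trans a.reachable

/-- the side of `w` after removing the edge `v w` -/
def side (G : SimpleGraph V) (v w : V) : Set V :=
  {u | (G.deleteEdges {s(v, w)}).Reachable w u}

theorem mem_side_self (v w : V) : w ∈ side G v w := SimpleGraph.Reachable.refl _

theorem side_cross {v w x y : V} (hv : v ∉ side G v w) (h : Cross G (side G v w) x y) :
    x = w ∧ y = v := by
  obtain ⟨a, hx, hy⟩ := h
  by_contra hne
  by_cases he : s(x, y) = s(v, w)
  · rw [Sym2.eq_iff] at he
    rcases he with ⟨h1, h2⟩ | ⟨h1, h2⟩
    · subst h1; exact hv hx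
    · exact hne ⟨h1, h2⟩
  · apply hy
    have : (G.deleteEdges {s(v, w)}).Adj x y := by
      rw [SimpleGraph.deleteEdges_adj]
      exact ⟨a, he⟩
    exact SimpleGraph.Reachable.trans hx this.reachable

theorem side_min {v w : V} {A : Set V} (hw : w ∈ A)
    (hA : ∀ x y, G.Adj x y → x ∈ A → x ∈ side G v w → s(x, y) ≠ s(v, w) → y ∈ A) :
    side G v w ⊆ A := by
  have key : ∀ x u, (p : (G.deleteEdges {s(v, w)}).Walk x u) → x ∈ A → x ∈ side G v w → u ∈ A := by
    intro x u p
    induction p with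
    | nil => intro h _; exact h
    | @cons x y z a p ih =>
      intro h1 h2
      rw [SimpleGraph.deleteEdges_adj] at a
      refine ih (hA _ _ a.1 h1 h2 (fun h => a.2 h)) ?_
      have : (G.deleteEdges {s(v, w)}).Adj x y := by
        rw [SimpleGraph.deleteEdges_adj]; exact a
      exact SimpleGraph.Reachable.trans h2 this.reachable
  rintro u ⟨p⟩
  exact key _ _ p hw (mem_side_self _ _)

theorem side_reach {v w u : V} (h : u ∈ side G v w) : G.Reachable w u :=
  h.mono (SimpleGraph.deleteEdges_le _)

theorem acyclic_side (hG : G.IsAcyclic) {v w : V} (a : G.Adj v w) : v ∉ side G v w := by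
  rw [SimpleGraph.isAcyclic_iff_forall_adj_isBridge] at hG
  have := hG a
  rw [SimpleGraph.isBridge_iff] at this
  intro h
  exact this h.symm

theorem acyclic_of_cuts
    (h : ∀ x y, G.Adj x y → ∃ S : Set V, x ∈ S ∧ y ∉ S ∧ ∀ u v, Cross G S u v → u = x ∧ v = y) :
    G.IsAcyclic := by
  rw [SimpleGraph.isAcyclic_iff_forall_adj_isBridge]
  intro v w a
  rw [SimpleGraph.isBridge_iff]
  intro hr
  obtain ⟨S, hx, hy, hS⟩ := h v w a
  refine hy (Clo.reach (G := G.deleteEdges {s(v, w)}) ?_ hx hr)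
  intro x y b hxS
  rw [SimpleGraph.deleteEdges_adj] at b
  by_contra hyS
  obtain ⟨rfl, rfl⟩ := hS x y ⟨b.1, hxS, hyS⟩
  exact b.2 rfl

theorem cross_side (hG : G.IsAcyclic) {v w x y : V} (a : G.Adj v w)
    (h : Cross G (side G v w) x y) : x = w ∧ y = v :=
  side_cross (acyclic_side hG a) h

theorem side_cut1 (hG : G.IsAcyclic) {v w : V} (a : G.Adj v w) : Cut1 G (side G v w) := by
  intro x y x' y' h h'
  obtain ⟨rfl, rfl⟩ := cross_side hG a h
  obtain ⟨rfl, rfl⟩ := cross_side hG a h'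
  exact ⟨rfl, rfl⟩

theorem side_disj (hG : G.IsAcyclic) {v w : V} (a : G.Adj v w) :
    Disjoint (side G v w) (side G w v) := by
  rw [Set.disjoint_left]
  suffices side G v w ⊆ (side G w v)ᶜ from fun x h h' => this h h'
  apply side_min
  · exact acyclic_side hG a.symm
  · intro x y b hx hxs hne hy
    obtain ⟨rfl, rfl⟩ := cross_side hG a.symm ⟨b.symm, hy, hx⟩
    exact hne Sym2.eq_swap

theorem side_union (hG : G.IsAcyclic) {v w u : V} (a : G.Adj v w) (r : G.Reachable v u) :
    u ∈ side G v w ∨ u ∈ side G w v := by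
  have hc : Clo G (side G v w ∪ side G w v) := by
    intro x y b hx
    by_contra hy
    rw [Set.mem_union, not_or] at hy
    rcases hx with hx | hx
    · obtain ⟨rfl, rfl⟩ := cross_side hG a ⟨b, hx, hy.1⟩
      exact hy.2 (mem_side_self _ _)
    · obtain ⟨rfl, rfl⟩ := cross_side hG a.symm ⟨b, hx, hy.2⟩
      exact hy.1 (mem_side_self _ _)
  exact hc.reach (Or.inr (mem_side_self _ _)) r

theorem side_sub (hG : G.IsAcyclic) {v w z : V} (a : G.Adj v w) (b : G.Adj w z) (hz : z ≠ v) :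
    side G w z ⊆ side G v w := by
  apply side_min
  · by_contra h
    obtain ⟨_, h⟩ := cross_side hG a ⟨b, mem_side_self _ _, h⟩
    exact hz h
  · intro x y c hx hxs _
    by_contra h
    obtain ⟨rfl, rfl⟩ := cross_side hG a ⟨c, hx, h⟩
    exact acyclic_side hG b hxs

theorem side_ssub (hG : G.IsAcyclic) {v w z : V} (a : G.Adj v w) (b : G.Adj w z) (hz : z ≠ v) :
    side G w z ⊂ side G v w :=
  ⟨side_sub hG a b hz, fun h => acyclic_side hG b (h (mem_side_self _ _))⟩

/-- different neighbours give disjoint sides -/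
theorem side_disj_nbr (hG : G.IsAcyclic) {v w z : V} (a : G.Adj v w) (b : G.Adj v z) (h : w ≠ z) :
    Disjoint (side G v w) (side G v z) := by
  have h1 := side_sub hG b.symm a h
  exact Set.disjoint_of_subset_left h1 (side_disj hG b.symm)

theorem side_cover {v u : V} (r : G.Reachable v u) (h : u ≠ v) : ∃ w, G.Adj v w ∧ u ∈ side G v w := by
  by_contra hc
  push Not at hc
  by_cases hacy : ∀ w, G.Adj v w → v ∉ side G v w
  · have hcl : Clo G ({v} ∪ ⋃ w ∈ {w | G.Adj v w}, side G v w) := by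
      intro x y b hx
      rcases hx with hx | hx
      · rw [Set.mem_singleton_iff] at hx; subst hx
        exact Or.inr (Set.mem_biUnion b (mem_side_self _ _))
      · simp only [Set.mem_iUnion] at hx
        obtain ⟨w, hw, hx⟩ := hx
        by_cases hy : y ∈ side G v w
        · exact Or.inr (Set.mem_biUnion hw hy)
        · obtain ⟨rfl, rfl⟩ := side_cross (hacy w hw) ⟨b, hx, hy⟩
          exact Or.inl rfl
    rcases hcl.reach (Or.inl rfl) r with h' | h'
    · exact h h'
    · simp only [Set.mem_iUnion] at h'
      obtain ⟨w, hw, h'⟩ := h'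
      exact hc w hw h'
  · push Not at hacy
    obtain ⟨w, hw, hv⟩ := hacy
    apply hc w hw
    -- everything reachable from v is in side
    have hcl : Clo G (side G v w) := by
      intro x y b hx
      by_contra hy
      have : (G.deleteEdges {s(v, w)}).Adj x y := by
        rw [SimpleGraph.deleteEdges_adj]
        refine ⟨b, ?_⟩
        intro he
        rw [Set.mem_singleton_iff, Sym2.eq_iff] at he
        rcases he with ⟨rfl, rfl⟩ | ⟨rfl, rfl⟩
        · exact hy (mem_side_self _ _)
        · exact hy hv
      exact hy (SimpleGraph.Reachable.trans hx this.reachable)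
    exact hcl.reach hv r

theorem leafless [Finite V] (hG : G.IsAcyclic) {A : Set V} (hA : A.Nonempty)
    (hdeg : ∀ x ∈ A, 4 ≤ (G.neighborSet x).ncard) (e f : V)
    (h : ∀ x y, Cross G A x y → y = e ∨ y = f) : False := by
  have key : ∃ y ∈ A, ∃ x, ∀ z ∈ A, G.Adj y z → z = x := by
    by_cases hd : ∃ x y, x ∈ A ∧ y ∈ A ∧ G.Adj x y
    · have hne : {n | ∃ x y, x ∈ A ∧ y ∈ A ∧ G.Adj x y ∧ (side G x y).ncard = n}.Nonempty := by
        obtain ⟨x, y, h1, h2, h3⟩ := hd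
        exact ⟨_, x, y, h1, h2, h3, rfl⟩
      obtain ⟨x, y, hx, hy, a, hn⟩ := Nat.sInf_mem hne
      refine ⟨y, hy, x, fun z hz b => ?_⟩
      by_contra hzx
      have hlt := Set.ncard_lt_ncard (side_ssub hG a b hzx) (Set.toFinite _)
      have := Nat.sInf_le (s := {n | ∃ x y, x ∈ A ∧ y ∈ A ∧ G.Adj x y ∧ (side G x y).ncard = n})
        ⟨y, z, hy, hz, b, rfl⟩
      omega
    · obtain ⟨y, hy⟩ := hA
      exact ⟨y, hy, y, fun z hz b => absurd ⟨y, z, hy, hz, b⟩ hd⟩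
  obtain ⟨y, hy, x, hx⟩ := key
  have hsub : G.neighborSet y ⊆ {x, e, f} := by
    intro z hz
    by_cases hzA : z ∈ A
    · left; exact hx z hzA hz
    · right
      exact h y z ⟨hz, hy, hzA⟩
  have h1 := Set.ncard_le_ncard hsub (Set.toFinite _)
  have h2 := hdeg y hy
  have h3 : ({x, e, f} : Set V).ncard ≤ 3 := Set.ncard_insert_le _ _ |>.trans (by
    have := Set.ncard_insert_le e {f}
    rw [Set.ncard_singleton] at this; omega)
  omega

end Cuts

end GFM

namespace GFM

section Cuts2
variable {V : Type} {G : SimpleGraph V}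

theorem Cut1.compl {S : Set V} (h : Cut1 G S) : Cut1 G Sᶜ := by
  intro x y x' y' h1 h2
  have a1 : Cross G S y x := ⟨h1.1.symm, not_not.1 h1.2.2, h1.2.1⟩
  have a2 : Cross G S y' x' := ⟨h2.1.symm, not_not.1 h2.2.2, h2.2.1⟩
  exact (h _ _ _ _ a1 a2).symm

theorem Cut1.target {S : Set V} (h : Cut1 G S) (d : V) : ∃ e, ∀ x y, Cross G S x y → y = e := by
  by_cases hc : ∃ x y, Cross G S x y
  · obtain ⟨x, y, hxy⟩ := hc
    exact ⟨y, fun x' y' h' => (h _ _ _ _ h' hxy).2⟩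
  · exact ⟨d, fun x y h' => absurd ⟨x, y, h'⟩ hc⟩

theorem cut_disj [Finite V] (hG : G.IsAcyclic) {S T : Set V} (hS : Cut1 G S) (hT : Cut1 G T)
    (hdeg : ∀ x ∈ S, x ∈ T → 4 ≤ (G.neighborSet x).ncard) : Disjoint S T := by
  rw [Set.disjoint_iff_inter_eq_empty]
  by_contra hne
  have hne : (S ∩ T).Nonempty := Set.nonempty_iff_ne_empty.2 hne
  obtain ⟨d, hd⟩ := hne
  obtain ⟨e, he⟩ := hS.target d
  obtain ⟨f, hf⟩ := hT.target d
  refine leafless hG (A := S ∩ T) ⟨d, hd⟩ (fun x hx => hdeg x hx.1 hx.2) e f ?_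
  intro x y hxy
  by_cases hy : y ∈ S
  · right
    exact hf x y ⟨hxy.1, hxy.2.1.2, fun h => hxy.2.2 ⟨hy, h⟩⟩
  · left
    exact he x y ⟨hxy.1, hxy.2.1.1, hy⟩

theorem cut_sub [Finite V] (hG : G.IsAcyclic) {S T : Set V} (hS : Cut1 G S) (hT : Cut1 G T)
    (hdeg : ∀ x ∈ S, x ∉ T → 4 ≤ (G.neighborSet x).ncard) : S ⊆ T := by
  have := cut_disj hG hS hT.compl (fun x h1 h2 => hdeg x h1 h2)
  exact Set.disjoint_compl_right_iff_subset.1 this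

end Cuts2

section Smoothing

variable {W : Type} {Γ : SimpleGraph W} {P : W → Prop}

/-- coming from `h` to `g`, the first vertex outside `P` is `b` -/
inductive Tm (Γ : SimpleGraph W) (P : W → Prop) : W → W → W → Prop
  | base {h g : W} : ¬ P g → Tm Γ P h g g
  | step {h g g' b : W} : P g → Γ.Adj g g' → g' ≠ h → Tm Γ P g g' b → Tm Γ P h g b

/-- vertices in `P` have exactly two neighbours -/
structure Two (Γ : SimpleGraph W) (P : W → Prop) : Prop where
  uniq : ∀ g h h' h'', P g → Γ.Adj g h → Γ.Adj g h' → Γ.Adj g h'' → h' ≠ h → h'' ≠ h → h' = h''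
  ex : ∀ g h, P g → Γ.Adj g h → ∃ h', Γ.Adj g h' ∧ h' ≠ h

theorem Tm.notP {h g b : W} (t : Tm Γ P h g b) : ¬ P b := by
  induction t with
  | base h => exact h
  | step _ _ _ _ ih => exact ih

theorem Tm.eq_of_notP {h g b : W} (t : Tm Γ P h g b) (hg : ¬ P g) : b = g := by
  cases t with
  | base h => rfl
  | step h1 _ _ _ => exact absurd h1 hg

theorem Tm.det (h2 : Two Γ P) {h g b b' : W} (t : Tm Γ P h g b) (t' : Tm Γ P h g b')
    (a : Γ.Adj h g) : b = b' := by
  induction t with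
  | base h1 => exact (t'.eq_of_notP h1).symm
  | @step h g g' b h1 a1 n1 t1 ih =>
    cases t' with
    | base h3 => exact absurd h1 h3
    | @step _ _ g'' _ h3 a3 n3 t3 =>
      have := h2.uniq g h g' g'' h1 a.symm a1 a3 n1 n3
      subst this
      exact ih t3 a1

theorem Tm.mem_side (hG : Γ.IsAcyclic) {h g b : W} (t : Tm Γ P h g b)
    (a : Γ.Adj h g) : b ∈ side Γ h g := by
  induction t with
  | base h1 => exact mem_side_self _ _
  | @step h g g' b h1 a1 n1 t1 ih => exact side_sub hG a a1 n1 (ih a1)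

theorem Tm.exists [Finite W] (hG : Γ.IsAcyclic) (h2 : Two Γ P) : ∀ (n : ℕ) (h g : W),
    (side Γ h g).ncard = n → Γ.Adj h g → ∃ b, Tm Γ P h g b := by
  intro n
  induction n using Nat.strong_induction_on with
  | _ n ih =>
  intro h g hn a
  by_cases hP : P g
  · obtain ⟨g', a1, n1⟩ := h2.ex g h hP a.symm
    obtain ⟨b, hb⟩ := ih _ (by
      rw [← hn]
      exact Set.ncard_lt_ncard (side_ssub hG a a1 n1) (Set.toFinite _)) g g' rfl a1
    exact ⟨b, Tm.step hP a1 n1 hb⟩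
  · exact ⟨g, Tm.base hP⟩

theorem Tm.ex [Finite W] (hG : Γ.IsAcyclic) (h2 : Two Γ P) {h g : W} (a : Γ.Adj h g) :
    ∃ b, Tm Γ P h g b := Tm.exists hG h2 _ h g rfl a

theorem Tm.rev {h g b c : W} (t : Tm Γ P h g b) (a : Γ.Adj h g) (t' : Tm Γ P g h c) :
    ∃ k, Γ.Adj b k ∧ Tm Γ P b k c := by
  induction t with
  | base h1 => exact ⟨_, a.symm, t'⟩
  | @step h g g' b h1 a1 n1 t1 ih => exact ih a1 (Tm.step h1 a.symm n1.symm t')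

theorem Tm.cross {h g b c : W} (t : Tm Γ P h g b) (a : Γ.Adj h g) (t' : Tm Γ P g h c)
    {S : Set W} (hS : h ∈ S) (hb : b ∉ S) :
    ∃ x y, Cross Γ S x y ∧ Tm Γ P x y b ∧ Tm Γ P y x c := by
  induction t with
  | @base h g h1 => exact ⟨h, g, ⟨a, hS, hb⟩, Tm.base h1, t'⟩
  | @step h g g' b h1 a1 n1 t1 ih =>
    by_cases hg : g ∈ S
    · exact ih a1 (Tm.step h1 a.symm n1.symm t') hg hb
    · exact ⟨h, g, ⟨a, hS, hg⟩, Tm.step h1 a1 n1 t1, t'⟩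

theorem Tm.walk {h g b : W} (t : Tm Γ P h g b) :
    ∃ p : Γ.Walk g b, ∀ v ∈ p.support, v = b ∨ P v := by
  induction t with
  | base h1 => exact ⟨SimpleGraph.Walk.nil, by simp⟩
  | @step h g g' b h1 a1 n1 t1 ih =>
    obtain ⟨p, hp⟩ := ih
    refine ⟨SimpleGraph.Walk.cons a1 p, ?_⟩
    intro v hv
    rw [SimpleGraph.Walk.support_cons, List.mem_cons] at hv
    rcases hv with rfl | hv
    · exact Or.inr h1
    · exact hp v hv

theorem Tm.of_path {g b : W} (p : Γ.Walk g b) : ∀ h, p.IsPath → h ∉ p.support →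
    (∀ v ∈ p.support, v = b ∨ P v) → ¬ P b → Tm Γ P h g b := by
  induction p with
  | nil => intro h _ _ _ hb; exact Tm.base hb
  | @cons g g' b a p ih =>
    intro h hp hn hs hb
    rw [SimpleGraph.Walk.cons_isPath_iff] at hp
    have hgb : g ≠ b := by
      rintro rfl
      exact hp.2 p.end_mem_support
    have hPg : P g := by
      rcases hs g (SimpleGraph.Walk.start_mem_support _) with h1 | h1
      · exact absurd h1 hgb
      · exact h1
    rw [SimpleGraph.Walk.support_cons, List.mem_cons, not_or] at hn
    refine Tm.step hPg a ?_ (ih g hp.1 hp.2 ?_ hb)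
    · rintro rfl
      exact hn.2 p.start_mem_support
    · intro v hv
      exact hs v (by rw [SimpleGraph.Walk.support_cons]; exact List.mem_cons_of_mem _ hv)

def NB (Γ : SimpleGraph W) (P : W → Prop) (b b' : W) : Prop := ∃ h, Γ.Adj b h ∧ Tm Γ P b h b'

theorem nb_of_walk {b b' : W} (hne : b ≠ b') (hb' : ¬ P b') (p : Γ.Walk b b')
    (hp : ∀ v ∈ p.support, v = b ∨ v = b' ∨ P v) : NB Γ P b b' := by
  have hq : p.bypass.IsPath := p.bypass_isPath
  have hs : ∀ v ∈ p.bypass.support, v = b ∨ v = b' ∨ P v := fun v hv =>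
    hp v (p.support_bypass_subset_support hv)
  generalize p.bypass = q at hq hs
  cases q with
  | nil => exact absurd rfl hne
  | @cons _ g _ a q =>
    rw [SimpleGraph.Walk.cons_isPath_iff] at hq
    refine ⟨g, a, Tm.of_path q b hq.1 hq.2 ?_ hb'⟩
    intro v hv
    rcases hs v (by rw [SimpleGraph.Walk.support_cons]; exact List.mem_cons_of_mem _ hv) with h | h
    · subst h; exact absurd hv hq.2
    · exact h

theorem walk_of_nb {b b' : W} (h : NB Γ P b b') :
    ∃ p : Γ.Walk b b', 0 < p.length ∧ ∀ v ∈ p.support, v = b ∨ v = b' ∨ P v := by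
  obtain ⟨g, a, t⟩ := h
  obtain ⟨p, hp⟩ := t.walk
  refine ⟨SimpleGraph.Walk.cons a p, by simp, ?_⟩
  intro v hv
  rw [SimpleGraph.Walk.support_cons, List.mem_cons] at hv
  rcases hv with rfl | hv
  · exact Or.inl rfl
  · exact Or.inr (hp v hv)

theorem nb_symm {b b' : W} (hb : ¬ P b) (h : NB Γ P b b') : NB Γ P b' b := by
  obtain ⟨g, a, t⟩ := h
  exact t.rev a (Tm.base hb)

/-- `Sm` is obtained from `Γ` by smoothing the vertices in `P` -/
structure Smooth (Γ : SimpleGraph W) (P : W → Prop) {U : Type} (Sm : SimpleGraph U) (e : U → W) :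
    Prop where
  acyc : Γ.IsAcyclic
  two : Two Γ P
  inj : Function.Injective e
  range : ∀ x, ¬ P x ↔ ∃ u, e u = x
  adj : ∀ u u', Sm.Adj u u' ↔ NB Γ P (e u) (e u')

variable {U : Type} {Sm : SimpleGraph U} {e : U → W}

theorem Smooth.notP (h : Smooth Γ P Sm e) (u : U) : ¬ P (e u) := (h.range _).2 ⟨u, rfl⟩

theorem Smooth.cross (h : Smooth Γ P Sm e) {S : Set W} {u u' : U} (a : Sm.Adj u u')
    (hu : e u ∈ S) (hu' : e u' ∉ S) :
    ∃ x y, Cross Γ S x y ∧ Tm Γ P x y (e u') ∧ Tm Γ P y x (e u) := by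
  obtain ⟨g, a1, t⟩ := (h.adj u u').1 a
  exact t.cross a1 (Tm.base (h.notP u)) hu hu'

theorem Smooth.cut1 (h : Smooth Γ P Sm e) {S : Set W} (hS : Cut1 Γ S) : Cut1 Sm (e ⁻¹' S) := by
  intro u v u' v' h1 h2
  obtain ⟨x, y, c1, t1, t1'⟩ := h.cross h1.1 h1.2.1 h1.2.2
  obtain ⟨x', y', c2, t2, t2'⟩ := h.cross h2.1 h2.2.1 h2.2.2
  obtain ⟨rfl, rfl⟩ := hS _ _ _ _ c1 c2
  exact ⟨h.inj (t1'.det h.two t2' c1.1.symm), h.inj (t1.det h.two t2 c1.1)⟩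

theorem Smooth.adj_of_dart (h : Smooth Γ P Sm e) {x y : W} (a : Γ.Adj x y) {u u' : U}
    (t : Tm Γ P x y (e u')) (t' : Tm Γ P y x (e u)) : Sm.Adj u u' :=
  (h.adj u u').2 (t'.rev a.symm t)

theorem Smooth.acyclic (h : Smooth Γ P Sm e) : Sm.IsAcyclic := by
  apply acyclic_of_cuts
  intro u u' a
  obtain ⟨g, a1, t⟩ := (h.adj u u').1 a
  refine ⟨e ⁻¹' (side Γ g (e u)), mem_side_self _ _, ?_, ?_⟩
  · intro hc
    exact Set.disjoint_left.1 (side_disj h.acyc a1) (t.mem_side h.acyc a1) hc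
  · intro c c' hcc
    obtain ⟨x, y, c1, t1, t1'⟩ := h.cross hcc.1 hcc.2.1 hcc.2.2
    obtain ⟨rfl, rfl⟩ := cross_side h.acyc a1.symm c1
    exact ⟨h.inj (t1'.eq_of_notP (h.notP u)), h.inj (t1.det h.two t a1)⟩

theorem Smooth.degree [Finite W] (h : Smooth Γ P Sm e) (u : U) :
    (Sm.neighborSet u).ncard = (Γ.neighborSet (e u)).ncard := by
  have hex : ∀ g, Γ.Adj (e u) g → ∃ u', Tm Γ P (e u) g (e u') := by
    intro g a
    obtain ⟨b, hb⟩ := Tm.ex h.acyc h.two a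
    obtain ⟨u', rfl⟩ := (h.range b).1 hb.notP
    exact ⟨u', hb⟩
  symm
  refine Set.ncard_congr (fun g a => Classical.choose (hex g a)) ?_ ?_ ?_
  · intro g a
    exact (h.adj u _).2 ⟨g, a, Classical.choose_spec (hex g a)⟩
  · intro g g' a a' he
    by_contra hne
    have s1 := (Classical.choose_spec (hex g a)).mem_side h.acyc a
    have s2 := (Classical.choose_spec (hex g' a')).mem_side h.acyc a'
    rw [← he] at s2
    exact Set.disjoint_left.1 (side_disj_nbr h.acyc a a' hne) s1 s2
  · intro u' a
    obtain ⟨g, a1, t⟩ := (h.adj u u').1 a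
    exact ⟨g, a1, h.inj ((Classical.choose_spec (hex g a1)).det h.two t a1)⟩

end Smoothing
end GFM

namespace GFM

section Glue
open GoodForest

variable {m : ℕ}

theorem leaf_nbr (F : GoodForest m) (i : Fin m) : ∃ w, ∀ z, F.G.Adj (Sum.inl i) z ↔ z = w := by
  obtain ⟨w, hw⟩ := Set.ncard_eq_one.1 (F.leaf_degree i)
  refine ⟨w, fun z => ?_⟩
  rw [← SimpleGraph.mem_neighborSet, hw, Set.mem_singleton_iff]

variable (F : GoodForest m) (H : (j : Fin F.n) → GoodForest (F.deg j))
  (ε : (j : Fin F.n) → (F.G.neighborSet (Sum.inr j)) ≃ Fin (F.deg j))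

def gl : (v w : Fin m ⊕ Fin F.n) → F.G.Adj v w → GlueV F H
  | Sum.inl i, _, _ => Sum.inl i
  | Sum.inr j, w, h => Sum.inr ⟨j, Sum.inl (ε j ⟨w, h⟩)⟩

def proj : GlueV F H → Fin m ⊕ Fin F.n
  | Sum.inl i => Sum.inl i
  | Sum.inr ⟨j, _⟩ => Sum.inr j

theorem proj_gl {v w} (h : F.G.Adj v w) : proj F H (gl F H ε v w h) = v := by
  rcases v with i | j <;> rfl

theorem gl_inj {v w w'} (h : F.G.Adj v w) (h' : F.G.Adj v w')
    (e : gl F H ε v w h = gl F H ε v w' h') : w = w' := by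
  rcases v with i | j
  · obtain ⟨u, hu⟩ := leaf_nbr F i
    rw [(hu w).1 h, (hu w').1 h']
  · simp only [gl] at e
    have e := Sum.inr_injective e
    have e := eq_of_heq (Sigma.mk.inj_iff.1 e).2
    have e := (ε j).injective (Sum.inl_injective e)
    exact congrArg Subtype.val e

def HE (a b : GlueV F H) : Prop :=
  ∃ (j : Fin F.n) (x y : Fin (F.deg j) ⊕ Fin (H j).n),
    (H j).G.Adj x y ∧ a = Sum.inr ⟨j, x⟩ ∧ b = Sum.inr ⟨j, y⟩

def FE (a b : GlueV F H) : Prop :=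
  ∃ (v w : Fin m ⊕ Fin F.n) (h : F.G.Adj v w), a = gl F H ε v w h ∧ b = gl F H ε w v h.symm

theorem glue_adj {a b : GlueV F H} : (glueGraph F H ε).Adj a b ↔ HE F H a b ∨ FE F H ε a b := by
  rw [glueGraph, SimpleGraph.fromRel_adj]
  constructor
  · rintro ⟨-, h | h⟩
    · rcases h with ⟨j, x, y, h, h1, h2⟩ | ⟨j, j', h, h1, h2⟩ | ⟨i, j, h, h1, h2⟩ | ⟨i, i', h, h1, h2⟩
      · exact Or.inl ⟨j, x, y, h, h1, h2⟩
      · exact Or.inr ⟨_, _, h, h1, h2⟩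
      · exact Or.inr ⟨_, _, h.symm, h1, h2⟩
      · exact Or.inr ⟨_, _, h, h1, h2⟩
    · rcases h with ⟨j, x, y, h, h1, h2⟩ | ⟨j, j', h, h1, h2⟩ | ⟨i, j, h, h1, h2⟩ | ⟨i, i', h, h1, h2⟩
      · exact Or.inl ⟨j, y, x, h.symm, h2, h1⟩
      · exact Or.inr ⟨_, _, h.symm, h2, h1⟩
      · exact Or.inr ⟨_, _, h, h2, h1⟩
      · exact Or.inr ⟨_, _, h.symm, h2, h1⟩
  · rintro (⟨j, x, y, h, rfl, rfl⟩ | ⟨v, w, h, rfl, rfl⟩)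
    · refine ⟨?_, Or.inl (Or.inl ⟨j, x, y, h, rfl, rfl⟩)⟩
      intro e
      have e := eq_of_heq (Sigma.mk.inj_iff.1 (Sum.inr_injective e)).2
      exact h.ne e
    · refine ⟨?_, ?_⟩
      · intro e
        have := congrArg (proj F H) e
        rw [proj_gl, proj_gl] at this
        exact h.ne this
      · rcases v with i | j <;> rcases w with i' | j'
        · exact Or.inl (Or.inr (Or.inr (Or.inr ⟨i, i', h, rfl, rfl⟩)))
        · exact Or.inl (Or.inr (Or.inr (Or.inl ⟨i, j', h.symm, rfl, rfl⟩)))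
        · exact Or.inr (Or.inr (Or.inr (Or.inl ⟨i', j, h, rfl, rfl⟩)))
        · exact Or.inl (Or.inr (Or.inl ⟨j, j', h, rfl, rfl⟩))

theorem glue_H {j : Fin F.n} {x y : Fin (F.deg j) ⊕ Fin (H j).n} (h : (H j).G.Adj x y) :
    (glueGraph F H ε).Adj (Sum.inr ⟨j, x⟩) (Sum.inr ⟨j, y⟩) :=
  (glue_adj F H ε).2 (Or.inl ⟨j, x, y, h, rfl, rfl⟩)

theorem glue_F {v w} (h : F.G.Adj v w) :
    (glueGraph F H ε).Adj (gl F H ε v w h) (gl F H ε w v h.symm) :=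
  (glue_adj F H ε).2 (Or.inr ⟨v, w, h, rfl, rfl⟩)

theorem inr_inj {j : Fin F.n} {x y : Fin (F.deg j) ⊕ Fin (H j).n}
    (e : (Sum.inr ⟨j, x⟩ : GlueV F H) = Sum.inr ⟨j, y⟩) : x = y :=
  eq_of_heq (Sigma.mk.inj_iff.1 (Sum.inr_injective e)).2

theorem proj_HE {a b : GlueV F H} (h : HE F H a b) : proj F H a = proj F H b := by
  obtain ⟨j, x, y, h, rfl, rfl⟩ := h
  rfl

/-- crossings of a pulled back set -/
theorem proj_cross {S : Set (Fin m ⊕ Fin F.n)} {a b : GlueV F H}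
    (h : Cross (glueGraph F H ε) (proj F H ⁻¹' S) a b) :
    ∃ v w h, Cross F.G S v w ∧ a = gl F H ε v w h ∧ b = gl F H ε w v h.symm := by
  obtain ⟨h1, h2, h3⟩ := h
  rcases (glue_adj F H ε).1 h1 with h1 | ⟨v, w, h, rfl, rfl⟩
  · rw [Set.mem_preimage] at h2 h3
    rw [proj_HE F H h1] at h2
    exact absurd h2 h3
  · rw [Set.mem_preimage, proj_gl] at h2 h3
    exact ⟨v, w, h, ⟨h, h2, h3⟩, rfl, rfl⟩

theorem proj_cut1 {S : Set (Fin m ⊕ Fin F.n)} (hS : Cut1 F.G S) :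
    Cut1 (glueGraph F H ε) (proj F H ⁻¹' S) := by
  intro a b a' b' h h'
  obtain ⟨v, w, h, h1, rfl, rfl⟩ := proj_cross F H ε h
  obtain ⟨v', w', h', h1', rfl, rfl⟩ := proj_cross F H ε h'
  obtain ⟨rfl, rfl⟩ := hS _ _ _ _ h1 h1'
  exact ⟨rfl, rfl⟩

/-- extension of a vertex set of `H j` to the glued graph -/
def lift (j : Fin F.n) (S : Set (Fin (F.deg j) ⊕ Fin (H j).n)) : Set (GlueV F H) :=
  {a | (∃ x ∈ S, a = Sum.inr ⟨j, x⟩) ∨ ∃ (w : _) (h : F.G.Adj (Sum.inr j) w),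
    proj F H a ∈ side F.G (Sum.inr j) w ∧ Sum.inl (ε j ⟨w, h⟩) ∈ S}

theorem mem_lift {j : Fin F.n} {S : Set (Fin (F.deg j) ⊕ Fin (H j).n)} {x} :
    (Sum.inr ⟨j, x⟩ : GlueV F H) ∈ lift F H ε j S ↔ x ∈ S := by
  constructor
  · rintro (⟨y, hy, e⟩ | ⟨w, h, h1, -⟩)
    · rw [inr_inj F H e]; exact hy
    · exact absurd h1 (acyclic_side F.acyclic h)
  · intro h
    exact Or.inl ⟨x, h, rfl⟩

theorem lift_cross {j : Fin F.n} {S : Set (Fin (F.deg j) ⊕ Fin (H j).n)} {a b : GlueV F H}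
    (h : Cross (glueGraph F H ε) (lift F H ε j S) a b) :
    ∃ x y, Cross (H j).G S x y ∧ a = Sum.inr ⟨j, x⟩ ∧ b = Sum.inr ⟨j, y⟩ := by
  obtain ⟨h1, h2, h3⟩ := h
  rcases (glue_adj F H ε).1 h1 with h1 | ⟨v, w, h, rfl, rfl⟩
  · obtain ⟨j', x, y, h, rfl, rfl⟩ := h1
    by_cases hj : j' = j
    · subst hj
      rw [mem_lift] at h2 h3
      exact ⟨x, y, ⟨h, h2, h3⟩, rfl, rfl⟩
    · exfalso
      rcases h2 with ⟨z, hz, e⟩ | h2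
      · exact hj (Sigma.mk.inj_iff.1 (Sum.inr_injective e)).1
      · exact h3 (Or.inr h2)
  · exfalso
    by_cases hv : v = Sum.inr j
    · subst hv
      have h2 := (mem_lift F H ε).1 h2
      exact h3 (Or.inr ⟨w, h, by rw [proj_gl]; exact mem_side_self _ _, h2⟩)
    · rcases h2 with ⟨z, hz, e⟩ | ⟨u, hu, h2, h2'⟩
      · have := congrArg (proj F H) e
        rw [proj_gl] at this
        exact hv this
      · rw [proj_gl] at h2
        by_cases hw : w = Sum.inr j
        · subst hw
          have hvu : u = v := by
            by_contra hne
            exact Set.disjoint_left.1 (side_disj_nbr F.acyclic hu h.symm hne) h2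
              (mem_side_self _ _)
          subst hvu
          exact h3 ((mem_lift F H ε).2 h2')
        · apply h3
          refine Or.inr ⟨u, hu, ?_, h2'⟩
          rw [proj_gl]
          by_contra hc
          exact hw (cross_side F.acyclic hu ⟨h, h2, hc⟩).2

theorem lift_cut1 {j : Fin F.n} {S : Set (Fin (F.deg j) ⊕ Fin (H j).n)} (hS : Cut1 (H j).G S) :
    Cut1 (glueGraph F H ε) (lift F H ε j S) := by
  intro a b a' b' h h'
  obtain ⟨v, w, h1, rfl, rfl⟩ := lift_cross F H ε h
  obtain ⟨v', w', h2, rfl, rfl⟩ := lift_cross F H ε h'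
  obtain ⟨rfl, rfl⟩ := hS _ _ _ _ h1 h2
  exact ⟨rfl, rfl⟩

theorem glue_acyclic : (glueGraph F H ε).IsAcyclic := by
  apply acyclic_of_cuts
  intro a b hab0
  rcases (glue_adj F H ε).1 hab0 with ⟨j, x, y, h, rfl, rfl⟩ | ⟨v, w, h, rfl, rfl⟩
  · refine ⟨lift F H ε j (side (H j).G y x), ?_, ?_, ?_⟩
    · rw [mem_lift]; exact mem_side_self _ _
    · rw [mem_lift]; exact acyclic_side (H j).acyclic h.symm
    · intro u v huv
      obtain ⟨x', y', h', rfl, rfl⟩ := lift_cross F H ε huv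
      obtain ⟨rfl, rfl⟩ := cross_side (H j).acyclic h.symm h'
      exact ⟨rfl, rfl⟩
  · refine ⟨proj F H ⁻¹' (side F.G w v), ?_, ?_, ?_⟩
    · rw [Set.mem_preimage, proj_gl]; exact mem_side_self _ _
    · rw [Set.mem_preimage, proj_gl]; exact acyclic_side F.acyclic h.symm
    · intro a b hab
      obtain ⟨v', w', h', h1', rfl, rfl⟩ := proj_cross F H ε hab
      obtain ⟨rfl, rfl⟩ := cross_side F.acyclic h.symm h1'
      exact ⟨rfl, rfl⟩

theorem glue_nbrs (j : Fin F.n) (c : Fin (F.deg j)) : ∃ a0 b0, a0 ≠ b0 ∧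
    ∀ h, (glueGraph F H ε).Adj (Sum.inr ⟨j, Sum.inl c⟩) h ↔ h = a0 ∨ h = b0 := by
  obtain ⟨y, hy⟩ := leaf_nbr (H j) c
  obtain ⟨⟨w, hw⟩, hc⟩ := (ε j).surjective c
  have hw' : F.G.Adj (Sum.inr j) w := hw
  refine ⟨Sum.inr ⟨j, y⟩, gl F H ε w (Sum.inr j) hw'.symm, ?_, ?_⟩
  · intro e
    have := congrArg (proj F H) e
    rw [proj_gl] at this
    exact hw'.ne this
  · intro b
    rw [glue_adj]
    constructor
    · rintro (⟨j', x, z, h, e, rfl⟩ | ⟨v, u, h, e, rfl⟩)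
      · left
        obtain ⟨rfl, e⟩ := Sigma.mk.inj_iff.1 (Sum.inr_injective e)
        have e := eq_of_heq e
        subst e
        rw [(hy z).1 h]
      · right
        have e1 := congrArg (proj F H) e
        rw [proj_gl] at e1
        change Sum.inr j = v at e1
        subst e1
        have : gl F H ε (Sum.inr j) w hw' = gl F H ε (Sum.inr j) u h := by
          rw [← e, ← hc]; rfl
        have := gl_inj F H ε _ _ this
        subst this
        rfl
    · rintro (rfl | rfl)
      · exact Or.inl ⟨j, _, y, (hy y).2 rfl, rfl, rfl⟩
      · exact Or.inr ⟨Sum.inr j, w, hw', by rw [← hc]; rfl, rfl⟩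

theorem glue_two : Two (glueGraph F H ε) (IsGluePoint F H) := by
  constructor
  · rintro g h h' h'' ⟨j, c, rfl⟩ a1 a2 a3 n1 n2
    obtain ⟨a0, b0, hne, hi⟩ := glue_nbrs F H ε j c
    rw [hi] at a1 a2 a3
    grind
  · rintro g h ⟨j, c, rfl⟩ a1
    obtain ⟨a0, b0, hne, hi⟩ := glue_nbrs F H ε j c
    rw [hi] at a1
    rcases a1 with rfl | rfl
    · exact ⟨b0, (hi _).2 (Or.inr rfl), hne.symm⟩
    · exact ⟨a0, (hi _).2 (Or.inl rfl), hne⟩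

theorem comp_smooth : Smooth (glueGraph F H ε) (IsGluePoint F H) (compose F H ε) (embedV F H) := by
  have hr : ∀ x, ¬ IsGluePoint F H x ↔ ∃ u, embedV F H u = x := by
    intro x
    constructor
    · intro h
      rcases x with i | ⟨j, c | x⟩
      · exact ⟨Sum.inl i, rfl⟩
      · exact absurd ⟨j, c, rfl⟩ h
      · exact ⟨Sum.inr ⟨j, x⟩, rfl⟩
    · rintro ⟨u, rfl⟩ ⟨j, c, e⟩
      rcases u with i | ⟨j', x⟩
      · cases e
      · simp only [embedV] at e
        obtain ⟨rfl, e⟩ := Sigma.mk.inj_iff.1 (Sum.inr_injective e)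
        cases eq_of_heq e
  have hi : Function.Injective (embedV F H) := by
    rintro (i | ⟨j, x⟩) (i' | ⟨j', x'⟩) e
    · exact congrArg Sum.inl (Sum.inl_injective e)
    · cases e
    · cases e
    · simp only [embedV] at e
      obtain ⟨rfl, e⟩ := Sigma.mk.inj_iff.1 (Sum.inr_injective e)
      have := Sum.inr_injective (eq_of_heq e)
      subst this
      rfl
  refine ⟨glue_acyclic F H ε, glue_two F H ε, hi, hr, ?_⟩
  intro u u'
  have hu := (hr _).2 ⟨u, rfl⟩
  have hu' := (hr _).2 ⟨u', rfl⟩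
  rw [compose, SimpleGraph.fromRel_adj]
  constructor
  · rintro ⟨hne, ⟨p, -, hp⟩ | ⟨p, -, hp⟩⟩
    · exact nb_of_walk (fun e => hne (hi e)) hu' p hp
    · exact nb_symm hu' (nb_of_walk (fun e => hne (hi e).symm) hu p hp)
  · intro h
    refine ⟨?_, Or.inl ?_⟩
    · rintro rfl
      obtain ⟨g, a, t⟩ := h
      exact acyclic_side (glue_acyclic F H ε) a (t.mem_side (glue_acyclic F H ε) a)
    · exact walk_of_nb h

theorem comp_acyclic : (compose F H ε).IsAcyclic := (comp_smooth F H ε).acyclic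

theorem comp_leaf (i : Fin m) : ((compose F H ε).neighborSet (Sum.inl i)).ncard = 1 := by
  rw [(comp_smooth F H ε).degree, Set.ncard_eq_one]
  obtain ⟨w, hw⟩ := leaf_nbr F i
  have h : F.G.Adj (Sum.inl i) w := (hw w).2 rfl
  refine ⟨gl F H ε w (Sum.inl i) h.symm, ?_⟩
  ext b
  rw [SimpleGraph.mem_neighborSet, glue_adj, Set.mem_singleton_iff]
  constructor
  · rintro (⟨j', x, z, h, e, rfl⟩ | ⟨v, u, h, e, rfl⟩)
    · cases e
    · have e1 := congrArg (proj F H) e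
      rw [proj_gl] at e1
      change Sum.inl i = v at e1
      subst e1
      have := (hw u).1 h
      subst this
      rfl
  · rintro rfl
    exact Or.inr ⟨_, _, h, rfl, rfl⟩

theorem comp_deg (j : Fin F.n) (x : Fin (H j).n) :
    ((compose F H ε).neighborSet (Sum.inr ⟨j, x⟩)).ncard = (H j).deg x := by
  rw [(comp_smooth F H ε).degree, GoodForest.deg]
  have : (glueGraph F H ε).neighborSet (embedV F H (Sum.inr ⟨j, x⟩)) =
      (fun y => (Sum.inr ⟨j, y⟩ : GlueV F H)) '' ((H j).G.neighborSet (Sum.inr x)) := by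
    ext b
    rw [SimpleGraph.mem_neighborSet, glue_adj, Set.mem_image]
    constructor
    · rintro (⟨j', x', z, h, e, rfl⟩ | ⟨v, u, h, e, rfl⟩)
      · obtain ⟨rfl, e⟩ := Sigma.mk.inj_iff.1 (Sum.inr_injective e)
        have e := eq_of_heq e
        subst e
        exact ⟨z, h, rfl⟩
      · exfalso
        rcases v with i | j'
        · cases e
        · obtain ⟨rfl, e⟩ := Sigma.mk.inj_iff.1 (Sum.inr_injective e)
          cases eq_of_heq e
    · rintro ⟨y, h, rfl⟩
      exact Or.inl ⟨j, _, y, h, rfl, rfl⟩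
  rw [this, Set.ncard_image_of_injective]
  intro y y' e
  exact inr_inj F H e

end Glue

theorem iso_ncard {V W : Type} {G : SimpleGraph V} {G' : SimpleGraph W} (φ : G ≃g G') (v : V) :
    (G'.neighborSet (φ v)).ncard = (G.neighborSet v).ncard := by
  have : G'.neighborSet (φ v) = φ '' G.neighborSet v := by
    ext w
    rw [SimpleGraph.mem_neighborSet, Set.mem_image]
    constructor
    · intro h
      refine ⟨φ.symm w, ?_, by simp⟩
      rw [SimpleGraph.mem_neighborSet, ← φ.map_adj_iff]
      simpa using h
    · rintro ⟨u, hu, rfl⟩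
      exact φ.map_adj_iff.2 hu
  rw [this, Set.ncard_image_of_injective _ φ.injective]

theorem iso_acyclic {V W : Type} {G : SimpleGraph V} {G' : SimpleGraph W} (φ : G ≃g G')
    (h : G.IsAcyclic) : G'.IsAcyclic := by
  exact (SimpleGraph.Iso.isAcyclic_iff φ).1 h

theorem exists_gf {m : ℕ} {V : Type} [Finite V] (K : SimpleGraph (Fin m ⊕ V)) (h1 : K.IsAcyclic)
    (h2 : ∀ i, (K.neighborSet (Sum.inl i)).ncard = 1)
    (h3 : ∀ j, Even (K.neighborSet (Sum.inr j)).ncard)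
    (h4 : ∀ j, 4 ≤ (K.neighborSet (Sum.inr j)).ncard) :
    ∃ F : GoodForest m, ∃ φ : F.G ≃g K, ∀ i, φ (Sum.inl i) = Sum.inl i := by
  obtain ⟨n, ⟨e⟩⟩ := Finite.exists_equiv_fin V
  let f : Fin m ⊕ Fin n ≃ Fin m ⊕ V := Equiv.sumCongr (Equiv.refl _) e.symm
  let φ : K.comap f ≃g K := SimpleGraph.Iso.comap f K
  have hd : ∀ v, ((K.comap f).neighborSet v).ncard = (K.neighborSet (f v)).ncard := fun v =>
    (iso_ncard φ v).symm
  refine ⟨⟨n, K.comap f, iso_acyclic φ.symm h1, ?_, ?_, ?_⟩, φ, ?_⟩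
  · intro i; rw [hd]; exact h2 i
  · intro i; rw [hd]; exact h3 _
  · intro i; rw [hd]; exact h4 _
  · intro i; rfl

theorem exists_comp {m : ℕ} (F : GoodForest m) (H : (j : Fin F.n) → GoodForest (F.deg j))
    (ε : (j : Fin F.n) → (F.G.neighborSet (Sum.inr j)) ≃ Fin (F.deg j)) :
    ∃ F' : GoodForest m, ∃ φ : F'.G ≃g GoodForest.compose F H ε,
      ∀ i, φ (Sum.inl i) = Sum.inl i := by
  apply exists_gf _ (comp_acyclic F H ε) (comp_leaf F H ε)
  · rintro ⟨j, x⟩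
    rw [comp_deg]
    exact (H j).internal_degree_even x
  · rintro ⟨j, x⟩
    rw [comp_deg]
    exact (H j).internal_degree_ge x

end GFM

namespace GFM

/-- leaf sets of one-edge cuts -/
def LC {m : ℕ} {V : Type} (G : SimpleGraph (Fin m ⊕ V)) (C : Set (Fin m)) : Prop :=
  ∃ S : Set (Fin m ⊕ V), Cut1 G S ∧ ∀ i, Sum.inl i ∈ S ↔ i ∈ C

theorem LC.iso {m : ℕ} {V W : Type} {G : SimpleGraph (Fin m ⊕ V)} {G' : SimpleGraph (Fin m ⊕ W)}
    (φ : G ≃g G') (hφ : ∀ i, φ (Sum.inl i) = Sum.inl i) {C : Set (Fin m)} (h : LC G' C) :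
    LC G C := by
  obtain ⟨S, h1, h2⟩ := h
  refine ⟨φ ⁻¹' S, ?_, ?_⟩
  · intro x y x' y' c c'
    have := h1 (φ x) (φ y) (φ x') (φ y') ⟨φ.map_adj_iff.2 c.1, c.2.1, c.2.2⟩
      ⟨φ.map_adj_iff.2 c'.1, c'.2.1, c'.2.2⟩
    exact ⟨φ.injective this.1, φ.injective this.2⟩
  · intro i
    rw [Set.mem_preimage, hφ, h2]

theorem iso_symm_leaf {m : ℕ} {V W : Type} {G : SimpleGraph (Fin m ⊕ V)}
    {G' : SimpleGraph (Fin m ⊕ W)}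
    (φ : G ≃g G') (hφ : ∀ i, φ (Sum.inl i) = Sum.inl i) (i : Fin m) :
    φ.symm (Sum.inl i) = Sum.inl i := by
  rw [← hφ i]; simp

theorem LC.iso_iff {m : ℕ} {V W : Type} {G : SimpleGraph (Fin m ⊕ V)}
    {G' : SimpleGraph (Fin m ⊕ W)}
    (φ : G ≃g G') (hφ : ∀ i, φ (Sum.inl i) = Sum.inl i) {C : Set (Fin m)} :
    LC G C ↔ LC G' C :=
  ⟨LC.iso φ.symm (iso_symm_leaf φ hφ), LC.iso φ hφ⟩

section SmoothIso
variable {W W' U U' : Type} {Γ : SimpleGraph W} {P : W → Prop} {Sm : SimpleGraph U} {e : U → W}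
  {Γ' : SimpleGraph W'} {P' : W' → Prop} {Sm' : SimpleGraph U'} {e' : U' → W'}

theorem Tm.map (ψ : Γ ≃g Γ') (hP : ∀ x, P x ↔ P' (ψ x)) {h g b : W} (t : Tm Γ P h g b) :
    Tm Γ' P' (ψ h) (ψ g) (ψ b) := by
  induction t with
  | base h1 => exact Tm.base (by rwa [← hP])
  | @step h g g' b h1 a1 n1 t1 ih =>
    exact Tm.step ((hP _).1 h1) (ψ.map_adj_iff.2 a1) (fun e => n1 (ψ.injective e)) ih

theorem NB.map (ψ : Γ ≃g Γ') (hP : ∀ x, P x ↔ P' (ψ x)) {b b' : W} (t : NB Γ P b b') :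
    NB Γ' P' (ψ b) (ψ b') := by
  obtain ⟨h, a, t⟩ := t
  exact ⟨ψ h, ψ.map_adj_iff.2 a, t.map ψ hP⟩

theorem NB.map_iff (ψ : Γ ≃g Γ') (hP : ∀ x, P x ↔ P' (ψ x)) {b b' : W} :
    NB Γ' P' (ψ b) (ψ b') ↔ NB Γ P b b' := by
  constructor
  · intro h
    have := h.map (P' := P) ψ.symm (fun x => by rw [hP]; simp)
    simpa using this
  · exact NB.map ψ hP

theorem Smooth.iso (h : Smooth Γ P Sm e) (h' : Smooth Γ' P' Sm' e') (ψ : Γ ≃g Γ')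
    (hP : ∀ x, P x ↔ P' (ψ x)) : ∃ θ : Sm ≃g Sm', ∀ u, e' (θ u) = ψ (e u) := by
  have ex : ∀ u, ∃ u', e' u' = ψ (e u) := fun u =>
    (h'.range _).1 (by rw [← hP]; exact h.notP u)
  choose f hf using ex
  have hb : Function.Bijective f := by
    constructor
    · intro u v huv
      apply h.inj
      apply ψ.injective
      rw [← hf, ← hf, huv]
    · intro u'
      have : ¬ P (ψ.symm (e' u')) := by
        rw [hP]; simpa using h'.notP u'
      obtain ⟨u, hu⟩ := (h.range _).1 this
      refine ⟨u, h'.inj ?_⟩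
      rw [hf, hu]; simp
  refine ⟨⟨Equiv.ofBijective f hb, ?_⟩, hf⟩
  intro a b
  change Sm'.Adj (f a) (f b) ↔ _
  rw [h'.adj, h.adj, hf, hf, NB.map_iff ψ hP]

end SmoothIso

section Glue
open GoodForest

variable {m : ℕ} (F : GoodForest m) (H : (j : Fin F.n) → GoodForest (F.deg j))
  (ε : (j : Fin F.n) → (F.G.neighborSet (Sum.inr j)) ≃ Fin (F.deg j))

/-- terminal vertex of a dart inside `H j` -/
theorem tm_term {j : Fin F.n} {x y : Fin (F.deg j) ⊕ Fin (H j).n} (a : (H j).G.Adj x y)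
    {b : GlueV F H} (t : Tm (glueGraph F H ε) (IsGluePoint F H) (Sum.inr ⟨j, x⟩) (Sum.inr ⟨j, y⟩) b) :
    (∃ z, y = Sum.inr z ∧ b = Sum.inr ⟨j, Sum.inr z⟩) ∨
    (∃ (w : _) (h : F.G.Adj (Sum.inr j) w), y = Sum.inl (ε j ⟨w, h⟩) ∧
      proj F H b ∈ side F.G (Sum.inr j) w) := by
  rcases y with c | z
  · right
    obtain ⟨⟨w, hw⟩, hc⟩ := (ε j).surjective c
    have hw' : F.G.Adj (Sum.inr j) w := hw
    refine ⟨w, hw', by rw [← hc], ?_⟩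
    cases t with
    | base h1 => exact absurd ⟨j, c, rfl⟩ h1
    | @step _ _ g' _ h1 a1 n1 t1 =>
      have a1' := a1
      rw [glue_adj] at a1'
      have hg : g' = gl F H ε w (Sum.inr j) hw'.symm := by
        rcases a1' with ⟨j', x', z, h, e, rfl⟩ | ⟨v, u, h, e, rfl⟩
        · exfalso
          obtain ⟨rfl, e⟩ := Sigma.mk.inj_iff.1 (Sum.inr_injective e)
          have e := eq_of_heq e
          subst e
          obtain ⟨y0, hy0⟩ := leaf_nbr (H j) c
          apply n1
          rw [(hy0 z).1 h, (hy0 x).1 a.symm]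
        · have e1 := congrArg (proj F H) e
          rw [proj_gl] at e1
          change Sum.inr j = v at e1
          subst e1
          have : gl F H ε (Sum.inr j) w hw' = gl F H ε (Sum.inr j) u h := by
            rw [← e, ← hc]; rfl
          have := gl_inj F H ε _ _ this
          subst this
          rfl
      have hgl : (Sum.inr ⟨j, Sum.inl c⟩ : GlueV F H) = gl F H ε (Sum.inr j) w hw' := by
        rw [← hc]; rfl
      have hs := t1.mem_side (glue_acyclic F H ε) a1
      rw [hg, hgl] at hs
      have : side (glueGraph F H ε) (gl F H ε (Sum.inr j) w hw') (gl F H ε w (Sum.inr j) hw'.symm) ⊆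
          proj F H ⁻¹' side F.G (Sum.inr j) w := by
        apply side_min
        · rw [Set.mem_preimage, proj_gl]; exact mem_side_self _ _
        · intro p q hpq hp _ hne
          by_contra hq
          obtain ⟨v, u, h, hcr, rfl, rfl⟩ := proj_cross F H ε ⟨hpq, hp, hq⟩
          obtain ⟨rfl, rfl⟩ := cross_side F.acyclic hw' hcr
          exact hne Sym2.eq_swap
      exact this hs
  · left
    refine ⟨z, rfl, t.eq_of_notP ?_⟩
    rintro ⟨j', c, e⟩
    obtain ⟨rfl, e⟩ := Sigma.mk.inj_iff.1 (Sum.inr_injective e)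
    cases eq_of_heq e

/-- leaves of the composition behind the leaves `C` of `H j` -/
def bhd (j : Fin F.n) (C : Set (Fin (F.deg j))) : Set (Fin m) :=
  {i | ∃ (w : _) (h : F.G.Adj (Sum.inr j) w), Sum.inl i ∈ side F.G (Sum.inr j) w ∧ ε j ⟨w, h⟩ ∈ C}

theorem LC_comp1 {j : Fin F.n} {C : Set (Fin (F.deg j))} (h : LC (H j).G C) :
    LC (compose F H ε) (bhd F ε j C) := by
  obtain ⟨S, hS, hC⟩ := h
  refine ⟨embedV F H ⁻¹' lift F H ε j S, (comp_smooth F H ε).cut1 (lift_cut1 F H ε hS), ?_⟩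
  intro i
  constructor
  · rintro (⟨x, -, e⟩ | ⟨w, h, h1, h2⟩)
    · cases e
    · exact ⟨w, h, h1, (hC _).1 h2⟩
  · rintro ⟨w, h, h1, h2⟩
    exact Or.inr ⟨w, h, h1, (hC _).2 h2⟩

theorem LC_comp2 {j : Fin F.n} {C : Set (Fin (F.deg j))}
    (h : LC (compose F H ε) (bhd F ε j C)) : LC (H j).G C := by
  obtain ⟨S', hS', hC⟩ := h
  have sm := comp_smooth F H ε
  have hT : ∀ w, F.G.Adj (Sum.inr j) w →
      Cut1 (compose F H ε) (embedV F H ⁻¹' (proj F H ⁻¹' side F.G (Sum.inr j) w)) := fun w h =>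
    sm.cut1 (proj_cut1 F H ε (side_cut1 F.acyclic h))
  have hdeg : ∀ x : Σ j : Fin F.n, Fin (H j).n,
      4 ≤ ((compose F H ε).neighborSet (Sum.inr x)).ncard := by
    rintro ⟨j, x⟩
    rw [comp_deg]
    exact (H j).internal_degree_ge x
  have hsub : ∀ w (h : F.G.Adj (Sum.inr j) w), ε j ⟨w, h⟩ ∈ C →
      (embedV F H ⁻¹' (proj F H ⁻¹' side F.G (Sum.inr j) w)) ⊆ S' := by
    intro w h hc
    apply cut_sub (comp_acyclic F H ε) (hT w h) hS'
    rintro (i | x) h1 h2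
    · exact absurd ((hC i).2 ⟨w, h, h1, hc⟩) h2
    · exact hdeg x
  have hdis : ∀ w (h : F.G.Adj (Sum.inr j) w), ε j ⟨w, h⟩ ∉ C →
      Disjoint S' (embedV F H ⁻¹' (proj F H ⁻¹' side F.G (Sum.inr j) w)) := by
    intro w h hc
    apply cut_disj (comp_acyclic F H ε) hS' (hT w h)
    rintro (i | x) h1 h2
    · exfalso
      obtain ⟨w', h', h3, h4⟩ := (hC i).1 h1
      by_cases hw : w = w'
      · subst hw; exact hc h4
      · exact Set.disjoint_left.1 (side_disj_nbr F.acyclic h h' hw) h2 h3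
    · exact hdeg x
  set S : Set (Fin (F.deg j) ⊕ Fin (H j).n) :=
    {y | (∃ x, y = Sum.inr x ∧ (Sum.inr ⟨j, x⟩ : CompV F H) ∈ S') ∨ ∃ c ∈ C, y = Sum.inl c} with hSdef
  have hSinl : ∀ c, Sum.inl c ∈ S ↔ c ∈ C := by
    intro c; simp [hSdef]
  have hSinr : ∀ x, Sum.inr x ∈ S ↔ (Sum.inr ⟨j, x⟩ : CompV F H) ∈ S' := by
    intro c; simp [hSdef]
  have hterm : ∀ x y, (H j).G.Adj x y → ∃ u, Tm (glueGraph F H ε) (IsGluePoint F H)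
      (Sum.inr ⟨j, x⟩) (Sum.inr ⟨j, y⟩) (embedV F H u) := by
    intro x y a
    obtain ⟨b, hb⟩ := Tm.ex sm.acyc sm.two (glue_H F H ε a)
    obtain ⟨u, rfl⟩ := (sm.range b).1 hb.notP
    exact ⟨u, hb⟩
  have hmem : ∀ x y, (H j).G.Adj x y → ∀ u, Tm (glueGraph F H ε) (IsGluePoint F H)
      (Sum.inr ⟨j, x⟩) (Sum.inr ⟨j, y⟩) (embedV F H u) → (u ∈ S' ↔ y ∈ S) := by
    intro x y a u t
    rcases tm_term F H ε a t with ⟨z, rfl, e⟩ | ⟨w, h, rfl, h1⟩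
    · have : u = Sum.inr ⟨j, z⟩ := sm.inj e
      rw [this, hSinr]
    · rw [hSinl]
      constructor
      · intro hu
        by_contra hc
        exact Set.disjoint_left.1 (hdis w h hc) hu h1
      · intro hc
        exact hsub w h hc h1
  have huniq : ∀ x y, (H j).G.Adj x y → ∀ x' y', (H j).G.Adj x' y' →
      ∀ u, Tm (glueGraph F H ε) (IsGluePoint F H)
      (Sum.inr ⟨j, x⟩) (Sum.inr ⟨j, y⟩) (embedV F H u) → Tm (glueGraph F H ε) (IsGluePoint F H)
      (Sum.inr ⟨j, x'⟩) (Sum.inr ⟨j, y'⟩) (embedV F H u) → y = y' := by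
    intro x y a x' y' a' u t t'
    rcases tm_term F H ε a t with ⟨z, rfl, e⟩ | ⟨w, h, rfl, h1⟩ <;>
    rcases tm_term F H ε a' t' with ⟨z', rfl, e'⟩ | ⟨w', h', rfl, h1'⟩
    · rw [e] at e'
      exact inr_inj F H e'
    · rw [e] at h1'
      exact absurd h1' (acyclic_side F.acyclic h')
    · rw [e'] at h1
      exact absurd h1 (acyclic_side F.acyclic h)
    · by_cases hw : w = w'
      · subst hw; rfl
      · exact absurd h1' (Set.disjoint_left.1 (side_disj_nbr F.acyclic h h' hw) h1)
  refine ⟨S, ?_, hSinl⟩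
  intro x y x' y' c c'
  obtain ⟨u, hu⟩ := hterm x y c.1
  obtain ⟨v, hv⟩ := hterm y x c.1.symm
  obtain ⟨u', hu'⟩ := hterm x' y' c'.1
  obtain ⟨v', hv'⟩ := hterm y' x' c'.1.symm
  have a1 := sm.adj_of_dart (glue_H F H ε c.1) hu hv
  have a2 := sm.adj_of_dart (glue_H F H ε c'.1) hu' hv'
  have := hS' v u v' u' ⟨a1, (hmem _ _ c.1.symm _ hv).2 c.2.1, fun h => c.2.2 ((hmem _ _ c.1 _ hu).1 h)⟩
    ⟨a2, (hmem _ _ c'.1.symm _ hv').2 c'.2.1, fun h => c'.2.2 ((hmem _ _ c'.1 _ hu').1 h)⟩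
  obtain ⟨rfl, rfl⟩ := this
  exact ⟨huniq _ _ c.1.symm _ _ c'.1.symm _ hv hv', huniq _ _ c.1 _ _ c'.1 _ hu hu'⟩

theorem LC_comp {j : Fin F.n} {C : Set (Fin (F.deg j))} :
    LC (H j).G C ↔ LC (compose F H ε) (bhd F ε j C) :=
  ⟨LC_comp1 F H ε, LC_comp2 F H ε⟩

theorem comp_iso (H' : (j : Fin F.n) → GoodForest (F.deg j))
    (ε' : (j : Fin F.n) → (F.G.neighborSet (Sum.inr j)) ≃ Fin (F.deg j))
    (φ : ∀ j, (H j).G ≃g (H' j).G)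
    (hφ : ∀ j w, φ j (Sum.inl (ε j w)) = Sum.inl (ε' j w)) :
    ∃ θ : compose F H ε ≃g compose F H' ε', ∀ i, θ (Sum.inl i) = Sum.inl i := by
  let f : GlueV F H ≃ GlueV F H' :=
    Equiv.sumCongr (Equiv.refl _) (Equiv.sigmaCongrRight (fun j => (φ j).toEquiv))
  have f1 : ∀ i, f (Sum.inl i) = Sum.inl i := fun i => rfl
  have f2 : ∀ j x, f (Sum.inr ⟨j, x⟩) = Sum.inr ⟨j, φ j x⟩ := fun j x => rfl
  have f3 : ∀ v w h, f (gl F H ε v w h) = gl F H' ε' v w h := by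
    intro v w h
    rcases v with i | j
    · rfl
    · have := f2 j (Sum.inl (ε j ⟨w, h⟩))
      rw [hφ] at this
      exact this
  let ψ : glueGraph F H ε ≃g glueGraph F H' ε' := ⟨f, by
    intro a b
    rw [glue_adj, glue_adj]
    constructor
    · rintro (⟨j, x, y, h, e1, e2⟩ | ⟨v, w, h, e1, e2⟩)
      · left
        refine ⟨j, (φ j).symm x, (φ j).symm y, (φ j).symm.map_adj_iff.2 h, ?_, ?_⟩
        · apply f.injective
          rw [e1, f2]; simp
        · apply f.injective
          rw [e2, f2]; simp
      · right
        refine ⟨v, w, h, ?_, ?_⟩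
        · apply f.injective
          rw [e1, f3]
        · apply f.injective
          rw [e2, f3]
    · rintro (⟨j, x, y, h, rfl, rfl⟩ | ⟨v, w, h, rfl, rfl⟩)
      · exact Or.inl ⟨j, φ j x, φ j y, (φ j).map_adj_iff.2 h, rfl, rfl⟩
      · exact Or.inr ⟨v, w, h, f3 _ _ _, f3 _ _ _⟩⟩
  have hP : ∀ x, IsGluePoint F H x ↔ IsGluePoint F H' (ψ x) := by
    intro x
    change _ ↔ IsGluePoint F H' (f x)
    constructor
    · rintro ⟨j, c, rfl⟩
      obtain ⟨w, rfl⟩ := (ε j).surjective c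
      exact ⟨j, ε' j w, by rw [f2, hφ]⟩
    · rintro ⟨j, c, e⟩
      obtain ⟨w, rfl⟩ := (ε' j).surjective c
      refine ⟨j, ε j w, ?_⟩
      apply f.injective
      rw [e, f2, hφ]
  obtain ⟨θ, hθ⟩ := (comp_smooth F H ε).iso (comp_smooth F H' ε') ψ hP
  refine ⟨θ, fun i => ?_⟩
  apply (comp_smooth F H' ε').inj
  rw [hθ]
  rfl

end Glue
end GFM

namespace GFM

section Fam

variable {m : ℕ}

/-- members of the family together with all singletons -/
def Pl (C : Finset (Finset (Fin m))) (E : Finset (Fin m)) : Prop := E ∈ C ∨ E.card = 1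

/-- children of `D` -/
noncomputable def ch (C : Finset (Finset (Fin m))) (D : Finset (Fin m)) :
    Finset (Finset (Fin m)) :=
  Finset.univ.filter (fun E => Pl C E ∧ E ⊂ D ∧ ∀ E', Pl C E' → E ⊆ E' → E' ⊂ D → E' = E)

theorem mem_ch {C : Finset (Finset (Fin m))} {D E : Finset (Fin m)} :
    E ∈ ch C D ↔ Pl C E ∧ E ⊂ D ∧ ∀ E', Pl C E' → E ⊆ E' → E' ⊂ D → E' = E := by
  simp [ch]

noncomputable def wt (C : Finset (Finset (Fin m))) : ℤ :=
  ∏ D ∈ C, -(((ch C D).card - 1).factorial : ℤ)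

/-- laminar family of odd sets of size at least three -/
structure Od (C : Finset (Finset (Fin m))) : Prop where
  odd : ∀ D ∈ C, Odd D.card
  three : ∀ D ∈ C, 3 ≤ D.card
  lam : ∀ A ∈ C, ∀ B ∈ C, A ⊆ B ∨ B ⊆ A ∨ Disjoint A B

theorem Od.plOdd {C : Finset (Finset (Fin m))} (h : Od C) {E} (hE : Pl C E) : Odd E.card := by
  rcases hE with hE | hE
  · exact h.odd E hE
  · rw [hE]; exact odd_one

theorem Od.plNe {C : Finset (Finset (Fin m))} (h : Od C) {E} (hE : Pl C E) : E.Nonempty := by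
  rw [← Finset.card_pos]; exact (h.plOdd hE).pos

theorem Od.plLam {C : Finset (Finset (Fin m))} (h : Od C) {A B} (hA : Pl C A) (hB : Pl C B) :
    A ⊆ B ∨ B ⊆ A ∨ Disjoint A B := by
  rcases hA with hA | hA
  · rcases hB with hB | hB
    · exact h.lam A hA B hB
    · obtain ⟨x, rfl⟩ := Finset.card_eq_one.1 hB
      by_cases hx : x ∈ A
      · right; left; simpa using hx
      · right; right; simpa using hx
  · obtain ⟨x, rfl⟩ := Finset.card_eq_one.1 hA
    by_cases hx : x ∈ B
    · left; simpa using hx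
    · right; right; simpa using hx

theorem pl_single (C : Finset (Finset (Fin m))) (x : Fin m) : Pl C {x} := Or.inr (by simp)

/-- each proper Pl subset lies in a child -/
theorem ch_above {C : Finset (Finset (Fin m))} {D E : Finset (Fin m)} (hE : Pl C E) (hED : E ⊂ D) :
    ∃ E' ∈ ch C D, E ⊆ E' := by
  obtain ⟨E', hE', hmax⟩ := Finset.exists_max_image
    (Finset.univ.filter (fun E' => Pl C E' ∧ E ⊆ E' ∧ E' ⊂ D)) Finset.card
    ⟨E, by simp [hE, hED]⟩
  simp only [Finset.mem_filter, Finset.mem_univ, true_and] at hE' hmax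
  refine ⟨E', mem_ch.2 ⟨hE'.1, hE'.2.2, fun F hF h1 h2 => ?_⟩, hE'.2.1⟩
  exact (Finset.eq_of_subset_of_card_le h1 (hmax F ⟨hF, hE'.2.1.trans h1, h2⟩)).symm

theorem ch_cover {C : Finset (Finset (Fin m))} {D : Finset (Fin m)} (hD : 2 ≤ D.card) {x : Fin m}
    (hx : x ∈ D) : ∃ E ∈ ch C D, x ∈ E := by
  have : ({x} : Finset (Fin m)) ⊂ D := by
    rw [Finset.ssubset_iff_subset_ne]
    refine ⟨by simpa using hx, ?_⟩
    rintro rfl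
    simp at hD
  obtain ⟨E, h1, h2⟩ := ch_above (pl_single C x) this
  exact ⟨E, h1, by simpa using h2⟩

theorem Od.ch_disj {C : Finset (Finset (Fin m))} (h : Od C) {D E F : Finset (Fin m)}
    (hE : E ∈ ch C D) (hF : F ∈ ch C D) (hne : E ≠ F) : Disjoint E F := by
  rw [mem_ch] at hE hF
  rcases h.plLam hE.1 hF.1 with h1 | h1 | h1
  · exact absurd (hE.2.2 F hF.1 h1 hF.2.1).symm hne
  · exact absurd (hF.2.2 E hE.1 h1 hE.2.1) hne
  · exact h1

theorem Od.ch_union {C : Finset (Finset (Fin m))} {D : Finset (Fin m)} (hD : 2 ≤ D.card) :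
    (ch C D).biUnion id = D := by
  ext x
  simp only [Finset.mem_biUnion, id]
  constructor
  · rintro ⟨E, hE, hx⟩
    exact (mem_ch.1 hE).2.1.1 hx
  · exact fun hx => ch_cover hD hx

theorem Od.ch_card {C : Finset (Finset (Fin m))} (h : Od C) {D : Finset (Fin m)}
    (hD : D ∈ C) : Odd (ch C D).card ∧ 3 ≤ (ch C D).card := by
  have hd : 2 ≤ D.card := by have := h.three D hD; omega
  have h1 : D.card = ∑ E ∈ ch C D, E.card := by
    conv_lhs => rw [← Od.ch_union (C := C) hd]
    rw [Finset.card_biUnion]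
    · rfl
    · intro x hx y hy hxy
      exact h.ch_disj hx hy hxy
  have hodd : Odd (ch C D).card := by
    have h2 := h.odd D hD
    rw [h1, Finset.odd_sum_iff_odd_card_odd] at h2
    rwa [Finset.filter_true_of_mem] at h2
    intro E hE
    exact h.plOdd (mem_ch.1 hE).1
  refine ⟨hodd, ?_⟩
  by_contra hlt
  have h3 : (ch C D).card = 1 := by
    obtain ⟨k, hk⟩ := hodd
    omega
  obtain ⟨E, hE⟩ := Finset.card_eq_one.1 h3
  have hE' : E ∈ ch C D := by rw [hE]; simp
  have h4 := Od.ch_union (C := C) hd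
  rw [hE] at h4
  simp at h4
  exact (mem_ch.1 hE').2.1.ne h4

theorem Od.up_unique {C : Finset (Finset (Fin m))} (h : Od C) {D D' E : Finset (Fin m)}
    (hD : D ∈ C) (hD' : D' ∈ C) (h1 : E ∈ ch C D) (h2 : E ∈ ch C D') : D = D' := by
  rw [mem_ch] at h1 h2
  by_contra hne
  rcases h.lam D hD D' hD' with h3 | h3 | h3
  · have := h2.2.2 D (Or.inl hD) h1.2.1.1 (Finset.ssubset_iff_subset_ne.2 ⟨h3, hne⟩)
    exact h1.2.1.ne this.symm
  · have := h1.2.2 D' (Or.inl hD') h2.2.1.1 (Finset.ssubset_iff_subset_ne.2 ⟨h3, Ne.symm hne⟩)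
    exact h2.2.1.ne this.symm
  · obtain ⟨x, hx⟩ := h.plNe h1.1
    exact Finset.disjoint_left.1 h3 (h1.2.1.1 hx) (h2.2.1.1 hx)

theorem Od.up_exists {C : Finset (Finset (Fin m))} (h : Od C) {D E : Finset (Fin m)}
    (hE : Pl C E) (hD : D ∈ C) (hED : E ⊂ D) : ∃ D' ∈ C, E ∈ ch C D' ∧ D' ⊆ D := by
  obtain ⟨D', hD', hmin⟩ := Finset.exists_min_image
    (C.filter (fun D' => E ⊂ D')) Finset.card ⟨D, by simp [hD, hED]⟩
  simp only [Finset.mem_filter] at hD' hmin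
  have hmin' : ∀ F ∈ C, E ⊂ F → F ⊆ D' → F = D' := fun F hF h1 h2 =>
    Finset.eq_of_subset_of_card_le h2 (hmin F ⟨hF, h1⟩)
  refine ⟨D', hD'.1, mem_ch.2 ⟨hE, hD'.2, ?_⟩, ?_⟩
  · intro F hF h1 h2
    by_contra hne
    have h3 : E ⊂ F := Finset.ssubset_iff_subset_ne.2 ⟨h1, Ne.symm hne⟩
    rcases hF with hF | hF
    · exact h2.ne (hmin' F hF h3 h2.1)
    · have := Finset.card_lt_card h3
      have := (h.plNe hE).card_pos
      omega
  · rcases h.lam D' hD'.1 D hD with h1 | h1 | h1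
    · exact h1
    · rw [hmin' D hD hED h1]
    · obtain ⟨x, hx⟩ := h.plNe hE
      exact absurd (hED.1 hx) (Finset.disjoint_left.1 h1 (hD'.2.1 hx))

theorem ch_eq {C : Finset (Finset (Fin m))} {D : Finset (Fin m)} {Q : Finset (Finset (Fin m))}
    (h1 : ∀ E ∈ Q, Pl C E ∧ E ⊂ D) (h2 : ∀ E, Pl C E → E ⊂ D → ∃ F ∈ Q, E ⊆ F)
    (h3 : ∀ E ∈ Q, ∀ F ∈ Q, E ⊆ F → E = F) : ch C D = Q := by
  ext E
  rw [mem_ch]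
  constructor
  · rintro ⟨hE, hED, hm⟩
    obtain ⟨F, hF, hEF⟩ := h2 E hE hED
    rw [← hm F (h1 F hF).1 hEF (h1 F hF).2]
    exact hF
  · intro hE
    refine ⟨(h1 E hE).1, (h1 E hE).2, fun E' hE' h4 h5 => ?_⟩
    obtain ⟨F, hF, hEF⟩ := h2 E' hE' h5
    have := h3 E hE F hF (h4.trans hEF)
    subst this
    exact hEF.antisymm h4

theorem ch_congr {C C' : Finset (Finset (Fin m))} {D : Finset (Fin m)}
    (h : ∀ E, E ⊂ D → (E ∈ C ↔ E ∈ C')) : ch C D = ch C' D := by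
  have h' : ∀ E, E ⊂ D → (Pl C E ↔ Pl C' E) := fun E hE => by
    unfold Pl; rw [h E hE]
  ext E
  rw [mem_ch, mem_ch]
  constructor
  · rintro ⟨a, b, c⟩
    exact ⟨(h' E b).1 a, b, fun E' d e f => c E' ((h' E' f).2 d) e f⟩
  · rintro ⟨a, b, c⟩
    exact ⟨(h' E b).2 a, b, fun E' d e f => c E' ((h' E' f).1 d) e f⟩

end Fam
end GFM

namespace GFM

section Fam

variable {m : ℕ}

theorem exists_other {Q : Finset (Finset (Fin m))} (hQ : 2 ≤ Q.card) (E : Finset (Fin m)) :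
    ∃ F ∈ Q, F ≠ E := by
  by_contra hc
  push Not at hc
  have : Q ⊆ {E} := fun F hF => by simpa using hc F hF
  have := Finset.card_le_card this
  simp at this
  omega

structure Ins (C : Finset (Finset (Fin m))) (D : Finset (Fin m)) (Q : Finset (Finset (Fin m))) :
    Prop where
  od : Od C
  mem : D ∈ C
  sub : Q ⊆ ch C D
  three : Q.card = 3
  five : 5 ≤ (ch C D).card

variable {C Q : Finset (Finset (Fin m))} {D D0 E F : Finset (Fin m)}

theorem Ins.ssub (h : Ins C D Q) : Q.biUnion id ⊂ D := by
  have h1 : Q.biUnion id ⊆ D := by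
    rw [Finset.biUnion_subset]
    exact fun E hE => (mem_ch.1 (h.sub hE)).2.1.1
  obtain ⟨E, hE, hEQ⟩ : ∃ E ∈ ch C D, E ∉ Q := by
    by_contra hc
    push Not at hc
    have := Finset.card_le_card (show ch C D ⊆ Q from hc)
    have := h.three
    have := h.five
    omega
  refine Finset.ssubset_iff_subset_ne.2 ⟨h1, fun he => ?_⟩
  obtain ⟨x, hx⟩ := h.od.plNe (mem_ch.1 hE).1
  have hx' : x ∈ Q.biUnion id := by rw [he]; exact (mem_ch.1 hE).2.1.1 hx
  simp only [Finset.mem_biUnion, id] at hx'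
  obtain ⟨F, hF, hxF⟩ := hx'
  have hne : E ≠ F := by rintro rfl; exact hEQ hF
  exact Finset.disjoint_left.1 (h.od.ch_disj hE (h.sub hF) hne) hx hxF

theorem Ins.mem_ssub (h : Ins C D Q) (hE : E ∈ Q) : E ⊂ Q.biUnion id := by
  refine Finset.ssubset_iff_subset_ne.2 ⟨Finset.subset_biUnion_of_mem id hE, fun he => ?_⟩
  obtain ⟨F, hF, hne⟩ := exists_other (by rw [h.three]; norm_num) (Q := Q) E
  obtain ⟨x, hx⟩ := h.od.plNe (mem_ch.1 (h.sub hF)).1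
  have : x ∈ E := by rw [he]; exact Finset.mem_biUnion.2 ⟨F, hF, hx⟩
  exact Finset.disjoint_left.1 (h.od.ch_disj (h.sub hF) (h.sub hE) hne) hx this

theorem Ins.below (h : Ins C D Q) (hF : Pl C F) (hs : F ⊆ Q.biUnion id) : ∃ E ∈ Q, F ⊆ E := by
  obtain ⟨E, hE, hFE⟩ := ch_above hF (Finset.ssubset_of_subset_of_ssubset hs h.ssub)
  refine ⟨E, ?_, hFE⟩
  obtain ⟨x, hx⟩ := h.od.plNe hF
  have := hs hx
  simp only [Finset.mem_biUnion, id] at this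
  obtain ⟨E', hE', hx'⟩ := this
  by_cases he : E = E'
  · rwa [he]
  · exact absurd hx' (Finset.disjoint_left.1 (h.od.ch_disj hE (h.sub hE') he) (hFE hx))

theorem Ins.notPl (h : Ins C D Q) : ¬ Pl C (Q.biUnion id) := fun hp => by
  obtain ⟨E, hE, hs⟩ := h.below hp (le_refl _)
  exact (h.mem_ssub hE).2 hs

theorem Ins.not_mem (h : Ins C D Q) : Q.biUnion id ∉ C := fun hp => h.notPl (Or.inl hp)

theorem Ins.above (h : Ins C D Q) (hF : Pl C F) (hs : Q.biUnion id ⊆ F) : D ⊆ F := by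
  have hne : (Q.biUnion id).Nonempty := by
    obtain ⟨E, hE, -⟩ := exists_other (by rw [h.three]; norm_num) (Q := Q) ∅
    obtain ⟨x, hx⟩ := h.od.plNe (mem_ch.1 (h.sub hE)).1
    exact ⟨x, Finset.mem_biUnion.2 ⟨E, hE, hx⟩⟩
  rcases h.od.plLam hF (Or.inl h.mem) with h1 | h1 | h1
  · by_cases he : F = D
    · rw [he]
    · exfalso
      obtain ⟨E, hE, hFE⟩ := ch_above hF (Finset.ssubset_iff_subset_ne.2 ⟨h1, he⟩)
      obtain ⟨E', hE', hne'⟩ := exists_other (by rw [h.three]; norm_num) (Q := Q) E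
      obtain ⟨x, hx⟩ := h.od.plNe (mem_ch.1 (h.sub hE')).1
      exact Finset.disjoint_left.1 (h.od.ch_disj (h.sub hE') hE hne') hx
        (hFE (hs (Finset.mem_biUnion.2 ⟨E', hE', hx⟩)))
  · exact h1
  · obtain ⟨x, hx⟩ := hne
    exact absurd (h.ssub.1 hx) (Finset.disjoint_left.1 h1 (hs hx))

theorem Ins.card_odd (h : Ins C D Q) : Odd (Q.biUnion id).card ∧ 3 ≤ (Q.biUnion id).card := by
  have h1 : (Q.biUnion id).card = ∑ E ∈ Q, E.card := by
    rw [Finset.card_biUnion]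
    · rfl
    · intro x hx y hy hxy
      exact h.od.ch_disj (h.sub hx) (h.sub hy) hxy
  have ho : ∀ E ∈ Q, Odd E.card := fun E hE => h.od.plOdd (mem_ch.1 (h.sub hE)).1
  rw [h1]
  constructor
  · rw [Finset.odd_sum_iff_odd_card_odd, Finset.filter_true_of_mem ho, h.three]
    decide
  · have := Finset.card_nsmul_le_sum Q Finset.card 1 (fun E hE => (ho E hE).pos)
    rw [h.three] at this
    simpa using this

theorem Ins.od' (h : Ins C D Q) : Od (insert (Q.biUnion id) C) := by
  have key : ∀ F ∈ C, Q.biUnion id ⊆ F ∨ F ⊆ Q.biUnion id ∨ Disjoint (Q.biUnion id) F := by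
    intro F hF
    rcases h.od.lam F hF D h.mem with h1 | h1 | h1
    · by_cases he : F = D
      · left; rw [he]; exact h.ssub.1
      · obtain ⟨E, hE, hFE⟩ := ch_above (Or.inl hF) (Finset.ssubset_iff_subset_ne.2 ⟨h1, he⟩)
        by_cases hEQ : E ∈ Q
        · right; left; exact hFE.trans (h.mem_ssub hEQ).1
        · right; right
          rw [Finset.disjoint_biUnion_left]
          intro E' hE'
          have hne : E' ≠ E := by rintro rfl; exact hEQ hE'
          exact Finset.disjoint_of_subset_right hFE (h.od.ch_disj (h.sub hE') hE hne)
    · left; exact h.ssub.1.trans h1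
    · right; right; exact (Finset.disjoint_of_subset_right h.ssub.1 h1).symm
  constructor
  · intro F hF
    rcases Finset.mem_insert.1 hF with rfl | hF
    · exact h.card_odd.1
    · exact h.od.odd F hF
  · intro F hF
    rcases Finset.mem_insert.1 hF with rfl | hF
    · exact h.card_odd.2
    · exact h.od.three F hF
  · intro A hA B hB
    rcases Finset.mem_insert.1 hA with rfl | hA
    · rcases Finset.mem_insert.1 hB with rfl | hB
      · left; exact le_refl _
      · exact key B hB
    · rcases Finset.mem_insert.1 hB with rfl | hB
      · rcases key A hA with h1 | h1 | h1
        · right; left; exact h1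
        · left; exact h1
        · right; right; exact h1.symm
      · exact h.od.lam A hA B hB

theorem pl_insert {E} : Pl (insert D0 C) E ↔ E = D0 ∨ Pl C E := by
  unfold Pl; rw [Finset.mem_insert, or_assoc]

theorem Od.anti (h : Od C) (hE : E ∈ ch C D) (hF : F ∈ ch C D) (hs : E ⊆ F) : E = F := by
  by_contra hne
  obtain ⟨x, hx⟩ := h.plNe (mem_ch.1 hE).1
  exact Finset.disjoint_left.1 (h.ch_disj hE hF hne) hx (hs hx)

theorem Ins.ch_new (h : Ins C D Q) : ch (insert (Q.biUnion id) C) (Q.biUnion id) = Q := by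
  apply ch_eq
  · exact fun E hE => ⟨pl_insert.2 (Or.inr (mem_ch.1 (h.sub hE)).1), h.mem_ssub hE⟩
  · intro E hE hs
    rcases pl_insert.1 hE with rfl | hE
    · exact absurd rfl hs.ne
    · exact h.below hE hs.1
  · exact fun E hE F hF hs => h.od.anti (h.sub hE) (h.sub hF) hs

theorem Ins.ch_par (h : Ins C D Q) :
    ch (insert (Q.biUnion id) C) D = insert (Q.biUnion id) (ch C D \ Q) := by
  have hdis : ∀ E ∈ ch C D \ Q, Disjoint E (Q.biUnion id) := by
    intro E hE
    rw [Finset.mem_sdiff] at hE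
    rw [Finset.disjoint_biUnion_right]
    intro E' hE'
    have hne : E ≠ E' := by rintro rfl; exact hE.2 hE'
    exact h.od.ch_disj hE.1 (h.sub hE') hne
  have hne0 : (Q.biUnion id).Nonempty := by
    rw [← Finset.card_pos]; exact h.card_odd.1.pos
  apply ch_eq
  · intro E hE
    rcases Finset.mem_insert.1 hE with rfl | hE
    · exact ⟨pl_insert.2 (Or.inl rfl), h.ssub⟩
    · have := mem_ch.1 (Finset.mem_sdiff.1 hE).1
      exact ⟨pl_insert.2 (Or.inr this.1), this.2.1⟩
  · intro E hE hs
    rcases pl_insert.1 hE with rfl | hE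
    · exact ⟨_, Finset.mem_insert_self _ _, le_refl _⟩
    · obtain ⟨F, hF, hEF⟩ := ch_above hE hs
      by_cases hFQ : F ∈ Q
      · exact ⟨_, Finset.mem_insert_self _ _, hEF.trans (h.mem_ssub hFQ).1⟩
      · exact ⟨F, Finset.mem_insert_of_mem (Finset.mem_sdiff.2 ⟨hF, hFQ⟩), hEF⟩
  · intro E hE F hF hs
    rcases Finset.mem_insert.1 hE with rfl | hE
    · rcases Finset.mem_insert.1 hF with rfl | hF
      · rfl
      · obtain ⟨x, hx⟩ := hne0
        exact absurd hx (Finset.disjoint_left.1 (hdis F hF) (hs hx))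
    · rcases Finset.mem_insert.1 hF with rfl | hF
      · obtain ⟨x, hx⟩ := h.od.plNe (mem_ch.1 (Finset.mem_sdiff.1 hE).1).1
        exact absurd (hs hx) (Finset.disjoint_left.1 (hdis E hE) hx)
      · exact h.od.anti (Finset.mem_sdiff.1 hE).1 (Finset.mem_sdiff.1 hF).1 hs

theorem Ins.ch_other (h : Ins C D Q) (hF : F ∈ C) (hne : F ≠ D) :
    ch (insert (Q.biUnion id) C) F = ch C F := by
  apply ch_eq
  · intro E hE
    exact ⟨pl_insert.2 (Or.inr (mem_ch.1 hE).1), (mem_ch.1 hE).2.1⟩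
  · intro E hE hs
    rcases pl_insert.1 hE with rfl | hE
    · have h1 := h.above (Or.inl hF) hs.1
      obtain ⟨E, hE, hs'⟩ := ch_above (Or.inl h.mem) (Finset.ssubset_iff_subset_ne.2 ⟨h1, hne.symm⟩)
      exact ⟨E, hE, h.ssub.1.trans hs'⟩
    · exact ch_above hE hs
  · exact fun E hE F hF hs => h.od.anti hE hF hs

theorem Ins.wt (h : Ins C D Q) :
    wt (insert (Q.biUnion id) C) =
      2 * (((ch C D).card - 3).factorial : ℤ) *
        ∏ F ∈ C.erase D, -(((ch C F).card - 1).factorial : ℤ) := by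
  unfold GFM.wt
  rw [Finset.prod_insert h.not_mem, h.ch_new, ← Finset.mul_prod_erase _ _ h.mem, h.ch_par]
  have h1 : (insert (Q.biUnion id) (ch C D \ Q)).card - 1 = (ch C D).card - 3 := by
    rw [Finset.card_insert_of_notMem, Finset.card_sdiff_of_subset h.sub, h.three]
    · omega
    · intro hc
      exact h.notPl (mem_ch.1 (Finset.mem_sdiff.1 hc).1).1
  rw [h1, h.three]
  have h2 : ∏ F ∈ C.erase D, -(((ch (insert (Q.biUnion id) C) F).card - 1).factorial : ℤ) =
      ∏ F ∈ C.erase D, -(((ch C F).card - 1).factorial : ℤ) := by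
    apply Finset.prod_congr rfl
    intro F hF
    rw [h.ch_other (Finset.mem_of_mem_erase hF) (Finset.ne_of_mem_erase hF)]
  rw [h2]
  norm_num [Nat.factorial]
  ring

theorem wt_split (hD : D ∈ C) : wt C = -(((ch C D).card - 1).factorial : ℤ) *
        ∏ F ∈ C.erase D, -(((ch C F).card - 1).factorial : ℤ) := by
  unfold GFM.wt
  rw [← Finset.mul_prod_erase _ _ hD]

/-- removing a non top member with three children -/
theorem ins_erase (h : Od C) (hD0 : D0 ∈ C) (hD : D ∈ C) (hc : D0 ∈ ch C D)
    (h3 : (ch C D0).card = 3) : Ins (C.erase D0) D (ch C D0) := by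
  have hne : D ≠ D0 := fun he => (mem_ch.1 hc).2.1.ne he.symm
  have hpl : ∀ {E}, Pl (C.erase D0) E ↔ Pl C E ∧ E ≠ D0 := by
    intro E
    unfold Pl
    rw [Finset.mem_erase]
    have := h.three D0 hD0
    constructor
    · rintro (⟨h1, h2⟩ | h1)
      · exact ⟨Or.inl h2, h1⟩
      · refine ⟨Or.inr h1, ?_⟩
        rintro rfl; omega
    · rintro ⟨h1 | h1, h2⟩
      · exact Or.inl ⟨h2, h1⟩
      · exact Or.inr h1
  have hdis : ∀ E ∈ (ch C D).erase D0, ∀ F ∈ ch C D0, Disjoint E F := by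
    intro E hE F hF
    exact Finset.disjoint_of_subset_right (mem_ch.1 hF).2.1.1
      (h.ch_disj (Finset.mem_of_mem_erase hE) hc (Finset.ne_of_mem_erase hE))
  have hch : ch (C.erase D0) D = (ch C D).erase D0 ∪ ch C D0 := by
    apply ch_eq
    · intro E hE
      rcases Finset.mem_union.1 hE with hE | hE
      · have := mem_ch.1 (Finset.mem_of_mem_erase hE)
        exact ⟨hpl.2 ⟨this.1, Finset.ne_of_mem_erase hE⟩, this.2.1⟩
      · have := mem_ch.1 hE
        exact ⟨hpl.2 ⟨this.1, this.2.1.ne⟩, this.2.1.trans (mem_ch.1 hc).2.1⟩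
    · intro E hE hs
      rw [hpl] at hE
      obtain ⟨F, hF, hEF⟩ := ch_above hE.1 hs
      by_cases he : F = D0
      · subst he
        obtain ⟨G, hG, hEG⟩ := ch_above hE.1 (Finset.ssubset_iff_subset_ne.2 ⟨hEF, hE.2⟩)
        exact ⟨G, Finset.mem_union_right _ hG, hEG⟩
      · exact ⟨F, Finset.mem_union_left _ (Finset.mem_erase.2 ⟨he, hF⟩), hEF⟩
    · intro E hE F hF hs
      rcases Finset.mem_union.1 hE with hE | hE
      · rcases Finset.mem_union.1 hF with hF | hF
        · exact h.anti (Finset.mem_of_mem_erase hE) (Finset.mem_of_mem_erase hF) hs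
        · obtain ⟨x, hx⟩ := h.plNe (mem_ch.1 (Finset.mem_of_mem_erase hE)).1
          exact absurd (hs hx) (Finset.disjoint_left.1 (hdis E hE F hF) hx)
      · rcases Finset.mem_union.1 hF with hF | hF
        · obtain ⟨x, hx⟩ := h.plNe (mem_ch.1 hE).1
          exact absurd hx (Finset.disjoint_left.1 (hdis F hF E hE) (hs hx))
        · exact h.anti hE hF hs
  refine ⟨⟨fun E hE => h.odd E (Finset.mem_of_mem_erase hE),
      fun E hE => h.three E (Finset.mem_of_mem_erase hE),
      fun A hA B hB => h.lam A (Finset.mem_of_mem_erase hA) B (Finset.mem_of_mem_erase hB)⟩,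
    Finset.mem_erase.2 ⟨hne, hD⟩, ?_, h3, ?_⟩
  · rw [hch]; exact Finset.subset_union_right
  · rw [hch, Finset.card_union_of_disjoint, Finset.card_erase_of_mem hc, h3]
    · have := (h.ch_card hD).2
      omega
    · rw [Finset.disjoint_left]
      intro E hE hE'
      obtain ⟨x, hx⟩ := h.plNe (mem_ch.1 hE').1
      exact Finset.disjoint_left.1 (hdis E hE E hE') hx hx

end Fam
end GFM

namespace GFM

section Fam

variable {m : ℕ}

noncomputable def Lam (S : Finset (Fin m)) : Finset (Finset (Finset (Fin m))) :=
  Finset.univ.filter (fun C => Od C ∧ (∀ D ∈ C, D ⊆ S) ∧ (3 ≤ S.card → S ∈ C))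

theorem mem_Lam {S : Finset (Fin m)} {C : Finset (Finset (Fin m))} :
    C ∈ Lam S ↔ Od C ∧ (∀ D ∈ C, D ⊆ S) ∧ (3 ≤ S.card → S ∈ C) := by
  simp [Lam]

noncomputable def tS (S : Finset (Fin m)) : ℤ := ∑ C ∈ Lam S, wt C

theorem single_ssub {S : Finset (Fin m)} {a : Fin m} (h3 : 2 ≤ S.card) (ha : a ∈ S) :
    ({a} : Finset (Fin m)) ⊂ S := by
  refine Finset.ssubset_iff_subset_ne.2 ⟨by simpa using ha, ?_⟩
  rintro rfl
  simp at h3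

theorem tS_cancel {S : Finset (Fin m)} (h3 : 3 ≤ S.card) {a : Fin m} (ha : a ∈ S) :
    tS S = ∑ C ∈ (Lam S).filter (fun C => {a} ∈ ch C S ∧ (ch C S).card = 3), wt C := by
  set Pr := (Lam S ×ˢ (Finset.univ : Finset (Finset (Fin m)))).filter
    (fun p => p.2 ∈ p.1 ∧ {a} ∈ ch p.1 p.2) with hPr
  have memPr : ∀ p, p ∈ Pr ↔ p.1 ∈ Lam S ∧ p.2 ∈ p.1 ∧ {a} ∈ ch p.1 p.2 := by
    intro p; simp [hPr]
  have e1 : tS S = ∑ p ∈ Pr, wt p.1 := by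
    symm
    unfold tS
    apply Finset.sum_nbij (fun p => p.1)
    · intro p hp; exact ((memPr p).1 hp).1
    · rintro ⟨p, D⟩ hp ⟨q, D'⟩ hq h
      simp only at h
      subst h
      have h1 := (memPr _).1 hp
      have h2 := (memPr _).1 hq
      have := (mem_Lam.1 h1.1).1.up_unique h1.2.1 h2.2.1 h1.2.2 h2.2.2
      simp only at this
      rw [this]
    · intro C hC
      have h1 := mem_Lam.1 hC
      obtain ⟨D, hD, hc, -⟩ := h1.1.up_exists (pl_single C a) (h1.2.2 h3)
        (single_ssub (by omega) ha)
      exact ⟨(C, D), (memPr _).2 ⟨hC, hD, hc⟩, rfl⟩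
    · intro p hp; rfl
  rw [e1, ← Finset.sum_filter_add_sum_filter_not Pr (fun p => (ch p.1 p.2).card = 3),
    ← Finset.sum_filter_add_sum_filter_not (Pr.filter (fun p => (ch p.1 p.2).card = 3))
      (fun p => p.2 = S)]
  set PC := (Pr.filter (fun p => (ch p.1 p.2).card = 3)).filter (fun p => p.2 = S) with hPC
  set PA := (Pr.filter (fun p => (ch p.1 p.2).card = 3)).filter (fun p => ¬ p.2 = S) with hPA
  set PB := Pr.filter (fun p => ¬ (ch p.1 p.2).card = 3) with hPB
  have eC : ∑ p ∈ PC, wt p.1 =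
      ∑ C ∈ (Lam S).filter (fun C => {a} ∈ ch C S ∧ (ch C S).card = 3), wt C := by
    apply Finset.sum_nbij (fun p => p.1)
    · rintro ⟨p, D⟩ hp
      simp only [hPC, Finset.mem_filter, memPr] at hp ⊢
      obtain ⟨⟨⟨h1, h2, h4⟩, h5⟩, rfl⟩ := hp
      exact ⟨h1, h4, h5⟩
    · rintro ⟨p, D⟩ hp ⟨q, D'⟩ hq h
      simp only [hPC, Finset.mem_coe, Finset.mem_filter] at hp hq
      simp only at h
      rw [hp.2, hq.2, h]
    · intro C hC
      simp only [Finset.mem_coe, Finset.mem_filter] at hC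
      refine ⟨(C, S), ?_, rfl⟩
      simp only [hPC, Finset.mem_coe, Finset.mem_filter, memPr]
      exact ⟨⟨⟨hC.1, (mem_Lam.1 hC.1).2.2 h3, hC.2.1⟩, hC.2.2⟩, trivial⟩
    · intro p hp; rfl
  have mkIns : ∀ p ∈ PB, ∀ Q' ∈ Finset.powersetCard 2 ((ch p.1 p.2).erase {a}),
      Ins p.1 p.2 (insert {a} Q') := by
    intro p hp Q' hQ'
    simp only [hPB, Finset.mem_filter, memPr] at hp
    rw [Finset.mem_powersetCard] at hQ'
    obtain ⟨⟨h1, h2, h4⟩, h5⟩ := hp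
    have hod := (mem_Lam.1 h1).1
    refine ⟨hod, h2, ?_, ?_, ?_⟩
    · intro E hE
      rcases Finset.mem_insert.1 hE with rfl | hE
      · exact h4
      · exact Finset.mem_of_mem_erase (hQ'.1 hE)
    · rw [Finset.card_insert_of_notMem, hQ'.2]
      intro hc
      exact Finset.notMem_erase _ _ (hQ'.1 hc)
    · obtain ⟨⟨k, hk⟩, h7⟩ := hod.ch_card h2
      omega
  have eA : ∑ p ∈ PA, wt p.1 = ∑ x ∈ PB.sigma (fun p => Finset.powersetCard 2 ((ch p.1 p.2).erase {a})),
      wt (insert ((insert {a} x.2).biUnion id) x.1.1) := by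
    symm
    apply Finset.sum_nbij (fun x => (insert ((insert {a} x.2).biUnion id) x.1.1,
      (insert {a} x.2).biUnion id))
    · rintro ⟨p, Q'⟩ hx
      rw [Finset.mem_sigma] at hx
      have hI := mkIns p hx.1 Q' hx.2
      have hp := hx.1
      simp only [hPB, Finset.mem_filter, memPr] at hp
      have hL := mem_Lam.1 hp.1.1
      simp only [hPA, Finset.mem_filter, memPr]
      have hss : (insert {a} Q').biUnion id ⊂ S :=
        Finset.ssubset_of_ssubset_of_subset hI.ssub (hL.2.1 _ hI.mem)
      refine ⟨⟨⟨mem_Lam.2 ⟨hI.od', ?_, ?_⟩, Finset.mem_insert_self _ _, ?_⟩, ?_⟩, hss.ne⟩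
      · intro D hD
        rcases Finset.mem_insert.1 hD with rfl | hD
        · exact hss.1
        · exact hL.2.1 D hD
      · exact fun _ => Finset.mem_insert_of_mem (hL.2.2 h3)
      · rw [hI.ch_new]; exact Finset.mem_insert_self _ _
      · rw [hI.ch_new]; exact hI.three
    · rintro ⟨⟨C, D⟩, Q'⟩ hx ⟨⟨C1, D1⟩, Q1⟩ hx1 h
      rw [Finset.mem_coe, Finset.mem_sigma] at hx hx1
      have hI := mkIns _ hx.1 _ hx.2
      have hI1 := mkIns _ hx1.1 _ hx1.2
      simp only [Prod.mk.injEq] at h hI hI1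
      obtain ⟨hA, hB⟩ := h
      have hC : C = C1 := by
        have h1 := Finset.erase_insert hI.not_mem
        rw [hA, hB, Finset.erase_insert hI1.not_mem] at h1
        exact h1.symm
      subst hC
      have hQ : insert {a} Q' = insert {a} Q1 := by
        have h1 := hI.ch_new
        rw [hA, hB, hI1.ch_new] at h1
        exact h1.symm
      have hD : D = D1 := hI.od.up_unique hI.mem hI1.mem
        (hI.sub (Finset.mem_insert_self _ _)) (hI1.sub (Finset.mem_insert_self _ _))
      subst hD
      have hn : ∀ Q ∈ Finset.powersetCard 2 ((ch C D).erase {a}), {a} ∉ Q := by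
        intro Q hQ hc
        rw [Finset.mem_powersetCard] at hQ
        exact Finset.notMem_erase _ _ (hQ.1 hc)
      have hQ2 : Q' = Q1 := by
        rw [← Finset.erase_insert (hn Q' hx.2), hQ, Finset.erase_insert (hn Q1 hx1.2)]
      rw [hQ2]
    · rintro ⟨C, D0⟩ hp
      simp only [hPA, Finset.mem_coe, Finset.mem_filter, memPr] at hp
      obtain ⟨⟨⟨h1, h2, h4⟩, h5⟩, h6⟩ := hp
      have hL := mem_Lam.1 h1
      obtain ⟨D, hD, hc, hs⟩ := hL.1.up_exists (Or.inl h2) (hL.2.2 h3)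
        (Finset.ssubset_iff_subset_ne.2 ⟨hL.2.1 _ h2, h6⟩)
      have hI := ins_erase hL.1 h2 hD hc h5
      have hu : (ch C D0).biUnion id = D0 :=
        Od.ch_union (by have := hL.1.three _ h2; omega)
      have hins : insert {a} ((ch C D0).erase {a}) = ch C D0 := Finset.insert_erase h4
      refine ⟨⟨(C.erase D0, D), (ch C D0).erase {a}⟩, ?_, ?_⟩
      · rw [Finset.mem_coe, Finset.mem_sigma]
        simp only [hPB, Finset.mem_filter, memPr]
        refine ⟨⟨⟨mem_Lam.2 ⟨hI.od, ?_, ?_⟩, hI.mem, hI.sub h4⟩, ?_⟩, ?_⟩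
        · exact fun E hE => hL.2.1 E (Finset.mem_of_mem_erase hE)
        · exact fun _ => Finset.mem_erase.2 ⟨Ne.symm h6, hL.2.2 h3⟩
        · have := hI.five; omega
        · rw [Finset.mem_powersetCard, Finset.card_erase_of_mem h4, h5]
          exact ⟨Finset.erase_subset_erase _ hI.sub, rfl⟩
      · simp only [hins, hu, Finset.insert_erase h2]
    · intro x hx; rfl
  have eB : ∑ p ∈ PA, wt p.1 = - ∑ p ∈ PB, wt p.1 := by
    rw [eA, Finset.sum_sigma, ← Finset.sum_neg_distrib]
    apply Finset.sum_congr rfl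
    intro p hp
    rw [Finset.sum_congr rfl (fun Q' hQ' => (mkIns p hp Q' hQ').wt), Finset.sum_const,
      Finset.card_powersetCard]
    simp only [hPB, Finset.mem_filter, memPr] at hp
    obtain ⟨⟨h1, h2, h4⟩, h5⟩ := hp
    obtain ⟨⟨k, hk⟩, h7⟩ := (mem_Lam.1 h1).1.ch_card h2
    rw [Finset.card_erase_of_mem h4, wt_split h2]
    obtain ⟨n, hn⟩ : ∃ n, (ch p.1 p.2).card = n + 3 := ⟨_, (Nat.sub_add_cancel h7).symm⟩
    rw [hn]
    have e : ((n + 3 - 1).choose 2) * 2 * (n + 3 - 3).factorial = (n + 3 - 1).factorial := by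
      have h8 := Nat.choose_mul_factorial_mul_factorial (n := n + 2) (k := 2) (by omega)
      simpa [Nat.factorial] using h8
    have e' : (((n + 3 - 1).choose 2 : ℕ) : ℤ) * 2 * ((n + 3 - 3).factorial : ℤ) =
      ((n + 3 - 1).factorial : ℤ) := by exact_mod_cast e
    rw [← e', nsmul_eq_mul]
    ring
  rw [eC, eB]
  ring

end Fam
end GFM

namespace GFM

section Fam

variable {m : ℕ}

/-- two families living on disjoint sets -/
structure Sep (A B : Finset (Fin m)) (C1 C2 : Finset (Finset (Fin m))) : Prop where
  disj : Disjoint A B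
  od1 : Od C1
  od2 : Od C2
  sub1 : ∀ D ∈ C1, D ⊆ A
  sub2 : ∀ D ∈ C2, D ⊆ B

variable {A B : Finset (Fin m)} {C1 C2 : Finset (Finset (Fin m))}

theorem Sep.symm (h : Sep A B C1 C2) : Sep B A C2 C1 := ⟨h.disj.symm, h.od2, h.od1, h.sub2, h.sub1⟩

theorem Sep.not2 (h : Sep A B C1 C2) {E} (hE : E ⊆ A) : E ∉ C2 := fun hc => by
  obtain ⟨x, hx⟩ := h.od2.plNe (Or.inl hc)
  exact Finset.disjoint_left.1 h.disj (hE hx) (h.sub2 E hc hx)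

theorem Sep.od (h : Sep A B C1 C2) : Od (C1 ∪ C2) := by
  have key : ∀ D ∈ C1, ∀ E ∈ C2, Disjoint D E := fun D hD E hE =>
    Finset.disjoint_of_subset_left (h.sub1 D hD) (Finset.disjoint_of_subset_right (h.sub2 E hE) h.disj)
  constructor
  · intro D hD
    rcases Finset.mem_union.1 hD with hD | hD
    · exact h.od1.odd D hD
    · exact h.od2.odd D hD
  · intro D hD
    rcases Finset.mem_union.1 hD with hD | hD
    · exact h.od1.three D hD
    · exact h.od2.three D hD
  · intro D hD E hE
    rcases Finset.mem_union.1 hD with hD | hD <;> rcases Finset.mem_union.1 hE with hE | hE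
    · exact h.od1.lam D hD E hE
    · right; right; exact key D hD E hE
    · right; right; exact (key E hE D hD).symm
    · exact h.od2.lam D hD E hE

theorem Sep.disjC (h : Sep A B C1 C2) : Disjoint C1 C2 := by
  rw [Finset.disjoint_left]
  exact fun D hD => h.not2 (h.sub1 D hD)

theorem Sep.ch1 (h : Sep A B C1 C2) {D} (hD : D ⊆ A) : ch (C1 ∪ C2) D = ch C1 D := by
  apply ch_congr
  intro E hE
  rw [Finset.mem_union]
  have := h.not2 (hE.1.trans hD)
  tauto

theorem Sep.wt (h : Sep A B C1 C2) : wt (C1 ∪ C2) = wt C1 * wt C2 := by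
  unfold GFM.wt
  rw [Finset.prod_union h.disjC]
  congr 1
  · apply Finset.prod_congr rfl
    intro D hD
    rw [h.ch1 (h.sub1 D hD)]
  · apply Finset.prod_congr rfl
    intro D hD
    rw [Finset.union_comm, h.symm.ch1 (h.sub2 D hD)]

theorem Sep.filter1 (h : Sep A B C1 C2) : (C1 ∪ C2).filter (fun E => E ⊆ A) = C1 := by
  ext E
  rw [Finset.mem_filter, Finset.mem_union]
  constructor
  · rintro ⟨h1 | h1, h2⟩
    · exact h1
    · exact absurd h1 (h.not2 h2)
  · exact fun h1 => ⟨Or.inl h1, h.sub1 E h1⟩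

theorem Od.mono {C C' : Finset (Finset (Fin m))} (h : Od C) (hs : C' ⊆ C) : Od C' :=
  ⟨fun D hD => h.odd D (hs hD), fun D hD => h.three D (hs hD),
    fun D hD E hE => h.lam D (hs hD) E (hs hE)⟩

theorem Od.top {C : Finset (Finset (Fin m))} (h : Od C) {S : Finset (Fin m)}
    (hs : ∀ D ∈ C, D ⊆ S) (ho : Odd S.card) (h3 : 3 ≤ S.card) : Od (insert S C) := by
  constructor
  · intro D hD
    rcases Finset.mem_insert.1 hD with rfl | hD
    · exact ho
    · exact h.odd D hD
  · intro D hD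
    rcases Finset.mem_insert.1 hD with rfl | hD
    · exact h3
    · exact h.three D hD
  · intro D hD E hE
    rcases Finset.mem_insert.1 hD with hD | hD <;> rcases Finset.mem_insert.1 hE with hE | hE
    · left; rw [hD, hE]
    · right; left; rw [hD]; exact hs E hE
    · left; rw [hE]; exact hs D hD
    · exact h.lam D hD E hE

theorem wt_top {C : Finset (Finset (Fin m))} {S : Finset (Fin m)}
    (hs : ∀ D ∈ C, D ⊂ S) : wt (insert S C) =
      -(((ch (insert S C) S).card - 1).factorial : ℤ) * wt C := by
  have hn : S ∉ C := fun h => (hs S h).ne rfl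
  unfold GFM.wt
  rw [Finset.prod_insert hn]
  congr 1
  apply Finset.prod_congr rfl
  intro D hD
  have hc : ch (insert S C) D = ch C D := ?_
  · rw [hc]
  apply ch_congr
  intro E hE
  rw [Finset.mem_insert]
  have : E ≠ S := by
    rintro rfl
    exact (hE.trans (hs D hD)).ne rfl
  tauto

theorem lam_single (a : Fin m) : tS ({a} : Finset (Fin m)) = 1 := by
  have : Lam ({a} : Finset (Fin m)) = {∅} := by
    ext C
    rw [mem_Lam, Finset.mem_singleton]
    constructor
    · rintro ⟨h1, h2, -⟩
      rw [Finset.eq_empty_iff_forall_notMem]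
      intro D hD
      have h3 := h1.three D hD
      have h4 := Finset.card_le_card (h2 D hD)
      simp at h4
      omega
    · rintro rfl
      exact ⟨⟨by simp, by simp, by simp⟩, by simp, by simp⟩
  unfold tS
  rw [this]
  simp [wt]

theorem tS_rec {S : Finset (Fin m)} (ho : Odd S.card) (h3 : 3 ≤ S.card) {a : Fin m} (ha : a ∈ S) :
    tS S = -∑ P ∈ (S.erase a).powerset.filter (fun P => Odd P.card), tS P * tS ((S.erase a) \ P) := by
  rw [tS_cancel h3 ha]
  set K := (Lam S).filter (fun C => {a} ∈ ch C S ∧ (ch C S).card = 3) with hK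
  set PP := (S.erase a).powerset.filter (fun P => Odd P.card) with hPP
  have e1 : ∀ C ∈ K, wt C = - ∑ P ∈ (ch C S).erase {a}, wt (C.erase S) := by
    intro C hC
    simp only [hK, Finset.mem_filter] at hC
    obtain ⟨h1, h2, h4⟩ := hC
    have h5 := mem_Lam.1 h1
    have hSC := h5.2.2 h3
    rw [Finset.sum_const, Finset.card_erase_of_mem h2, h4]
    have h6 := wt_top (C := C.erase S) (S := S) (fun D hD =>
      Finset.ssubset_iff_subset_ne.2 ⟨h5.2.1 D (Finset.mem_of_mem_erase hD), Finset.ne_of_mem_erase hD⟩)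
    rw [Finset.insert_erase hSC, h4] at h6
    rw [h6]
    norm_num [Nat.factorial]
  rw [Finset.sum_congr rfl e1, Finset.sum_neg_distrib]
  congr 1
  have e2 : ∀ P ∈ PP, tS P * tS ((S.erase a) \ P) =
      ∑ x ∈ Lam P ×ˢ Lam ((S.erase a) \ P), wt x.1 * wt x.2 := by
    intro P hP
    unfold tS
    rw [Finset.sum_mul_sum, Finset.sum_product]
  rw [Finset.sum_congr rfl e2, Finset.sum_sigma', Finset.sum_sigma']
  have hev : Even (S.erase a).card := by
    rw [Finset.card_erase_of_mem ha]
    obtain ⟨k, hk⟩ := ho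
    exact ⟨k, by omega⟩
  -- basic data on the right hand side
  have data : ∀ P ∈ PP, ∀ x ∈ Lam P ×ˢ Lam ((S.erase a) \ P),
      Sep P ((S.erase a) \ P) x.1 x.2 ∧ (∀ D ∈ x.1 ∪ x.2, D ⊂ S) ∧
      Odd ((S.erase a) \ P).card ∧ a ∉ P ∧ P ⊆ S := by
    intro P hP x hx
    simp only [hPP, Finset.mem_filter, Finset.mem_powerset] at hP
    rw [Finset.mem_product] at hx
    have h1 := mem_Lam.1 hx.1
    have h2 := mem_Lam.1 hx.2
    refine ⟨⟨Finset.disjoint_sdiff, h1.1, h2.1, h1.2.1, h2.2.1⟩, ?_, ?_, ?_, ?_⟩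
    · intro D hD
      have hs : D ⊆ S.erase a := by
        rcases Finset.mem_union.1 hD with hD | hD
        · exact (h1.2.1 D hD).trans hP.1
        · exact (h2.2.1 D hD).trans Finset.sdiff_subset
      exact Finset.ssubset_of_subset_of_ssubset hs (Finset.erase_ssubset ha)
    · rw [Finset.card_sdiff_of_subset hP.1]
      have := Finset.card_le_card hP.1
      exact Nat.Even.sub_odd this hev hP.2
    · intro hc
      exact Finset.notMem_erase _ _ (hP.1 hc)
    · exact hP.1.trans (Finset.erase_subset _ _)
  symm
  apply Finset.sum_nbij (fun y => ⟨insert S (y.2.1 ∪ y.2.2), y.1⟩)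
  · rintro ⟨P, x⟩ hy
    rw [Finset.mem_sigma] at hy
    obtain ⟨hP, hx⟩ := hy
    obtain ⟨hsep, hss, hodd2, haP, hPS⟩ := data P hP x hx
    simp only [hPP, Finset.mem_filter, Finset.mem_powerset] at hP
    simp only [Finset.mem_product] at hx
    have h1 := mem_Lam.1 hx.1
    have h2 := mem_Lam.1 hx.2
    set P2 := (S.erase a) \ P with hP2
    have hpl1 : Pl (insert S (x.1 ∪ x.2)) P := by
      by_cases hc : P.card = 1
      · exact Or.inr hc
      · left
        obtain ⟨k, hk⟩ := hP.2
        exact Finset.mem_insert_of_mem (Finset.mem_union_left _ (h1.2.2 (by omega)))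
    have hpl2 : Pl (insert S (x.1 ∪ x.2)) P2 := by
      by_cases hc : P2.card = 1
      · exact Or.inr hc
      · left
        obtain ⟨k, hk⟩ := hodd2
        exact Finset.mem_insert_of_mem (Finset.mem_union_right _ (h2.2.2 (by omega)))
    have hPss : P ⊂ S := Finset.ssubset_of_subset_of_ssubset hP.1 (Finset.erase_ssubset ha)
    have hP2ss : P2 ⊂ S := Finset.ssubset_of_subset_of_ssubset Finset.sdiff_subset (Finset.erase_ssubset ha)
    obtain ⟨p, hp⟩ : P.Nonempty := Finset.card_pos.1 hP.2.pos
    obtain ⟨q, hq⟩ : P2.Nonempty := Finset.card_pos.1 hodd2.pos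
    have hpa : p ≠ a := by rintro rfl; exact haP hp
    have hqP : q ∉ P := (Finset.mem_sdiff.1 hq).2
    have hqa : q ≠ a := Finset.ne_of_mem_erase (Finset.mem_sdiff.1 hq).1
    have hpP2 : p ∉ P2 := fun h => (Finset.mem_sdiff.1 h).2 hp
    have haP2 : a ∉ P2 := fun h => Finset.notMem_erase _ _ (Finset.mem_sdiff.1 h).1
    have hch : ch (insert S (x.1 ∪ x.2)) S = {{a}, P, P2} := by
      apply ch_eq
      · intro E hE
        simp only [Finset.mem_insert, Finset.mem_singleton] at hE
        rcases hE with rfl | rfl | rfl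
        · exact ⟨pl_single _ _, single_ssub (by omega) ha⟩
        · exact ⟨hpl1, hPss⟩
        · exact ⟨hpl2, hP2ss⟩
      · intro E hE hs
        rcases hE with hE | hE
        · rcases Finset.mem_insert.1 hE with rfl | hE
          · exact absurd rfl hs.ne
          · rcases Finset.mem_union.1 hE with hE | hE
            · exact ⟨P, by simp, h1.2.1 E hE⟩
            · exact ⟨P2, by simp, h2.2.1 E hE⟩
        · obtain ⟨z, rfl⟩ := Finset.card_eq_one.1 hE
          have hz : z ∈ S := hs.1 (Finset.mem_singleton_self z)
          by_cases hza : z = a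
          · exact ⟨{a}, by simp, by simp [hza]⟩
          · by_cases hzP : z ∈ P
            · exact ⟨P, by simp, by simpa using hzP⟩
            · exact ⟨P2, by simp, by simp [hP2, hz, hza, hzP]⟩
      · intro E hE F hF hs
        simp only [Finset.mem_insert, Finset.mem_singleton] at hE hF
        rcases hE with rfl | rfl | rfl <;> rcases hF with rfl | rfl | rfl
        · rfl
        · exact absurd (hs (Finset.mem_singleton_self a)) haP
        · exact absurd (hs (Finset.mem_singleton_self a)) haP2
        · exact absurd (Finset.mem_singleton.1 (hs hp)) hpa
        · rfl
        · exact absurd (hs hp) hpP2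
        · exact absurd (Finset.mem_singleton.1 (hs hq)) hqa
        · exact absurd (hs hq) hqP
        · rfl
    have n1 : ({a} : Finset (Fin m)) ≠ P := by rintro rfl; simp at haP
    have n2 : ({a} : Finset (Fin m)) ≠ P2 := fun h => haP2 (h ▸ Finset.mem_singleton_self a)
    have n3 : P ≠ P2 := fun h => hpP2 (h ▸ hp)
    rw [Finset.mem_sigma]
    simp only [hK, Finset.mem_filter]
    rw [hch]
    refine ⟨⟨mem_Lam.2 ⟨hsep.od.top (fun D hD => (hss D hD).1) ho h3, ?_, ?_⟩, by simp, ?_⟩, ?_⟩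
    · intro D hD
      rcases Finset.mem_insert.1 hD with rfl | hD
      · rfl
      · exact (hss D hD).1
    · exact fun _ => Finset.mem_insert_self _ _
    · rw [Finset.card_eq_three]
      exact ⟨_, _, _, n1, n2, n3, rfl⟩
    · rw [Finset.mem_erase]
      exact ⟨n1.symm, by simp⟩
  · rintro ⟨P, x⟩ hy ⟨P', x'⟩ hy' h
    rw [Finset.mem_coe, Finset.mem_sigma] at hy hy'
    obtain ⟨hsep, hss, -⟩ := data P hy.1 x hy.2
    obtain ⟨hsep', hss', -⟩ := data P' hy'.1 x' hy'.2
    simp only [Sigma.mk.injEq, heq_eq_eq] at h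
    obtain ⟨h1, rfl⟩ := h
    have h2 : x.1 ∪ x.2 = x'.1 ∪ x'.2 := by
      have n1 : S ∉ x.1 ∪ x.2 := fun h => (hss S h).ne rfl
      have n2 : S ∉ x'.1 ∪ x'.2 := fun h => (hss' S h).ne rfl
      rw [← Finset.erase_insert n1, h1, Finset.erase_insert n2]
    have h3 : x.1 = x'.1 := by rw [← hsep.filter1, h2, hsep'.filter1]
    have h4 : x.2 = x'.2 := by
      rw [← hsep.symm.filter1, Finset.union_comm, h2, Finset.union_comm, hsep'.symm.filter1]
    have : x = x' := Prod.ext h3 h4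
    rw [this]
  · rintro ⟨C, P⟩ hy
    rw [Finset.mem_coe, Finset.mem_sigma] at hy
    simp only [hK, Finset.mem_filter] at hy
    obtain ⟨⟨h1, h2, h4⟩, h5⟩ := hy
    have hL := mem_Lam.1 h1
    have hod := hL.1
    have hSC := hL.2.2 h3
    have h6 : ((ch C S).erase {a}).card = 2 := by rw [Finset.card_erase_of_mem h2, h4]
    obtain ⟨P2, hP2⟩ : ∃ P2, ((ch C S).erase {a}).erase P = {P2} := by
      rw [← Finset.card_eq_one, Finset.card_erase_of_mem h5, h6]
    have hP2m : P2 ∈ ((ch C S).erase {a}).erase P := by rw [hP2]; simp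
    have hPch := Finset.mem_of_mem_erase h5
    have hPna := Finset.ne_of_mem_erase h5
    have hP2ch := Finset.mem_of_mem_erase (Finset.mem_of_mem_erase hP2m)
    have hP2na := Finset.ne_of_mem_erase (Finset.mem_of_mem_erase hP2m)
    have hP2P := Finset.ne_of_mem_erase hP2m
    have hall : ∀ E ∈ ch C S, E = {a} ∨ E = P ∨ E = P2 := by
      intro E hE
      by_cases e1 : E = {a}
      · exact Or.inl e1
      · by_cases e2 : E = P
        · exact Or.inr (Or.inl e2)
        · right; right
          have : E ∈ ((ch C S).erase {a}).erase P :=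
            Finset.mem_erase.2 ⟨e2, Finset.mem_erase.2 ⟨e1, hE⟩⟩
          rw [hP2] at this
          simpa using this
    have haP : a ∉ P := fun h =>
      Finset.disjoint_left.1 (hod.ch_disj h2 hPch hPna.symm) (Finset.mem_singleton_self a) h
    have haP2 : a ∉ P2 := fun h =>
      Finset.disjoint_left.1 (hod.ch_disj h2 hP2ch hP2na.symm) (Finset.mem_singleton_self a) h
    have hP2eq : (S.erase a) \ P = P2 := by
      ext z
      rw [Finset.mem_sdiff, Finset.mem_erase]
      constructor
      · rintro ⟨⟨z1, z2⟩, z3⟩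
        obtain ⟨E, hE, hz⟩ := ch_cover (C := C) (by omega) z2
        rcases hall E hE with rfl | rfl | rfl
        · exact absurd (Finset.mem_singleton.1 hz) z1
        · exact absurd hz z3
        · exact hz
      · intro hz
        refine ⟨⟨?_, (mem_ch.1 hP2ch).2.1.1 hz⟩, ?_⟩
        · rintro rfl; exact haP2 hz
        · exact fun h => Finset.disjoint_left.1 (hod.ch_disj hP2ch hPch hP2P) hz h
    have hlam : ∀ E ∈ ch C S, C.filter (fun D => D ⊆ E) ∈ Lam E := by
      intro E hE
      refine mem_Lam.2 ⟨hod.mono (Finset.filter_subset _ _), fun D hD => (Finset.mem_filter.1 hD).2, ?_⟩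
      intro h7
      rw [Finset.mem_filter]
      refine ⟨?_, le_refl _⟩
      rcases (mem_ch.1 hE).1 with h8 | h8
      · exact h8
      · omega
    refine ⟨⟨P, (C.filter (fun D => D ⊆ P), C.filter (fun D => D ⊆ P2))⟩, ?_, ?_⟩
    · rw [Finset.mem_coe, Finset.mem_sigma]
      simp only [hPP, Finset.mem_filter, Finset.mem_powerset, Finset.mem_product]
      refine ⟨⟨?_, hod.plOdd (mem_ch.1 hPch).1⟩, hlam P hPch, ?_⟩
      · intro z hz
        refine Finset.mem_erase.2 ⟨?_, (mem_ch.1 hPch).2.1.1 hz⟩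
        rintro rfl; exact haP hz
      · rw [hP2eq]; exact hlam P2 hP2ch
    · simp only [Sigma.mk.injEq, heq_eq_eq, and_true]
      ext E
      simp only [Finset.mem_insert, Finset.mem_union, Finset.mem_filter]
      constructor
      · rintro (rfl | h | h)
        · exact hSC
        · exact h.1
        · exact h.1
      · intro hE
        by_cases hES : E = S
        · exact Or.inl hES
        · right
          obtain ⟨F, hF, hEF⟩ := ch_above (Or.inl hE)
            (Finset.ssubset_iff_subset_ne.2 ⟨hL.2.1 E hE, hES⟩)
          rcases hall F hF with rfl | rfl | rfl
          · exfalso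
            have := Finset.card_le_card hEF
            have := hod.three E hE
            simp at *
            omega
          · exact Or.inl ⟨hE, hEF⟩
          · exact Or.inr ⟨hE, hEF⟩
  · rintro ⟨P, x⟩ hy
    rw [Finset.mem_sigma] at hy
    obtain ⟨hsep, hss, -⟩ := data P hy.1 x hy.2
    have n1 : S ∉ x.1 ∪ x.2 := fun h => (hss S h).ne rfl
    simp only
    rw [Finset.erase_insert n1, hsep.wt]

end Fam
end GFM

namespace GFM

section Fam

variable {m : ℕ}

theorem uS (n : ℕ) : ∀ N : Finset (Fin m), N.card = n → Odd n →
    ∑ Q ∈ N.powerset.filter (fun Q => Odd Q.card), tS Q = 1 := by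
  induction n using Nat.strong_induction_on with
  | _ n ih =>
  intro N hN hn
  obtain ⟨a, ha⟩ : N.Nonempty := by rw [← Finset.card_pos, hN]; exact hn.pos
  set M := N.erase a with hM
  have haM : a ∉ M := Finset.notMem_erase _ _
  have hins : insert a M = N := Finset.insert_erase ha
  have hMc : M.card = n - 1 := by rw [hM, Finset.card_erase_of_mem ha, hN]
  set f : Finset (Fin m) → ℤ := fun Q => if Odd Q.card then tS Q else 0 with hf
  rw [Finset.sum_filter, ← hins, Finset.sum_powerset_insert haM]
  -- the sets containing a
  have e1 : ∀ Q ∈ M.powerset, (if Odd (insert a Q).card then tS (insert a Q) else 0) =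
      (if Q = ∅ then 1 else 0) -
        ∑ P ∈ Q.powerset, (if Odd (Q \ P).card then (if Odd P.card then tS P * tS (Q \ P) else 0) else 0) := by
    intro Q hQ
    rw [Finset.mem_powerset] at hQ
    have haQ : a ∉ Q := fun h => haM (hQ h)
    have hc := Finset.card_insert_of_notMem haQ
    by_cases h0 : Q = ∅
    · subst h0
      simp [lam_single]
    · have hpos : 0 < Q.card := Finset.card_pos.2 (Finset.nonempty_iff_ne_empty.2 h0)
      rw [if_neg h0]
      by_cases ho : Odd (insert a Q).card
      · rw [if_pos ho, tS_rec ho (by obtain ⟨k, hk⟩ := ho; omega) (Finset.mem_insert_self a Q),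
          Finset.erase_insert haQ, Finset.sum_filter, zero_sub]
        congr 1
        apply Finset.sum_congr rfl
        intro P hP
        rw [Finset.mem_powerset] at hP
        have hle := Finset.card_le_card hP
        by_cases hoP : Odd P.card
        · rw [if_pos hoP]
          rw [if_pos]
          rw [Finset.card_sdiff_of_subset hP]
          obtain ⟨k, hk⟩ := ho
          obtain ⟨l, hl⟩ := hoP
          exact ⟨k - l - 1, by omega⟩
        · rw [if_neg hoP]; simp
      · rw [if_neg ho]
        symm
        rw [zero_sub, neg_eq_zero]
        apply Finset.sum_eq_zero
        intro P hP
        rw [Finset.mem_powerset] at hP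
        have hle := Finset.card_le_card hP
        by_cases hoP : Odd P.card
        · rw [if_neg]
          rw [Finset.card_sdiff_of_subset hP]
          rintro ⟨k, hk⟩
          obtain ⟨l, hl⟩ := hoP
          exact ho ⟨k + l + 1, by omega⟩
        · rw [if_neg hoP]; simp
  rw [Finset.sum_congr rfl e1, Finset.sum_sub_distrib]
  have e2 : ∑ Q ∈ M.powerset, (if Q = ∅ then (1 : ℤ) else 0) = 1 := by
    rw [Finset.sum_ite_eq' M.powerset ∅]
    simp
  have e3 : ∑ Q ∈ M.powerset, ∑ P ∈ Q.powerset,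
      (if Odd (Q \ P).card then (if Odd P.card then tS P * tS (Q \ P) else 0) else 0) =
      ∑ P ∈ M.powerset, (if Odd P.card then tS P else 0) := by
    have : ∀ P ∈ M.powerset, (if Odd P.card then tS P else 0) =
        ∑ R ∈ (M \ P).powerset, (if Odd R.card then (if Odd P.card then tS P * tS R else 0) else 0) := by
      intro P hP
      rw [Finset.mem_powerset] at hP
      by_cases hoP : Odd P.card
      · simp only [if_pos hoP]
        have hle := Finset.card_le_card hP
        have hcP := Finset.card_sdiff_of_subset hP
        have hodd : Odd (M \ P).card := by
          rw [hcP]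
          obtain ⟨k, hk⟩ := hn
          obtain ⟨l, hl⟩ := hoP
          exact ⟨k - l - 1, by omega⟩
        have h1 := ih (M \ P).card (by rw [hcP]; have := hn.pos; have := hoP.pos; omega) (M \ P) rfl hodd
        rw [Finset.sum_filter] at h1
        have : ∀ R : Finset (Fin m), (if Odd R.card then tS P * tS R else 0) =
            tS P * (if Odd R.card then tS R else 0) := by
          intro R; split_ifs <;> simp
        rw [Finset.sum_congr rfl (fun R _ => this R), ← Finset.mul_sum, h1, mul_one]
      · simp [if_neg hoP]
    rw [Finset.sum_congr rfl this, Finset.sum_sigma', Finset.sum_sigma']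
    symm
    apply Finset.sum_nbij' (fun x => ⟨x.1 ∪ x.2, x.1⟩) (fun y => ⟨y.2, y.1 \ y.2⟩)
    · rintro ⟨P, R⟩ h
      simp only [Finset.mem_sigma, Finset.mem_powerset] at h ⊢
      exact ⟨Finset.union_subset h.1 (h.2.trans Finset.sdiff_subset), Finset.subset_union_left⟩
    · rintro ⟨Q, P⟩ h
      simp only [Finset.mem_sigma, Finset.mem_powerset] at h ⊢
      exact ⟨h.2.trans h.1, Finset.sdiff_subset_sdiff h.1 (le_refl _)⟩
    · rintro ⟨P, R⟩ h
      simp only [Finset.mem_sigma, Finset.mem_powerset] at h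
      have hd : Disjoint R P := Finset.disjoint_of_subset_left h.2 Finset.sdiff_disjoint
      simp only [Finset.union_sdiff_left, Sigma.mk.injEq, heq_eq_eq, true_and]
      exact Finset.sdiff_eq_self_of_disjoint hd
    · rintro ⟨Q, P⟩ h
      simp only [Finset.mem_sigma, Finset.mem_powerset] at h
      simp only [Sigma.mk.injEq, heq_eq_eq, and_true]
      exact Finset.union_sdiff_of_subset h.2
    · rintro ⟨P, R⟩ h
      simp only [Finset.mem_sigma, Finset.mem_powerset] at h
      have hd : Disjoint R P := Finset.disjoint_of_subset_left h.2 Finset.sdiff_disjoint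
      have : (P ∪ R) \ P = R := by
        rw [Finset.union_sdiff_left]; exact Finset.sdiff_eq_self_of_disjoint hd
      simp only [this]
  rw [e2, e3]
  ring

abbrev XT (m : ℕ) := Finset (Finset (Fin m)) × Finset (Finset (Fin m))

/-- combinatorial encoding of a good forest: leaf sets of components, leaf sets below inner
vertices, every component being rooted at its largest leaf -/
structure VX (L : Finset (Fin m)) (X : XT m) : Prop where
  ne : ∀ T ∈ X.1, T.Nonempty
  even : ∀ T ∈ X.1, Even T.card
  disj : ∀ T ∈ X.1, ∀ T' ∈ X.1, T ≠ T' → Disjoint T T'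
  cov : ∀ x, x ∈ L ↔ ∃ T ∈ X.1, x ∈ T
  od : Od X.2
  sub : ∀ D ∈ X.2, ∃ T ∈ X.1, ∃ ρ ∈ T, (∀ c ∈ T, c ≤ ρ) ∧ D ⊆ T.erase ρ
  top : ∀ T ∈ X.1, ∀ ρ ∈ T, (∀ c ∈ T, c ≤ ρ) → 4 ≤ T.card → T.erase ρ ∈ X.2

noncomputable def VXs (L : Finset (Fin m)) : Finset (XT m) := Finset.univ.filter (VX L)

theorem mem_VXs {L : Finset (Fin m)} {X : XT m} : X ∈ VXs L ↔ VX L X := by simp [VXs]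

noncomputable def sL (L : Finset (Fin m)) : ℤ := ∑ X ∈ VXs L, wt X.2

theorem VX.subL {L : Finset (Fin m)} {X : XT m} (h : VX L X) {T} (hT : T ∈ X.1) : T ⊆ L :=
  fun x hx => (h.cov x).2 ⟨T, hT, hx⟩

theorem VX.subL2 {L : Finset (Fin m)} {X : XT m} (h : VX L X) {D} (hD : D ∈ X.2) : D ⊆ L := by
  obtain ⟨T, hT, ρ, -, -, hs⟩ := h.sub D hD
  exact hs.trans ((Finset.erase_subset _ _).trans (h.subL hT))

theorem sL_empty : sL (∅ : Finset (Fin m)) = 1 := by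
  have : VXs (∅ : Finset (Fin m)) = {(∅, ∅)} := by
    ext ⟨p, C⟩
    rw [mem_VXs, Finset.mem_singleton]
    constructor
    · intro h
      have h1 : p = ∅ := by
        rw [Finset.eq_empty_iff_forall_notMem]
        intro T hT
        obtain ⟨x, hx⟩ := h.ne T hT
        have := h.subL hT hx
        simp at this
      subst h1
      have h2 : C = ∅ := by
        rw [Finset.eq_empty_iff_forall_notMem]
        intro D hD
        obtain ⟨T, hT, -⟩ := h.sub D hD
        simp at hT
      rw [h2]
    · intro h
      simp only [Prod.mk.injEq] at h
      obtain ⟨rfl, rfl⟩ := h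
      exact ⟨by simp, by simp, by simp, by simp, ⟨by simp, by simp, by simp⟩, by simp, by simp⟩
  unfold sL
  rw [this]
  simp [wt]

theorem sL_rec {L : Finset (Fin m)} {b : Fin m} (hb : b ∈ L) (hmax : ∀ c ∈ L, c ≤ b) :
    sL L = ∑ Q ∈ (L.erase b).powerset.filter (fun Q => Odd Q.card), tS Q * sL (L \ insert b Q) := by
  set PP := (L.erase b).powerset.filter (fun Q => Odd Q.card) with hPP
  have e2 : ∀ Q ∈ PP, tS Q * sL (L \ insert b Q) =
      ∑ x ∈ Lam Q ×ˢ VXs (L \ insert b Q), wt x.1 * wt x.2.2 := by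
    intro P hP
    unfold tS sL
    rw [Finset.sum_mul_sum, Finset.sum_product]
  rw [Finset.sum_congr rfl e2, Finset.sum_sigma']
  have data : ∀ Q ∈ PP, ∀ x ∈ Lam Q ×ˢ VXs (L \ insert b Q),
      Sep Q (L \ insert b Q) x.1 x.2.2 ∧ insert b Q ∉ x.2.1 ∧ b ∉ Q ∧ Q ⊆ L ∧ Odd Q.card ∧
      Od x.1 ∧ (∀ D ∈ x.1, D ⊆ Q) ∧ (3 ≤ Q.card → Q ∈ x.1) ∧ VX (L \ insert b Q) x.2 := by
    intro Q hQ x hx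
    simp only [hPP, Finset.mem_filter, Finset.mem_powerset] at hQ
    rw [Finset.mem_product] at hx
    have h1 := mem_Lam.1 hx.1
    have h2 := mem_VXs.1 hx.2
    have hbQ : b ∉ Q := fun h => Finset.notMem_erase _ _ (hQ.1 h)
    refine ⟨⟨?_, h1.1, h2.od, h1.2.1, fun D hD => h2.subL2 hD⟩, ?_, hbQ,
      hQ.1.trans (Finset.erase_subset _ _), hQ.2, h1.1, h1.2.1, h1.2.2, h2⟩
    · rw [Finset.disjoint_left]
      intro x hx hx'
      exact (Finset.mem_sdiff.1 hx').2 (Finset.mem_insert_of_mem hx)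
    · intro hc
      exact (Finset.mem_sdiff.1 (h2.subL hc (Finset.mem_insert_self b Q))).2 (Finset.mem_insert_self b Q)
  symm
  unfold sL
  apply Finset.sum_nbij (fun y => (insert (insert b y.1) y.2.2.1, y.2.1 ∪ y.2.2.2))
  · rintro ⟨Q, C1, p, C2⟩ hy
    rw [Finset.mem_sigma] at hy
    obtain ⟨hsep, hnot, hbQ, hQL, hQo, hod1, hsub1, htop1, hV⟩ := data Q hy.1 _ hy.2
    simp only at *
    have hTL : insert b Q ⊆ L := Finset.insert_subset hb hQL
    have hdisj : ∀ T ∈ p, Disjoint (insert b Q) T := fun T hT =>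
      Finset.disjoint_of_subset_right (hV.subL hT) Finset.disjoint_sdiff
    have hmaxu : ∀ ρ ∈ insert b Q, (∀ c ∈ insert b Q, c ≤ ρ) → ρ = b := fun ρ h1 h2 =>
      le_antisymm (hmax _ (hTL h1)) (h2 b (Finset.mem_insert_self _ _))
    have her : (insert b Q).erase b = Q := Finset.erase_insert hbQ
    rw [mem_VXs]
    refine ⟨?_, ?_, ?_, ?_, hsep.od, ?_, ?_⟩
    · intro T hT
      rcases Finset.mem_insert.1 hT with rfl | hT
      · exact ⟨b, Finset.mem_insert_self _ _⟩
      · exact hV.ne T hT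
    · intro T hT
      rcases Finset.mem_insert.1 hT with rfl | hT
      · rw [Finset.card_insert_of_notMem hbQ]
        exact hQo.add_one
      · exact hV.even T hT
    · intro T hT T' hT' hne
      rcases Finset.mem_insert.1 hT with h1 | h1 <;> rcases Finset.mem_insert.1 hT' with h2 | h2
      · exact absurd (h1.trans h2.symm) hne
      · rw [h1]; exact hdisj T' h2
      · rw [h2]; exact (hdisj T h1).symm
      · exact hV.disj T h1 T' h2 hne
    · intro x
      constructor
      · intro hx
        by_cases h1 : x ∈ insert b Q
        · exact ⟨_, Finset.mem_insert_self _ _, h1⟩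
        · obtain ⟨T, hT, hxT⟩ := (hV.cov x).1 (Finset.mem_sdiff.2 ⟨hx, h1⟩)
          exact ⟨T, Finset.mem_insert_of_mem hT, hxT⟩
      · rintro ⟨T, hT, hxT⟩
        rcases Finset.mem_insert.1 hT with rfl | hT
        · exact hTL hxT
        · exact (Finset.mem_sdiff.1 (hV.subL hT hxT)).1
    · intro D hD
      rcases Finset.mem_union.1 hD with hD | hD
      · exact ⟨_, Finset.mem_insert_self _ _, b, Finset.mem_insert_self _ _, fun c hc => hmax c (hTL hc),
          by rw [her]; exact hsub1 D hD⟩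
      · obtain ⟨T, hT, h⟩ := hV.sub D hD
        exact ⟨T, Finset.mem_insert_of_mem hT, h⟩
    · intro T hT ρ hρ hm h4
      rcases Finset.mem_insert.1 hT with rfl | hT
      · have := hmaxu ρ hρ hm
        subst this
        rw [her]
        refine Finset.mem_union_left _ (htop1 ?_)
        rw [Finset.card_insert_of_notMem hbQ] at h4
        omega
      · exact Finset.mem_union_right _ (hV.top T hT ρ hρ hm h4)
  · rintro ⟨Q, C1, p, C2⟩ hy ⟨Q', C1', p', C2'⟩ hy' h
    rw [Finset.mem_coe, Finset.mem_sigma] at hy hy'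
    obtain ⟨hsep, hnot, hbQ, hQL, hQo, hod1, hsub1, htop1, hV⟩ := data Q hy.1 _ hy.2
    obtain ⟨hsep', hnot', hbQ', hQL', hQo', hod1', hsub1', htop1', hV'⟩ := data Q' hy'.1 _ hy'.2
    simp only [Prod.mk.injEq] at *
    obtain ⟨h1, h2⟩ := h
    have hQQ : insert b Q = insert b Q' := by
      have h3 : insert b Q ∈ insert (insert b Q') p' := by rw [← h1]; exact Finset.mem_insert_self _ _
      rcases Finset.mem_insert.1 h3 with h3 | h3
      · exact h3
      · exact absurd (Finset.mem_insert_self b Q')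
          (Finset.mem_sdiff.1 (hV'.subL h3 (Finset.mem_insert_self b Q))).2
    have hQ : Q = Q' := by rw [← Finset.erase_insert hbQ, hQQ, Finset.erase_insert hbQ']
    subst hQ
    have hp : p = p' := by rw [← Finset.erase_insert hnot, h1, Finset.erase_insert hnot']
    have hC1 : C1 = C1' := by rw [← hsep.filter1, h2, hsep'.filter1]
    have hC2 : C2 = C2' := by
      rw [← hsep.symm.filter1, Finset.union_comm, h2, Finset.union_comm, hsep'.symm.filter1]
    rw [hp, hC1, hC2]
  · rintro ⟨p, C⟩ hX
    rw [Finset.mem_coe, mem_VXs] at hX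
    obtain ⟨T, hT, hbT⟩ := (hX.cov b).1 hb
    have hTL := hX.subL hT
    have hins : insert b (T.erase b) = T := Finset.insert_erase hbT
    have hmT : ∀ c ∈ T, c ≤ b := fun c hc => hmax c (hTL hc)
    simp only at hT
    -- location of the members
    have loc : ∀ D ∈ C, D ⊆ T.erase b ∨ ∃ T' ∈ p, T' ≠ T ∧ D ⊆ L \ T ∧
        ∃ ρ ∈ T', (∀ c ∈ T', c ≤ ρ) ∧ D ⊆ T'.erase ρ := by
      intro D hD
      obtain ⟨T', hT', ρ, hρ, hm, hs⟩ := hX.sub D hD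
      by_cases he : T' = T
      · subst he
        left
        have : ρ = b := le_antisymm (hmT ρ hρ) (hm b hbT)
        rwa [this] at hs
      · right
        refine ⟨T', hT', he, ?_, ρ, hρ, hm, hs⟩
        intro x hx
        have hxT' := Finset.mem_of_mem_erase (hs hx)
        exact Finset.mem_sdiff.2 ⟨hX.subL hT' hxT',
          Finset.disjoint_left.1 (hX.disj T' hT' T hT he) hxT'⟩
    have oth : ∀ x ∈ L \ T, ∃ T' ∈ p.erase T, x ∈ T' := by
      intro x hx
      rw [Finset.mem_sdiff] at hx
      obtain ⟨T', hT', hxT'⟩ := (hX.cov x).1 hx.1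
      refine ⟨T', Finset.mem_erase.2 ⟨?_, hT'⟩, hxT'⟩
      rintro rfl; exact hx.2 hxT'
    refine ⟨⟨T.erase b, C.filter (fun D => D ⊆ T.erase b), p.erase T,
      C.filter (fun D => D ⊆ L \ T)⟩, ?_, ?_⟩
    · rw [Finset.mem_coe, Finset.mem_sigma]
      simp only [hPP, Finset.mem_filter, Finset.mem_powerset, Finset.mem_product]
      rw [hins]
      have hcT := Finset.card_erase_of_mem hbT
      have hposT := Finset.card_pos.2 ⟨b, hbT⟩
      refine ⟨⟨Finset.erase_subset_erase _ hTL, ?_⟩, mem_Lam.2 ⟨hX.od.mono (Finset.filter_subset _ _),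
        fun D hD => (Finset.mem_filter.1 hD).2, ?_⟩, mem_VXs.2 ?_⟩
      · rw [hcT]
        exact Nat.Even.sub_odd hposT (hX.even T hT) odd_one
      · intro h3
        exact Finset.mem_filter.2 ⟨hX.top T hT b hbT hmT (by omega), le_refl _⟩
      · refine ⟨fun T' hT' => hX.ne T' (Finset.mem_of_mem_erase hT'),
          fun T' hT' => hX.even T' (Finset.mem_of_mem_erase hT'),
          fun T' hT' T'' hT'' => hX.disj T' (Finset.mem_of_mem_erase hT') T'' (Finset.mem_of_mem_erase hT''),
          ?_, hX.od.mono (Finset.filter_subset _ _), ?_, ?_⟩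
        · intro x
          constructor
          · exact oth x
          · rintro ⟨T', hT', hx⟩
            rw [Finset.mem_erase] at hT'
            exact Finset.mem_sdiff.2 ⟨hX.subL hT'.2 hx,
              Finset.disjoint_left.1 (hX.disj T' hT'.2 T hT hT'.1) hx⟩
        · intro D hD
          simp only [Finset.mem_filter] at hD
          rcases loc D hD.1 with h | ⟨T', hT', hne, -, h⟩
          · obtain ⟨x, hx⟩ := hX.od.plNe (Or.inl hD.1)
            exact absurd (Finset.mem_of_mem_erase (h hx)) (Finset.mem_sdiff.1 (hD.2 hx)).2
          · exact ⟨T', Finset.mem_erase.2 ⟨hne, hT'⟩, h⟩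
        · intro T' hT' ρ hρ hm h4
          rw [Finset.mem_erase] at hT'
          refine Finset.mem_filter.2 ⟨hX.top T' hT'.2 ρ hρ hm h4, ?_⟩
          intro x hx
          have hx := Finset.mem_of_mem_erase hx
          exact Finset.mem_sdiff.2 ⟨hX.subL hT'.2 hx,
              Finset.disjoint_left.1 (hX.disj T' hT'.2 T hT hT'.1) hx⟩
    · simp only [hins, Finset.insert_erase hT, Prod.mk.injEq, true_and]
      ext D
      simp only [Finset.mem_union, Finset.mem_filter]
      constructor
      · rintro (h | h) <;> exact h.1
      · intro hD
        rcases loc D hD with h | ⟨T', hT', hne, h, -⟩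
        · exact Or.inl ⟨hD, h⟩
        · exact Or.inr ⟨hD, h⟩
  · rintro ⟨Q, x⟩ hy
    rw [Finset.mem_sigma] at hy
    obtain ⟨hsep, -⟩ := data Q hy.1 x hy.2
    exact hsep.wt.symm

theorem sL_one (n : ℕ) : ∀ L : Finset (Fin m), L.card = n → Even n → sL L = 1 := by
  induction n using Nat.strong_induction_on with
  | _ n ih =>
  intro L hL hn
  rcases L.eq_empty_or_nonempty with rfl | hne
  · exact sL_empty
  · have hb := L.max'_mem hne
    set b := L.max' hne
    have hpos := Finset.card_pos.2 hne
    have hodd : Odd (L.erase b).card := by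
      rw [Finset.card_erase_of_mem hb, hL]
      exact Nat.Even.sub_odd (by omega) hn odd_one
    rw [sL_rec hb (fun c hc => L.le_max' c hc), ← uS _ (L.erase b) rfl hodd]
    apply Finset.sum_congr rfl
    intro Q hQ
    simp only [Finset.mem_filter, Finset.mem_powerset] at hQ
    have hbQ : b ∉ Q := fun h => Finset.notMem_erase _ _ (hQ.1 h)
    have hs : insert b Q ⊆ L := Finset.insert_subset hb (hQ.1.trans (Finset.erase_subset _ _))
    have hc := Finset.card_insert_of_notMem hbQ
    have hcs := Finset.card_sdiff_of_subset hs
    have hle := Finset.card_le_card hs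
    rw [ih (L \ insert b Q).card (by omega) _ rfl ?_, mul_one]
    rw [hcs, hc, hL]
    obtain ⟨k, hk⟩ := hn
    obtain ⟨l, hl⟩ := hQ.2
    exact ⟨k - l - 1, by omega⟩

end Fam
end GFM

namespace GFM

section Root
variable {m : ℕ}

/-- leaves of a vertex set -/
noncomputable def lv {V : Type} (S : Set (Fin m ⊕ V)) : Finset (Fin m) :=
  Finset.univ.filter (fun i => Sum.inl i ∈ S)

theorem mem_lv {V : Type} {S : Set (Fin m ⊕ V)} {i : Fin m} : i ∈ lv S ↔ Sum.inl i ∈ S := by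
  simp [lv]

theorem cut_leaf (F : GoodForest m) {S : Set (Fin m ⊕ Fin F.n)} (hS : Cut1 F.G S)
    (hne : S.Nonempty) : ∃ i, Sum.inl i ∈ S := by
  by_contra hc
  push Not at hc
  obtain ⟨x, hx⟩ := hne
  obtain ⟨e, he⟩ := hS.target x
  refine leafless F.acyclic (A := S) ⟨x, hx⟩ ?_ e e (fun x y h => Or.inl (he x y h))
  rintro (i | j) h
  · exact absurd h (hc i)
  · exact F.internal_degree_ge j

theorem lv_sub (F : GoodForest m) {S T : Set (Fin m ⊕ Fin F.n)} (hS : Cut1 F.G S)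
    (hT : Cut1 F.G T) (h : lv S ⊆ lv T) : S ⊆ T := by
  apply cut_sub F.acyclic hS hT
  rintro (i | j) h1 h2
  · exact absurd (mem_lv.1 (h (mem_lv.2 h1))) h2
  · exact F.internal_degree_ge j

/-- rooting of a forest at the maximal leaves -/
structure Rt (F : GoodForest m) (rt : Fin m ⊕ Fin F.n → Fin m)
    (p : Fin m ⊕ Fin F.n → Fin m ⊕ Fin F.n) : Prop where
  reach : ∀ x, F.G.Reachable x (Sum.inl (rt x))
  max : ∀ x i, F.G.Reachable x (Sum.inl i) → i ≤ rt x
  adj : ∀ x, F.G.Adj x (p x)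
  sd : ∀ x, x ≠ Sum.inl (rt x) → Sum.inl (rt x) ∈ side F.G x (p x)

theorem exists_rt (F : GoodForest m) : ∃ rt p, Rt F rt p := by
  have h1 : ∀ x : Fin m ⊕ Fin F.n, ∃ r, F.G.Reachable x (Sum.inl r) ∧
      ∀ i, F.G.Reachable x (Sum.inl i) → i ≤ r := by
    intro x
    obtain ⟨i, hi⟩ := cut_leaf F (clo_comp (G := F.G) x).cut1 ⟨x, SimpleGraph.Reachable.refl x⟩
    obtain ⟨r, hr, hm⟩ := Finset.exists_max_image
      (Finset.univ.filter (fun i => F.G.Reachable x (Sum.inl i))) id ⟨i, by simpa using hi⟩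
    simp only [Finset.mem_filter, Finset.mem_univ, true_and, id] at hr hm
    exact ⟨r, hr, hm⟩
  choose rt hr hm using h1
  have h2 : ∀ x : Fin m ⊕ Fin F.n, ∃ w, F.G.Adj x w ∧
      (x ≠ Sum.inl (rt x) → Sum.inl (rt x) ∈ side F.G x w) := by
    intro x
    by_cases hx : x = Sum.inl (rt x)
    · rw [hx]
      obtain ⟨w, hw⟩ := leaf_nbr F (rt x)
      exact ⟨w, (hw w).2 rfl, fun h => absurd hx (by
        intro hx'; rw [← hx'] at h; exact h hx')⟩
    · obtain ⟨w, hw, hs⟩ := side_cover (hr x) (Ne.symm hx)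
      exact ⟨w, hw, fun _ => hs⟩
  choose p ha hs using h2
  exact ⟨rt, p, hr, hm, ha, hs⟩

variable {F : GoodForest m} {rt : Fin m ⊕ Fin F.n → Fin m}
    {p : Fin m ⊕ Fin F.n → Fin m ⊕ Fin F.n}

/-- branch at `x` -/
def Br (F : GoodForest m) (p : Fin m ⊕ Fin F.n → Fin m ⊕ Fin F.n) (x : Fin m ⊕ Fin F.n) :
    Set (Fin m ⊕ Fin F.n) := side F.G (p x) x

theorem Br_self (x) : x ∈ Br F p x := mem_side_self _ _

theorem Rt.cross (h : Rt F rt p) {x a b} (c : Cross F.G (Br F p x) a b) : a = x ∧ b = p x :=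
  cross_side F.acyclic (h.adj x).symm c

theorem Rt.cut1 (h : Rt F rt p) (x) : Cut1 F.G (Br F p x) := side_cut1 F.acyclic (h.adj x).symm

theorem Rt.p_not (h : Rt F rt p) (x) : p x ∉ Br F p x := acyclic_side F.acyclic (h.adj x).symm

theorem Rt.up (h : Rt F rt p) {x z} (hz : z ∈ Br F p x) (hne : z ≠ x) : p z ∈ Br F p x := by
  by_contra hc
  exact hne (h.cross ⟨h.adj z, hz, hc⟩).1

theorem Rt.rt_eq (h : Rt F rt p) {x y} (r : F.G.Reachable x y) : rt x = rt y :=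
  le_antisymm (h.max y _ (r.symm.trans (h.reach x))) (h.max x _ (r.trans (h.reach y)))

theorem Rt.root_not (h : Rt F rt p) {x} (hx : x ≠ Sum.inl (rt x)) :
    Sum.inl (rt x) ∉ Br F p x := fun hc =>
  Set.disjoint_left.1 (side_disj F.acyclic (h.adj x)) (h.sd x hx) hc

theorem Br_reach {x z} (hz : z ∈ Br F p x) : F.G.Reachable x z := side_reach hz

/-- the branch at a leaf is trivial -/
theorem Rt.leaf (h : Rt F rt p) (i : Fin m) : Br F p (Sum.inl i) = {Sum.inl i} := by
  obtain ⟨w, hw⟩ := leaf_nbr F i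
  apply Set.Subset.antisymm
  · apply side_min
    · rfl
    · intro x y a hx _ hne
      rw [Set.mem_singleton_iff] at hx
      subst hx
      exfalso
      apply hne
      rw [(hw y).1 a, (hw _).1 (h.adj (Sum.inl i))]
      exact Sym2.eq_swap
  · intro x hx
    rw [Set.mem_singleton_iff] at hx
    rw [hx]; exact Br_self _

theorem Rt.anti (h : Rt F rt p) {x z} (h1 : z ∈ Br F p x) (h2 : x ∈ Br F p z) : x = z := by
  by_contra hne
  have hroot : ∀ y w, w ∈ Br F p y → y ≠ w → y ≠ Sum.inl (rt y) := by
    intro y w hw hyw hy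
    rw [hy, h.leaf, Set.mem_singleton_iff] at hw
    exact hyw (hy.trans hw.symm)
  have hx := hroot x z h1 hne
  have hz := hroot z x h2 (Ne.symm hne)
  have hc : Clo F.G (Br F p x ∪ Br F p z) := by
    intro a b ab ha
    by_contra hb
    rw [Set.mem_union, not_or] at hb
    rcases ha with ha | ha
    · obtain ⟨rfl, rfl⟩ := h.cross ⟨ab, ha, hb.1⟩
      exact hb.2 (h.up h2 hne)
    · obtain ⟨rfl, rfl⟩ := h.cross ⟨ab, ha, hb.2⟩
      exact hb.1 (h.up h1 (Ne.symm hne))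
  have hr := hc.reach (Or.inl (Br_self x)) (h.reach x)
  rcases hr with hr | hr
  · exact h.root_not hx hr
  · rw [h.rt_eq (Br_reach h1)] at hr
    exact h.root_not hz hr

theorem Rt.sub (h : Rt F rt p) {x z} (h1 : z ∈ Br F p x) : Br F p z ⊆ Br F p x := by
  by_cases hne : x = z
  · rw [hne]
  apply side_min h1
  intro a b ab ha haz _
  by_contra hb
  obtain ⟨rfl, rfl⟩ := h.cross ⟨ab, ha, hb⟩
  exact hne (h.anti h1 haz)

theorem Rt.disj (h : Rt F rt p) {x z} (h1 : z ∉ Br F p x) (h2 : x ∉ Br F p z) :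
    Disjoint (Br F p x) (Br F p z) := by
  rw [Set.disjoint_left]
  suffices Br F p x ⊆ (Br F p z)ᶜ from fun a ha hb => this ha hb
  apply side_min h2
  intro a b ab ha hax hne hb
  obtain ⟨rfl, rfl⟩ := h.cross ⟨ab.symm, hb, ha⟩
  by_cases hbx : b ∈ Br F p x
  · exact h1 hbx
  · obtain ⟨h3, h4⟩ := h.cross ⟨ab, hax, hbx⟩
    apply hne
    rw [h3, h4]; exact Sym2.eq_swap

theorem Rt.orient (h : Rt F rt p) {x y} (a : F.G.Adj x y) :
    (x ≠ Sum.inl (rt x) ∧ y = p x) ∨ (y ≠ Sum.inl (rt y) ∧ x = p y) := by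
  have he := h.rt_eq a.reachable
  have key : ∀ x y, F.G.Adj x y → Sum.inl (rt x) ∈ side F.G x y →
      (x ≠ Sum.inl (rt x) ∧ y = p x) := by
    intro x y a hs
    have hx : x ≠ Sum.inl (rt x) := by
      intro hx
      rw [← hx] at hs
      exact acyclic_side F.acyclic a hs
    refine ⟨hx, ?_⟩
    by_contra hne
    exact Set.disjoint_left.1 (side_disj_nbr F.acyclic a (h.adj x) hne) hs (h.sd x hx)
  rcases side_union F.acyclic a (h.reach x) with hs | hs
  · exact Or.inl (key x y a hs)
  · rw [he] at hs
    exact Or.inr (key y x a.symm hs)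

/-- a neighbour other than the parent is a nonroot child -/
theorem Rt.child (h : Rt F rt p) {x z} (a : F.G.Adj x z) (hz : z ≠ p x) :
    z ≠ Sum.inl (rt z) ∧ x = p z := by
  rcases h.orient a with ⟨_, h1⟩ | h1
  · exact absurd h1 hz
  · exact h1

theorem Rt.child_mem (h : Rt F rt p) {x z} (a : F.G.Adj x z) (hz : z ≠ p x) : z ∈ Br F p x := by
  by_contra hc
  exact hz (h.cross ⟨a, Br_self x, hc⟩).2

theorem Rt.cover (h : Rt F rt p) {x u} (hu : u ∈ Br F p x) (hne : u ≠ x) :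
    ∃ z, F.G.Adj x z ∧ z ≠ p x ∧ u ∈ Br F p z := by
  obtain ⟨w, hw, hs⟩ := side_cover (Br_reach hu) hne
  have hwp : w ≠ p x := by
    rintro rfl
    exact Set.disjoint_left.1 (side_disj F.acyclic (h.adj x)) hs hu
  refine ⟨w, hw, hwp, ?_⟩
  have := (h.child hw hwp).2
  rw [Br, ← this]
  exact hs

/-- leaf set of the branch -/
noncomputable def dd (F : GoodForest m) (p : Fin m ⊕ Fin F.n → Fin m ⊕ Fin F.n)
    (x : Fin m ⊕ Fin F.n) : Finset (Fin m) := lv (Br F p x)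

theorem Rt.dd_sub (h : Rt F rt p) {x z} : dd F p z ⊆ dd F p x ↔ z ∈ Br F p x := by
  constructor
  · intro hs
    exact lv_sub F (h.cut1 z) (h.cut1 x) hs (Br_self z)
  · intro hs i hi
    exact mem_lv.2 (h.sub hs (mem_lv.1 hi))

theorem Rt.dd_inj (h : Rt F rt p) {x z} (e : dd F p x = dd F p z) : x = z :=
  h.anti (h.dd_sub.1 e.ge) (h.dd_sub.1 e.le)

theorem Rt.dd_leaf (h : Rt F rt p) (i : Fin m) : dd F p (Sum.inl i) = {i} := by
  ext k
  rw [dd, mem_lv, h.leaf]; simp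

theorem Rt.dd_ne (h : Rt F rt p) (x) : (dd F p x).Nonempty := by
  obtain ⟨i, hi⟩ := cut_leaf F (h.cut1 x) ⟨x, Br_self x⟩
  exact ⟨i, mem_lv.2 hi⟩

theorem Rt.dd_disj (h : Rt F rt p) {x z} (h1 : z ∉ Br F p x) (h2 : x ∉ Br F p z) :
    Disjoint (dd F p x) (dd F p z) := by
  rw [Finset.disjoint_left]
  intro i hi hi'
  exact Set.disjoint_left.1 (h.disj h1 h2) (mem_lv.1 hi) (mem_lv.1 hi')

theorem Rt.sib (h : Rt F rt p) {x z z'} (a : F.G.Adj x z) (hz : z ≠ p x) (a' : F.G.Adj x z')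
    (hz' : z' ≠ p x) (hne : z ≠ z') : Disjoint (dd F p z) (dd F p z') := by
  rw [Finset.disjoint_left]
  intro i hi hi'
  have e1 := (h.child a hz).2
  have e2 := (h.child a' hz').2
  rw [dd, mem_lv, Br] at hi hi'
  rw [← e1] at hi
  rw [← e2] at hi'
  exact Set.disjoint_left.1 (side_disj_nbr F.acyclic a a' hne) hi hi'

theorem Rt.dd_odd (h : Rt F rt p) : ∀ n x, (Br F p x).ncard = n → Odd (dd F p x).card := by
  intro n
  induction n using Nat.strong_induction_on with
  | _ n ih =>
  intro x hn
  rcases x with i | j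
  · rw [h.dd_leaf]; simp
  · set Z := Finset.univ.filter (fun z => F.G.Adj (Sum.inr j) z ∧ z ≠ p (Sum.inr j)) with hZ
    have hu : dd F p (Sum.inr j) = Z.biUnion (dd F p) := by
      ext i
      rw [Finset.mem_biUnion]
      constructor
      · intro hi
        obtain ⟨z, h1, h2, h3⟩ := h.cover (mem_lv.1 hi) (by simp)
        exact ⟨z, by simp [hZ, h1, h2], mem_lv.2 h3⟩
      · rintro ⟨z, hz, hi⟩
        simp only [hZ, Finset.mem_filter, Finset.mem_univ, true_and] at hz
        exact h.dd_sub.2 (h.child_mem hz.1 hz.2) hi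
    have hc : (dd F p (Sum.inr j)).card = ∑ z ∈ Z, (dd F p z).card := by
      rw [hu]
      apply Finset.card_biUnion
      intro z hz z' hz' hne
      rw [Finset.mem_coe] at hz hz'
      simp only [hZ, Finset.mem_filter, Finset.mem_univ, true_and] at hz hz'
      exact h.sib hz.1 hz.2 hz'.1 hz'.2 hne
    have hodd : ∀ z ∈ Z, Odd (dd F p z).card := by
      intro z hz
      simp only [hZ, Finset.mem_filter, Finset.mem_univ, true_and] at hz
      refine ih _ ?_ z rfl
      rw [← hn]
      apply Set.ncard_lt_ncard ?_ (Set.toFinite _)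
      refine ⟨h.sub (h.child_mem hz.1 hz.2), fun hs => ?_⟩
      exact hz.1.ne (h.anti (h.child_mem hz.1 hz.2) (hs (Br_self _)))
    have hZc : Odd Z.card := by
      have h1 : F.G.neighborSet (Sum.inr j) = insert (p (Sum.inr j)) (Z : Set _) := by
        ext z
        simp only [SimpleGraph.mem_neighborSet, hZ, Set.mem_insert_iff, Finset.coe_filter,
          Finset.mem_univ, true_and, Set.mem_ofPred_eq]
        constructor
        · intro hz
          by_cases e : z = p (Sum.inr j)
          · exact Or.inl e
          · exact Or.inr ⟨hz, e⟩
        · rintro (rfl | hz)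
          · exact h.adj _
          · exact hz.1
      have h2 := F.internal_degree_even j
      rw [h1, Set.ncard_insert_of_notMem (by simp [hZ]), Set.ncard_coe_finset] at h2
      rw [← Nat.not_even_iff_odd]
      intro h3
      rw [Nat.even_add_one] at h2
      exact h2 h3
    rw [hc, Finset.odd_sum_iff_odd_card_odd]
    rwa [Finset.filter_true_of_mem hodd]

theorem Rt.odd (h : Rt F rt p) (x) : Odd (dd F p x).card := h.dd_odd _ x rfl

theorem Rt.three (h : Rt F rt p) (j : Fin F.n) : 3 ≤ (dd F p (Sum.inr j)).card := by
  have h4 := F.internal_degree_ge j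
  have : 1 < ((F.G.neighborSet (Sum.inr j)) \ {p (Sum.inr j)}).ncard := by
    have hm : p (Sum.inr j) ∈ F.G.neighborSet (Sum.inr j) := h.adj (Sum.inr j)
    rw [Set.ncard_sdiff_singleton_of_mem hm]
    omega
  obtain ⟨z, z', hz, hz', hne⟩ := (Set.one_lt_ncard_iff (Set.toFinite _)).1 this
  have hd := h.sib hz.1 (by simpa using hz.2) hz'.1 (by simpa using hz'.2) hne
  have hs : dd F p z ∪ dd F p z' ⊆ dd F p (Sum.inr j) := Finset.union_subset
    (h.dd_sub.2 (h.child_mem hz.1 (by simpa using hz.2)))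
    (h.dd_sub.2 (h.child_mem hz'.1 (by simpa using hz'.2)))
  have hc := Finset.card_le_card hs
  rw [Finset.card_union_of_disjoint hd] at hc
  have c1 := (h.dd_ne z).card_pos
  have c2 := (h.dd_ne z').card_pos
  obtain ⟨k, hk⟩ := h.odd (Sum.inr j)
  omega

/-- component leaf set -/
noncomputable def cmp (F : GoodForest m) (i : Fin m) : Finset (Fin m) :=
  lv {u | F.G.Reachable (Sum.inl i) u}

theorem mem_cmp {i k : Fin m} : k ∈ cmp F i ↔ F.G.Reachable (Sum.inl i) (Sum.inl k) := mem_lv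

theorem cmp_eq {i k : Fin m} (h : F.G.Reachable (Sum.inl i) (Sum.inl k)) : cmp F i = cmp F k := by
  ext l
  rw [mem_cmp, mem_cmp]
  exact ⟨fun h' => h.symm.trans h', fun h' => h.trans h'⟩

theorem Rt.dd_cmp (h : Rt F rt p) (x) : dd F p x ⊆ cmp F (rt x) := by
  intro i hi
  rw [mem_cmp]
  exact (h.reach x).symm.trans (Br_reach (mem_lv.1 hi))

/-- the leaves below the root -/
theorem Rt.dd_top (h : Rt F rt p) {r : Fin m} (hr : rt (Sum.inl r) = r) :
    dd F p (p (Sum.inl r)) = (cmp F r).erase r := by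
  have a := h.adj (Sum.inl r)
  have hp : Sum.inl r = p (p (Sum.inl r)) := by
    rcases h.orient a with ⟨h1, _⟩ | ⟨_, h1⟩
    · rw [hr] at h1; exact absurd rfl h1
    · exact h1
  have hB : Br F p (p (Sum.inl r)) = side F.G (Sum.inl r) (p (Sum.inl r)) := by
    rw [Br, ← hp]
  ext i
  rw [dd, mem_lv, hB, Finset.mem_erase, mem_cmp]
  constructor
  · intro hi
    refine ⟨?_, a.reachable.trans (side_reach hi)⟩
    rintro rfl
    exact acyclic_side F.acyclic a hi
  · rintro ⟨h1, h2⟩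
    rcases side_union F.acyclic a h2 with h3 | h3
    · exact h3
    · exfalso
      have : side F.G (p (Sum.inl r)) (Sum.inl r) = {Sum.inl r} := h.leaf r
      rw [this] at h3
      exact h1 (Sum.inl_injective h3)

theorem Rt.rt_rt (h : Rt F rt p) (x) : rt (Sum.inl (rt x)) = rt x := (h.rt_eq (h.reach x)).symm

end Root
end GFM

namespace GFM

section Rep
variable {m : ℕ}

def Rl (X : XT m) (A B : Finset (Fin m)) : Prop :=
  (B ∈ X.2 ∧ A ∈ ch X.2 B) ∨ (A ∈ X.2 ∧ B ∈ ch X.2 A) ∨ (Disjoint A B ∧ A ∪ B ∈ X.1)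

theorem Rl.symm {X : XT m} {A B : Finset (Fin m)} (h : Rl X A B) : Rl X B A := by
  rcases h with h | h | ⟨h1, h2⟩
  · exact Or.inr (Or.inl h)
  · exact Or.inl h
  · exact Or.inr (Or.inr ⟨h1.symm, by rwa [Finset.union_comm]⟩)

structure Rep {V : Type} (G : SimpleGraph (Fin m ⊕ V)) (X : XT m)
    (d : Fin m ⊕ V → Finset (Fin m)) : Prop where
  leaf : ∀ i, d (Sum.inl i) = {i}
  inj : Function.Injective d
  rng : ∀ A, A ∈ X.2 ↔ ∃ v, d (Sum.inr v) = A
  adj : ∀ x y, G.Adj x y ↔ Rl X (d x) (d y)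

theorem Rep.pl {V : Type} {G : SimpleGraph (Fin m ⊕ V)} {X : XT m}
    {d : Fin m ⊕ V → Finset (Fin m)} (h : Rep G X d) {A} : Pl X.2 A ↔ ∃ x, d x = A := by
  constructor
  · rintro (hA | hA)
    · obtain ⟨v, hv⟩ := (h.rng A).1 hA
      exact ⟨_, hv⟩
    · obtain ⟨i, rfl⟩ := Finset.card_eq_one.1 hA
      exact ⟨_, h.leaf i⟩
  · rintro ⟨x | v, rfl⟩
    · rw [h.leaf]; exact pl_single _ _
    · exact Or.inl ((h.rng _).2 ⟨v, rfl⟩)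

theorem exists_rep (F : GoodForest m) : ∃ X d, VX Finset.univ X ∧ Rep F.G X d := by
  obtain ⟨rt, p, h⟩ := exists_rt F
  set C : Finset (Finset (Fin m)) := Finset.univ.image (fun j : Fin F.n => dd F p (Sum.inr j)) with hC
  set π : Finset (Finset (Fin m)) := Finset.univ.image (fun i : Fin m => cmp F i) with hπ
  have memC : ∀ A, A ∈ C ↔ ∃ j, dd F p (Sum.inr j) = A := by simp [hC]
  have memπ : ∀ A, A ∈ π ↔ ∃ i, cmp F i = A := by simp [hπ]
  have hpl : ∀ A, Pl C A ↔ ∃ x, dd F p x = A := by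
    intro A
    constructor
    · rintro (hA | hA)
      · obtain ⟨v, hv⟩ := (memC A).1 hA
        exact ⟨_, hv⟩
      · obtain ⟨i, rfl⟩ := Finset.card_eq_one.1 hA
        exact ⟨_, h.dd_leaf i⟩
    · rintro ⟨x | v, rfl⟩
      · rw [h.dd_leaf]; exact pl_single _ _
      · exact Or.inl ((memC _).2 ⟨v, rfl⟩)
  have hlam : ∀ x y, dd F p x ⊆ dd F p y ∨ dd F p y ⊆ dd F p x ∨ Disjoint (dd F p x) (dd F p y) := by
    intro x y
    by_cases h1 : x ∈ Br F p y
    · exact Or.inl (h.dd_sub.2 h1)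
    · by_cases h2 : y ∈ Br F p x
      · exact Or.inr (Or.inl (h.dd_sub.2 h2))
      · exact Or.inr (Or.inr (h.dd_disj h2 h1))
  -- maximal elements of components are roots
  have hmaxrt : ∀ i ρ, ρ ∈ cmp F i → (∀ c ∈ cmp F i, c ≤ ρ) → cmp F i = cmp F ρ ∧
      rt (Sum.inl ρ) = ρ := by
    intro i ρ hρ hm
    have hr := mem_cmp.1 hρ
    refine ⟨cmp_eq hr, le_antisymm ?_ ?_⟩
    · apply hm
      rw [mem_cmp]
      exact hr.trans (h.reach _)
    · exact h.max _ _ (SimpleGraph.Reachable.refl _)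
  have hrtmax : ∀ x, ∀ c ∈ cmp F (rt x), c ≤ rt x := by
    intro x c hc
    exact h.max x c ((h.reach x).trans (mem_cmp.1 hc))
  have hself : ∀ i, i ∈ cmp F i := fun i => mem_cmp.2 (SimpleGraph.Reachable.refl _)
  have hcmprt : ∀ i, cmp F i = cmp F (rt (Sum.inl i)) := fun i => cmp_eq (h.reach _)
  have hrt2 : ∀ i, rt (Sum.inl (rt (Sum.inl i))) = rt (Sum.inl i) := fun i => h.rt_rt _
  have hod : Od C := by
    constructor
    · intro D hD
      obtain ⟨j, rfl⟩ := (memC D).1 hD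
      exact h.odd _
    · intro D hD
      obtain ⟨j, rfl⟩ := (memC D).1 hD
      exact h.three _
    · intro A hA B hB
      obtain ⟨j, rfl⟩ := (memC A).1 hA
      obtain ⟨j', rfl⟩ := (memC B).1 hB
      exact hlam _ _
  have hssub : ∀ {x z}, dd F p z ⊂ dd F p x ↔ z ∈ Br F p x ∧ z ≠ x := by
    intro x z
    rw [Finset.ssubset_iff_subset_ne, h.dd_sub]
    constructor
    · rintro ⟨h1, h2⟩
      exact ⟨h1, fun e => h2 (by rw [e])⟩
    · rintro ⟨h1, h2⟩
      exact ⟨h1, fun e => h2 (h.dd_inj e)⟩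
  have hch : ∀ x, ch C (dd F p x) =
      (Finset.univ.filter (fun z => F.G.Adj x z ∧ z ≠ p x)).image (dd F p) := by
    intro x
    apply ch_eq
    · intro E hE
      simp only [Finset.mem_image, Finset.mem_filter, Finset.mem_univ, true_and] at hE
      obtain ⟨z, ⟨h1, h2⟩, rfl⟩ := hE
      exact ⟨(hpl _).2 ⟨z, rfl⟩, hssub.2 ⟨h.child_mem h1 h2, h1.ne'⟩⟩
    · intro E hE hEx
      obtain ⟨y, rfl⟩ := (hpl E).1 hE
      obtain ⟨h1, h2⟩ := hssub.1 hEx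
      obtain ⟨z, h3, h4, h5⟩ := h.cover h1 h2
      refine ⟨dd F p z, ?_, h.dd_sub.2 h5⟩
      simp only [Finset.mem_image, Finset.mem_filter, Finset.mem_univ, true_and]
      exact ⟨z, ⟨h3, h4⟩, rfl⟩
    · intro E hE E' hE' hs
      simp only [Finset.mem_image, Finset.mem_filter, Finset.mem_univ, true_and] at hE hE'
      obtain ⟨z, ⟨h1, h2⟩, rfl⟩ := hE
      obtain ⟨z', ⟨h1', h2'⟩, rfl⟩ := hE'
      by_contra hne
      have hd := h.sib h1 h2 h1' h2' (fun e => hne (by rw [e]))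
      obtain ⟨i, hi⟩ := h.dd_ne z
      exact Finset.disjoint_left.1 hd hi (hs hi)
  have hnleaf : ∀ x z, F.G.Adj x z → z ≠ p x → ∃ j, x = Sum.inr j := by
    intro x z a hz
    rcases x with i | j
    · exfalso
      obtain ⟨w, hw⟩ := leaf_nbr F i
      exact hz (((hw z).1 a).trans ((hw _).1 (h.adj _)).symm)
    · exact ⟨j, rfl⟩
  have hrooted : ∀ x : Fin m ⊕ Fin F.n, x ≠ Sum.inl (rt x) → dd F p x ⊆ (cmp F (rt x)).erase (rt x) := by
    intro x hx
    apply Finset.subset_erase.2 ⟨h.dd_cmp x, ?_⟩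
    intro hc
    exact h.root_not hx (mem_lv.1 hc)
  refine ⟨(π, C), dd F p, ?_, ?_⟩
  · constructor
    · intro T hT
      obtain ⟨i, rfl⟩ := (memπ T).1 hT
      exact ⟨i, hself i⟩
    · intro T hT
      obtain ⟨i, rfl⟩ := (memπ T).1 hT
      rw [hcmprt]
      have h1 := h.dd_top (hrt2 i)
      have h2 := h.odd (p (Sum.inl (rt (Sum.inl i))))
      rw [h1] at h2
      rw [← Finset.card_erase_add_one (hself (rt (Sum.inl i)))]
      exact h2.add_one
    · intro T hT T' hT' hne
      obtain ⟨i, rfl⟩ := (memπ T).1 hT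
      obtain ⟨i', rfl⟩ := (memπ T').1 hT'
      rw [Finset.disjoint_left]
      intro k hk hk'
      apply hne
      rw [mem_cmp] at hk hk'
      exact cmp_eq (hk.trans hk'.symm)
    · intro x
      simp only [Finset.mem_univ, true_iff]
      exact ⟨cmp F x, (memπ _).2 ⟨x, rfl⟩, hself x⟩
    · exact hod
    · intro D hD
      obtain ⟨j, rfl⟩ := (memC D).1 hD
      exact ⟨cmp F (rt (Sum.inr j)), (memπ _).2 ⟨_, rfl⟩, rt (Sum.inr j), hself _,
        hrtmax _, hrooted _ (by simp)⟩
    · intro T hT ρ hρ hm hcard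
      obtain ⟨i, rfl⟩ := (memπ T).1 hT
      obtain ⟨h1, h2⟩ := hmaxrt i ρ hρ hm
      rw [h1] at hcard ⊢
      rw [← h.dd_top h2]
      rcases hpρ : p (Sum.inl ρ) with k | j
      · exfalso
        have h3 := h.dd_top h2
        rw [hpρ, h.dd_leaf] at h3
        have h4 := congrArg Finset.card h3
        rw [Finset.card_erase_of_mem (hself ρ), Finset.card_singleton] at h4
        omega
      · exact (memC _).2 ⟨j, rfl⟩
  · have hone : ∀ x y : Fin m ⊕ Fin F.n, F.G.Adj x y → (x ≠ Sum.inl (rt x) ∧ y = p x) →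
        Rl (π, C) (dd F p x) (dd F p y) := by
      rintro x y a ⟨hx, rfl⟩
      by_cases hy : p x = Sum.inl (rt (p x))
      · right; right
        have hrr : rt (p x) = rt x := (h.rt_eq a.reachable).symm
        rw [hrr] at hy
        have hx2 : x = p (Sum.inl (rt x)) := by
          obtain ⟨w, hw⟩ := leaf_nbr F (rt x)
          have a1 := a.symm
          rw [hy] at a1
          exact ((hw x).1 a1).trans ((hw _).1 (h.adj _)).symm
        have htop := h.dd_top (h.rt_rt x)
        rw [← hx2] at htop
        rw [hy, h.dd_leaf, htop]
        constructor
        · simp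
        · rw [Finset.union_singleton, Finset.insert_erase (hself _)]
          exact (memπ _).2 ⟨_, rfl⟩
      · left
        have hxp : x ≠ p (p x) := by
          intro e
          have hs1 := h.sd x hx
          have hs2 := h.sd (p x) hy
          rw [← e, ← h.rt_eq a.reachable] at hs2
          exact Set.disjoint_left.1 (side_disj F.acyclic a) hs1 hs2
        constructor
        · obtain ⟨j, hj⟩ := hnleaf _ _ a.symm hxp
          exact (memC _).2 ⟨j, by rw [hj]⟩
        · change _ ∈ ch C _
          rw [hch]
          simp only [Finset.mem_image, Finset.mem_filter, Finset.mem_univ, true_and]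
          exact ⟨x, ⟨a.symm, hxp⟩, rfl⟩
    have hchadj : ∀ x y, dd F p x ∈ ch C (dd F p y) → F.G.Adj y x := by
      intro x y hxy
      rw [hch] at hxy
      simp only [Finset.mem_image, Finset.mem_filter, Finset.mem_univ, true_and] at hxy
      obtain ⟨z, ⟨h1, _⟩, e⟩ := hxy
      rw [← h.dd_inj e]; exact h1
    have htopadj : ∀ x y i, Disjoint (dd F p x) (dd F p y) → dd F p x ∪ dd F p y = cmp F i →
        rt (Sum.inl i) ∈ dd F p x → F.G.Adj x y := by
      intro x y i hd hu hr
      have hreach : F.G.Reachable x (Sum.inl (rt (Sum.inl i))) := Br_reach (mem_lv.1 hr)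
      have hrx : rt x = rt (Sum.inl i) := by
        rw [h.rt_eq hreach, hrt2]
      have hx : x = Sum.inl (rt (Sum.inl i)) := by
        by_contra hne
        rw [← hrx] at hne hr
        exact h.root_not hne (mem_lv.1 hr)
      have htop := h.dd_top (hrt2 i)
      have hy : dd F p y = dd F p (p x) := by
        rw [hx, htop, ← hcmprt, ← hu, hx, h.dd_leaf, Finset.singleton_union, Finset.erase_insert]
        rw [hx, h.dd_leaf] at hd
        simpa using hd
      rw [h.dd_inj hy]
      exact h.adj x
    constructor
    · exact h.dd_leaf
    · intro x y e; exact h.dd_inj e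
    · exact memC
    · intro x y
      constructor
      · intro a
        rcases h.orient a with h1 | h1
        · exact hone x y a h1
        · exact (hone y x a.symm h1).symm
      · rintro (⟨h1, h2⟩ | ⟨h1, h2⟩ | ⟨h1, h2⟩)
        · exact (hchadj x y h2).symm
        · exact hchadj y x h2
        · obtain ⟨i, hi⟩ := (memπ _).1 h2
          have hr : rt (Sum.inl i) ∈ dd F p x ∪ dd F p y := by
            rw [← hi, mem_cmp]; exact h.reach _
          rcases Finset.mem_union.1 hr with hr | hr
          · exact htopadj x y i h1 hi.symm hr
          · exact (htopadj y x i h1.symm (by rw [hi, Finset.union_comm]) hr).symm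

theorem Rep.iso {V W : Type} {G : SimpleGraph (Fin m ⊕ V)} {G' : SimpleGraph (Fin m ⊕ W)} {X : XT m}
    {d : Fin m ⊕ V → Finset (Fin m)} {d' : Fin m ⊕ W → Finset (Fin m)}
    (h : Rep G X d) (h' : Rep G' X d') : ∃ φ : G ≃g G', ∀ i, φ (Sum.inl i) = Sum.inl i := by
  have ex : ∀ x, ∃ y, d' y = d x := fun x => h'.pl.1 (h.pl.2 ⟨x, rfl⟩)
  choose f hf using ex
  have hb : Function.Bijective f := by
    constructor
    · intro x y e
      apply h.inj
      rw [← hf, ← hf, e]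
    · intro y
      obtain ⟨x, hx⟩ := h.pl.1 (h'.pl.2 ⟨y, rfl⟩)
      exact ⟨x, h'.inj (by rw [hf, hx])⟩
  refine ⟨⟨Equiv.ofBijective f hb, ?_⟩, ?_⟩
  · intro a b
    change G'.Adj (f a) (f b) ↔ _
    rw [h'.adj, h.adj, hf, hf]
  · intro i
    apply h'.inj
    change d' (f _) = _
    rw [hf, h.leaf, h'.leaf]

end Rep
end GFM

namespace GFM

section Real
variable {m : ℕ} {X : XT m}

theorem VX.bl_eq {L : Finset (Fin m)} (hX : VX L X) {T T' : Finset (Fin m)} (hT : T ∈ X.1)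
    (hT' : T' ∈ X.1) {x : Fin m} (h : x ∈ T) (h' : x ∈ T') : T = T' := by
  by_contra hne
  exact Finset.disjoint_left.1 (hX.disj T hT T' hT' hne) h h'

theorem VX.blk (hX : VX Finset.univ X) {A : Finset (Fin m)} (hA : Pl X.2 A) :
    ∃ T ∈ X.1, A ⊆ T := by
  rcases hA with hA | hA
  · obtain ⟨T, hT, ρ, -, -, hs⟩ := hX.sub A hA
    exact ⟨T, hT, hs.trans (Finset.erase_subset _ _)⟩
  · obtain ⟨i, rfl⟩ := Finset.card_eq_one.1 hA
    obtain ⟨T, hT, hi⟩ := (hX.cov i).1 (Finset.mem_univ _)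
    exact ⟨T, hT, by simpa using hi⟩

/-- the parent or the opposite side of the root edge -/
def Up (X : XT m) (A B : Finset (Fin m)) : Prop :=
  (B ∈ X.2 ∧ A ∈ ch X.2 B) ∨ (Disjoint A B ∧ A ∪ B ∈ X.1)

theorem VX.noparent (hX : VX Finset.univ X) {A B D : Finset (Fin m)} (hA : Pl X.2 A)
    (hB : Pl X.2 B) (hd : Disjoint A B) (hT : A ∪ B ∈ X.1) (hD : D ∈ X.2) (hAD : A ⊂ D) : False := by
  obtain ⟨T', hT', ρ, hρ, -, hs⟩ := hX.sub D hD
  obtain ⟨a, ha⟩ := hX.od.plNe hA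
  have hTT : A ∪ B = T' := hX.bl_eq hT hT' (Finset.mem_union_left _ ha)
    (Finset.mem_of_mem_erase (hs (hAD.1 ha)))
  rcases hX.od.plLam (Or.inl hD) hB with h | h | h
  · exact Finset.disjoint_left.1 hd ha (h (hAD.1 ha))
  · have : ρ ∈ D := by
      rw [← hTT] at hρ
      exact Finset.union_subset hAD.1 h hρ
    exact Finset.notMem_erase ρ T' (hs this)
  · apply hAD.2
    intro x hx
    have : x ∈ A ∪ B := by
      rw [hTT]; exact Finset.mem_of_mem_erase (hs hx)
    rcases Finset.mem_union.1 this with h1 | h1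
    · exact h1
    · exact absurd h1 (Finset.disjoint_left.1 h hx)

theorem VX.rootmax (hX : VX Finset.univ X) {D T : Finset (Fin m)} (hD : D ∈ X.2) (hT : T ∈ X.1)
    {ρ : Fin m} (hρ : ρ ∈ T) (hm : ∀ c ∈ T, c ≤ ρ) : ρ ∉ D := by
  intro hc
  obtain ⟨T', hT', ρ', hρ', hm', hs⟩ := hX.sub D hD
  have hTT : T = T' := hX.bl_eq hT hT' hρ (Finset.mem_of_mem_erase (hs hc))
  subst hTT
  have : ρ = ρ' := le_antisymm (hm' ρ hρ) (hm ρ' hρ')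
  subst this
  exact Finset.notMem_erase ρ T (hs hc)

theorem VX.exmax {L : Finset (Fin m)} (hX : VX L X) {T : Finset (Fin m)} (hT : T ∈ X.1) :
    ∃ ρ ∈ T, ∀ c ∈ T, c ≤ ρ := ⟨T.max' (hX.ne T hT), T.max'_mem _, fun c hc => T.le_max' c hc⟩

theorem VX.plTop {L : Finset (Fin m)} (hX : VX L X) {T : Finset (Fin m)} (hT : T ∈ X.1)
    {ρ : Fin m} (hρ : ρ ∈ T) (hm : ∀ c ∈ T, c ≤ ρ) : Pl X.2 (T.erase ρ) := by
  by_cases h4 : 4 ≤ T.card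
  · exact Or.inl (hX.top T hT ρ hρ hm h4)
  · right
    rw [Finset.card_erase_of_mem hρ]
    have h1 := (hX.ne T hT).card_pos
    obtain ⟨k, hk⟩ := hX.even T hT
    omega

theorem VX.up_ex (hX : VX Finset.univ X) {A : Finset (Fin m)} (hA : Pl X.2 A) :
    ∃ B, Pl X.2 B ∧ Up X A B := by
  by_cases hp : ∃ D ∈ X.2, A ⊂ D
  · obtain ⟨D, hD, hAD⟩ := hp
    obtain ⟨D', hD', h1, -⟩ := hX.od.up_exists hA hD hAD
    exact ⟨D', Or.inl hD', Or.inl ⟨hD', h1⟩⟩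
  · obtain ⟨T, hT, hAT⟩ := hX.blk hA
    obtain ⟨ρ, hρ, hm⟩ := hX.exmax hT
    have hpl := hX.plTop hT hρ hm
    by_cases hρA : ρ ∈ A
    · have hA1 : A = {ρ} := by
        rcases hA with hA | hA
        · exact absurd hρA (hX.rootmax hA hT hρ hm)
        · obtain ⟨i, rfl⟩ := Finset.card_eq_one.1 hA
          rw [Finset.mem_singleton.1 hρA]
      subst hA1
      refine ⟨T.erase ρ, hpl, Or.inr ⟨by simp, ?_⟩⟩
      rw [Finset.singleton_union, Finset.insert_erase hρ]
      exact hT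
    · have hs : A ⊆ T.erase ρ := Finset.subset_erase.2 ⟨hAT, hρA⟩
      have he : A = T.erase ρ := by
        by_contra hne
        have hss : A ⊂ T.erase ρ := Finset.ssubset_iff_subset_ne.2 ⟨hs, hne⟩
        rcases hpl with h1 | h1
        · exact hp ⟨_, h1, hss⟩
        · have := Finset.card_lt_card hss
          have := (hX.od.plNe hA).card_pos
          omega
      subst he
      refine ⟨{ρ}, pl_single _ _, Or.inr ⟨by simp, ?_⟩⟩
      rw [Finset.union_singleton, Finset.insert_erase hρ]
      exact hT

theorem VX.up_uniq (hX : VX Finset.univ X) {A B B' : Finset (Fin m)} (hA : Pl X.2 A)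
    (hB : Pl X.2 B) (hB' : Pl X.2 B') (h : Up X A B) (h' : Up X A B') : B = B' := by
  rcases h with ⟨h1, h2⟩ | ⟨h1, h2⟩ <;> rcases h' with ⟨h1', h2'⟩ | ⟨h1', h2'⟩
  · exact hX.od.up_unique h1 h1' h2 h2'
  · exact (hX.noparent hA hB' h1' h2' h1 (mem_ch.1 h2).2.1).elim
  · exact (hX.noparent hA hB h1 h2 h1' (mem_ch.1 h2').2.1).elim
  · obtain ⟨a, ha⟩ := hX.od.plNe hA
    have e := hX.bl_eq h2 h2' (Finset.mem_union_left _ ha) (Finset.mem_union_left _ ha)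
    ext x
    have ex := Finset.ext_iff.1 e x
    rw [Finset.mem_union, Finset.mem_union] at ex
    constructor
    · intro hx
      exact (ex.1 (Or.inr hx)).resolve_left (fun hc => Finset.disjoint_left.1 h1 hc hx)
    · intro hx
      exact (ex.2 (Or.inr hx)).resolve_left (fun hc => Finset.disjoint_left.1 h1' hc hx)

theorem rl_up {A B : Finset (Fin m)} : Rl X A B ↔ Up X A B ∨ (A ∈ X.2 ∧ B ∈ ch X.2 A) := by
  unfold Rl Up; tauto

theorem rl_or {A B : Finset (Fin m)} (h : Rl X A B) : Up X A B ∨ Up X B A := by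
  rcases rl_up.1 h with h | h
  · exact Or.inl h
  · exact Or.inr (Or.inl h)

section R
variable {V : Type} {G : SimpleGraph (Fin m ⊕ V)} {d : Fin m ⊕ V → Finset (Fin m)}

theorem Rep.nbrs (h : Rep G X d) (hX : VX Finset.univ X) (x) :
    ∃ U, Up X (d x) U ∧ d '' G.neighborSet x = if d x ∈ X.2 then insert U (ch X.2 (d x) : Set _) else {U} := by
  have hx : Pl X.2 (d x) := h.pl.2 ⟨x, rfl⟩
  obtain ⟨U, hU, hup⟩ := hX.up_ex hx
  refine ⟨U, hup, ?_⟩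
  ext B
  have key : B ∈ d '' G.neighborSet x ↔ B = U ∨ (d x ∈ X.2 ∧ B ∈ ch X.2 (d x)) := by
    constructor
    · rintro ⟨y, hy, rfl⟩
      have := (h.adj x y).1 hy
      rcases rl_up.1 this with h1 | h1
      · exact Or.inl (hX.up_uniq hx (h.pl.2 ⟨y, rfl⟩) hU h1 hup)
      · exact Or.inr h1
    · intro hB
      have hpl : Pl X.2 B ∧ Rl X (d x) B := by
        rcases hB with rfl | hB
        · exact ⟨hU, rl_up.2 (Or.inl hup)⟩
        · exact ⟨(mem_ch.1 hB.2).1, rl_up.2 (Or.inr hB)⟩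
      obtain ⟨y, rfl⟩ := h.pl.1 hpl.1
      exact ⟨y, (h.adj x y).2 hpl.2, rfl⟩
  rw [key]
  split_ifs with hc
  · simp [hc]
  · simp [hc]

theorem Rep.deg_leaf (h : Rep G X d) (hX : VX Finset.univ X) (i : Fin m) :
    (G.neighborSet (Sum.inl i)).ncard = 1 := by
  obtain ⟨U, -, hU⟩ := h.nbrs hX (Sum.inl i)
  rw [if_neg] at hU
  · rw [← Set.ncard_image_of_injective _ h.inj, hU, Set.ncard_singleton]
  · rw [h.leaf]
    intro hc
    have := hX.od.three _ hc
    simp at this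

theorem Rep.deg_int (h : Rep G X d) (hX : VX Finset.univ X) (v : V) :
    (G.neighborSet (Sum.inr v)).ncard = (ch X.2 (d (Sum.inr v))).card + 1 := by
  obtain ⟨U, hup, hU⟩ := h.nbrs hX (Sum.inr v)
  have hD : d (Sum.inr v) ∈ X.2 := (h.rng _).2 ⟨v, rfl⟩
  rw [if_pos hD] at hU
  rw [← Set.ncard_image_of_injective _ h.inj, hU, Set.ncard_insert_of_notMem, Set.ncard_coe_finset]
  intro hc
  rw [Finset.mem_coe, mem_ch] at hc
  rcases hup with ⟨h1, h2⟩ | ⟨h1, h2⟩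
  · exact (hc.2.1.trans (mem_ch.1 h2).2.1).false
  · obtain ⟨u, hu⟩ := hX.od.plNe hc.1
    exact Finset.disjoint_left.1 h1 (hc.2.1.1 hu) hu

theorem Rep.hat (h : Rep G X d) (hX : VX Finset.univ X) {x z z'}
    (c : Cross G {z | d z ⊆ d x} z z') : z = x ∧ Up X (d x) (d z') := by
  obtain ⟨a, hz, hz'⟩ := c
  have hz : d z ⊆ d x := hz
  have hz' : ¬ d z' ⊆ d x := hz'
  have px : Pl X.2 (d x) := h.pl.2 ⟨x, rfl⟩
  have pz : Pl X.2 (d z) := h.pl.2 ⟨z, rfl⟩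
  have pz' : Pl X.2 (d z') := h.pl.2 ⟨z', rfl⟩
  obtain ⟨u, hu⟩ := hX.od.plNe pz
  have key : d z = d x ∧ Up X (d z) (d z') := by
    rcases rl_up.1 ((h.adj z z').1 a) with hup | ⟨h1, h2⟩
    · refine ⟨?_, hup⟩
      rcases hup with ⟨h1, h2⟩ | ⟨h1, h2⟩
      · rcases hX.od.plLam px pz' with h3 | h3 | h3
        · have hss : d x ⊂ d z' := ⟨h3, hz'⟩
          exact ((mem_ch.1 h2).2.2 _ px hz hss).symm
        · exact absurd h3 hz'
        · exact absurd ((mem_ch.1 h2).2.1.1 hu) (Finset.disjoint_left.1 h3 (hz hu))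
      · obtain ⟨T, hT, hxT⟩ := hX.blk px
        have hTT := hX.bl_eq h2 hT (Finset.mem_union_left _ hu) (hxT (hz hu))
        rcases hX.od.plLam px pz' with h3 | h3 | h3
        · exact absurd (h3 (hz hu)) (Finset.disjoint_left.1 h1 hu)
        · exact absurd h3 hz'
        · apply Finset.Subset.antisymm hz
          intro y hy
          have := hxT hy
          rw [← hTT, Finset.mem_union] at this
          exact this.resolve_right (Finset.disjoint_left.1 h3 hy)
    · exact absurd ((mem_ch.1 h2).2.1.1.trans hz) hz'
  rw [← key.1]
  exact ⟨h.inj key.1, key.2⟩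

theorem Rep.hat' (h : Rep G X d) (hX : VX Finset.univ X) {x y z z'} (hup : Up X (d x) (d y))
    (c : Cross G {z | d z ⊆ d x} z z') : z = x ∧ z' = y := by
  obtain ⟨h1, h2⟩ := h.hat hX c
  exact ⟨h1, h.inj (hX.up_uniq (h.pl.2 ⟨x, rfl⟩) (h.pl.2 ⟨z', rfl⟩) (h.pl.2 ⟨y, rfl⟩) h2 hup)⟩

theorem Rep.up_not (h : Rep G X d) (hX : VX Finset.univ X) {x y} (hup : Up X (d x) (d y)) :
    ¬ d y ⊆ d x := by
  intro hc
  rcases hup with ⟨h1, h2⟩ | ⟨h1, h2⟩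
  · exact (mem_ch.1 h2).2.1.2 hc
  · obtain ⟨u, hu⟩ := hX.od.plNe (h.pl.2 ⟨y, rfl⟩)
    exact Finset.disjoint_left.1 h1 (hc hu) hu

theorem Rep.acyclic (h : Rep G X d) (hX : VX Finset.univ X) : G.IsAcyclic := by
  apply acyclic_of_cuts
  intro x y a
  rcases rl_or ((h.adj x y).1 a) with hup | hup
  · exact ⟨{z | d z ⊆ d x}, Finset.Subset.refl _, h.up_not hX hup, fun u v c => h.hat' hX hup c⟩
  · refine ⟨{z | d z ⊆ d y}ᶜ, h.up_not hX hup, fun hc => hc (Finset.Subset.refl _), ?_⟩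
    intro u v c
    exact (h.hat' hX hup ⟨c.1.symm, not_not.1 c.2.2, c.2.1⟩).symm

end R

theorem exists_real (hX : VX Finset.univ X) : ∃ (F : GoodForest m) (d : _), Rep F.G X d := by
  let d0 : Fin m ⊕ {A // A ∈ X.2} → Finset (Fin m) := Sum.elim (fun i => {i}) (fun A => A.1)
  have hpl : ∀ x, Pl X.2 (d0 x) := by
    rintro (i | A)
    · exact pl_single _ _
    · exact Or.inl A.2
  let K : SimpleGraph (Fin m ⊕ {A // A ∈ X.2}) :=
    { Adj := fun x y => Rl X (d0 x) (d0 y)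
      symm := ⟨fun x y h => h.symm⟩
      loopless := ⟨by
        rintro x (⟨_, h⟩ | ⟨_, h⟩ | ⟨h, _⟩)
        · exact (mem_ch.1 h).2.1.false
        · exact (mem_ch.1 h).2.1.false
        · obtain ⟨u, hu⟩ := hX.od.plNe (hpl x)
          exact Finset.disjoint_left.1 h hu hu⟩ }
  have hK : Rep K X d0 := by
    constructor
    · intro i; rfl
    · rintro (i | A) (i' | B) e
      · exact congrArg Sum.inl (Finset.singleton_injective e)
      · exfalso
        have := hX.od.three _ B.2
        have e : {i} = B.1 := e
        rw [← e] at this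
        simp at this
      · exfalso
        have := hX.od.three _ A.2
        have e : A.1 = {i'} := e
        rw [e] at this
        simp at this
      · exact congrArg Sum.inr (Subtype.ext e)
    · intro A
      constructor
      · intro hA; exact ⟨⟨A, hA⟩, rfl⟩
      · rintro ⟨v, rfl⟩; exact v.2
    · intro x y; exact Iff.rfl
  obtain ⟨F, φ, hφ⟩ := exists_gf K (hK.acyclic hX) (hK.deg_leaf hX)
    (fun j => by
      rw [hK.deg_int hX]
      exact (hX.od.ch_card ((hK.rng _).2 ⟨j, rfl⟩)).1.add_one)
    (fun j => by
      rw [hK.deg_int hX]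
      have := (hX.od.ch_card ((hK.rng _).2 ⟨j, rfl⟩)).2
      omega)
  refine ⟨F, fun x => d0 (φ x), ?_, ?_, ?_, ?_⟩
  · intro i
    rw [hφ]; rfl
  · intro x y e
    exact φ.injective (hK.inj e)
  · intro A
    constructor
    · intro hA
      rcases hv : φ.symm (Sum.inr ⟨A, hA⟩) with i | v
      · exfalso
        have := congrArg φ hv
        rw [hφ] at this
        simp at this
      · refine ⟨v, ?_⟩
        rw [← hv]
        simp [d0]
    · rintro ⟨v, rfl⟩
      rcases hv : φ (Sum.inr v) with i | B
      · exfalso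
        rw [← hφ i] at hv
        cases φ.injective hv
      · exact B.2
  · intro x y
    rw [← φ.map_adj_iff]

theorem Rep.wt {F : GoodForest m} {d} (h : Rep F.G X d) (hX : VX Finset.univ X) :
    wt X.2 = ∏ j : Fin F.n, -((F.deg j - 2).factorial : ℤ) := by
  have hi : X.2 = Finset.univ.image (fun j : Fin F.n => d (Sum.inr j)) := by
    ext A
    rw [h.rng]
    simp
  have h1 : ∀ j : Fin F.n, F.deg j - 2 = (ch X.2 (d (Sum.inr j))).card - 1 := by
    intro j
    rw [GoodForest.deg, h.deg_int hX]
    omega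
  simp only [h1]
  rw [GFM.wt]
  conv_lhs => arg 1; rw [hi]
  rw [Finset.prod_image]
  intro x _ y _ e
  exact Sum.inr_injective (h.inj e)

end Real
end GFM

namespace GFM

theorem flip_iff {W : Type} {G : SimpleGraph W} {S : Set W} {a b x y : W} (hab : Cross G S a b)
    (hu : ∀ x y, Cross G S x y → x = a ∧ y = b) (hxy : G.Adj x y) :
    (x ∈ S ↔ y ∉ S) ↔ (x = a ∧ y = b) ∨ (x = b ∧ y = a) := by
  constructor
  · intro h
    by_cases hx : x ∈ S
    · exact Or.inl (hu x y ⟨hxy, hx, h.1 hx⟩)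
    · have hy : y ∈ S := by
        by_contra hc; exact hx (h.2 hc)
      exact Or.inr (hu y x ⟨hxy.symm, hy, hx⟩).symm
  · rintro (⟨rfl, rfl⟩ | ⟨rfl, rfl⟩)
    · exact ⟨fun _ => hab.2.2, fun _ => hab.2.1⟩
    · exact ⟨fun h => absurd h hab.2.2, fun h => absurd hab.2.1 h⟩

section Uniq
variable {m : ℕ} {X : XT m} {V : Type} {G : SimpleGraph (Fin m ⊕ V)}
  {d : Fin m ⊕ V → Finset (Fin m)}

theorem Rep.clo_leaf (h : Rep G X d) {S : Set (Fin m ⊕ V)} (hS : Clo G S) :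
    ∀ n z, (d z).card = n → ∀ i ∈ d z, (Sum.inl i ∈ S ↔ z ∈ S) := by
  intro n
  induction n using Nat.strong_induction_on with
  | _ n ih =>
    intro z hz i hi
    rcases z with c | v
    · rw [h.leaf, Finset.mem_singleton] at hi
      rw [hi]
    · by_cases h1 : 2 ≤ (d (Sum.inr v)).card
      · obtain ⟨E, hE, hiE⟩ := ch_cover (C := X.2) h1 hi
        obtain ⟨y, rfl⟩ := h.pl.1 (mem_ch.1 hE).1
        have hlt := Finset.card_lt_card (mem_ch.1 hE).2.1
        rw [ih _ (by omega) y rfl i hiE]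
        exact hS.mem_iff ((h.adj _ _).2 (Or.inl ⟨(h.rng _).2 ⟨v, rfl⟩, hE⟩))
      · have h2 : d (Sum.inr v) = d (Sum.inl i) := by
          rw [h.leaf]
          symm
          apply Finset.eq_of_subset_of_card_le (by simpa using hi)
          simp; omega
        rw [h.inj h2]

theorem Rep.clo_blk (h : Rep G X d) (hX : VX Finset.univ X) {S : Set (Fin m ⊕ V)} (hS : Clo G S)
    {T : Finset (Fin m)} (hT : T ∈ X.1) :
    (∀ i ∈ T, Sum.inl i ∈ S) ∨ (∀ i ∈ T, Sum.inl i ∉ S) := by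
  obtain ⟨ρ, hρ, hm⟩ := hX.exmax hT
  obtain ⟨z, hz⟩ := h.pl.1 (hX.plTop hT hρ hm)
  have ha : G.Adj z (Sum.inl ρ) := by
    rw [h.adj, hz, h.leaf]
    refine Or.inr (Or.inr ⟨by simp, ?_⟩)
    rw [Finset.union_singleton, Finset.insert_erase hρ]
    exact hT
  have key : ∀ i ∈ T, (Sum.inl i ∈ S ↔ z ∈ S) := by
    intro i hi
    by_cases e : i = ρ
    · rw [e]; exact (hS.mem_iff ha).symm
    · exact h.clo_leaf hS _ z rfl i (by rw [hz]; exact Finset.mem_erase.2 ⟨e, hi⟩)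
  by_cases hzS : z ∈ S
  · exact Or.inl fun i hi => (key i hi).2 hzS
  · exact Or.inr fun i hi hc => hzS ((key i hi).1 hc)

theorem Rep.sub_leaf (h : Rep G X d) {i : Fin m} {A : Finset (Fin m)} :
    d (Sum.inl i) ⊆ A ↔ i ∈ A := by
  rw [h.leaf, Finset.singleton_subset_iff]

theorem Rep.lc_in (h : Rep G X d) (hX : VX Finset.univ X) {C : Finset (Fin m)}
    (hC : LC G (C : Set (Fin m))) : ∃ A, (A = ∅ ∨ Pl X.2 A) ∧
      ∀ T ∈ X.1, (∀ i ∈ T, (i ∈ C ↔ i ∈ A)) ∨ (∀ i ∈ T, (i ∈ C ↔ i ∉ A)) := by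
  obtain ⟨S, hS, hSC⟩ := hC
  by_cases hc : ∃ a b, Cross G S a b
  · obtain ⟨a, b, hab⟩ := hc
    have hu : ∀ x y, Cross G S x y → x = a ∧ y = b := fun x y c => hS x y a b c hab
    have main : ∃ e, ∀ x y, G.Adj x y → ((d x ⊆ d e ↔ ¬ d y ⊆ d e) ↔ (x ∈ S ↔ y ∉ S)) := by
      rcases rl_or ((h.adj a b).1 hab.1) with hup | hup
      · refine ⟨a, fun x y hxy => ?_⟩
        rw [flip_iff hab hu hxy]
        exact flip_iff (S := {z | d z ⊆ d a}) ⟨hab.1, Finset.Subset.refl _, h.up_not hX hup⟩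
          (fun x y c => h.hat' hX hup c) hxy
      · refine ⟨b, fun x y hxy => ?_⟩
        rw [flip_iff hab hu hxy, or_comm]
        exact flip_iff (S := {z | d z ⊆ d b}) ⟨hab.1.symm, Finset.Subset.refl _, h.up_not hX hup⟩
          (fun x y c => h.hat' hX hup c) hxy
    obtain ⟨e, he⟩ := main
    refine ⟨d e, Or.inr (h.pl.2 ⟨e, rfl⟩), fun T hT => ?_⟩
    have hclo : Clo G {z | z ∈ S ↔ d z ⊆ d e} := by
      intro x y hxy hx
      have hx : x ∈ S ↔ d x ⊆ d e := hx
      have := he x y hxy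
      show y ∈ S ↔ d y ⊆ d e
      tauto
    rcases h.clo_blk hX hclo hT with h1 | h1
    · left
      intro i hi
      have : Sum.inl i ∈ S ↔ d (Sum.inl i) ⊆ d e := h1 i hi
      rwa [hSC, h.sub_leaf] at this
    · right
      intro i hi
      have : ¬ (Sum.inl i ∈ S ↔ d (Sum.inl i) ⊆ d e) := h1 i hi
      rw [hSC, h.sub_leaf, Finset.mem_coe] at this
      tauto
  · refine ⟨∅, Or.inl rfl, fun T hT => ?_⟩
    have hclo : Clo G S := by
      intro x y a hx
      by_contra hy
      exact hc ⟨x, y, a, hx, hy⟩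
    rcases h.clo_blk hX hclo hT with h1 | h1
    · right
      intro i hi
      have := (hSC i).1 (h1 i hi)
      simpa using this
    · left
      intro i hi
      have := h1 i hi
      rw [hSC] at this
      simpa using this

theorem VX.parity (hX : VX Finset.univ X) {C A : Finset (Fin m)}
    (hA : ∀ T ∈ X.1, (∀ i ∈ T, (i ∈ C ↔ i ∈ A)) ∨ (∀ i ∈ T, (i ∈ C ↔ i ∉ A))) :
    Even (C.card + A.card) := by
  have hU : (C \ A) ∪ (A \ C) = (X.1.filter (fun T => ∀ i ∈ T, (i ∈ C ↔ i ∉ A))).biUnion id := by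
    ext i
    simp only [Finset.mem_union, Finset.mem_sdiff, Finset.mem_biUnion, Finset.mem_filter, id]
    obtain ⟨T, hT, hi⟩ := (hX.cov i).1 (Finset.mem_univ _)
    constructor
    · intro h
      refine ⟨T, ⟨hT, ?_⟩, hi⟩
      rcases hA T hT with h1 | h1
      · have := h1 i hi
        exfalso; tauto
      · exact h1
    · rintro ⟨T', ⟨-, h1⟩, hi'⟩
      have := h1 i hi'
      tauto
  have hE : Even ((C \ A) ∪ (A \ C)).card := by
    rw [hU, Finset.card_biUnion]
    · apply Finset.even_sum
      intro T hT
      exact hX.even T (Finset.mem_filter.1 hT).1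
    · intro T hT T' hT' hne
      exact hX.disj T (Finset.mem_filter.1 hT).1 T' (Finset.mem_filter.1 hT').1 hne
  rw [Finset.card_union_of_disjoint disjoint_sdiff_sdiff] at hE
  have h1 := Finset.card_sdiff_add_card_inter C A
  have h2 := Finset.card_sdiff_add_card_inter A C
  rw [Finset.inter_comm] at h2
  obtain ⟨k, hk⟩ := hE
  exact ⟨k + (C ∩ A).card, by omega⟩

theorem Rep.lc_C (h : Rep G X d) (hX : VX Finset.univ X) {A : Finset (Fin m)} (hA : A ∈ X.2) :
    LC G (A : Set (Fin m)) := by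
  obtain ⟨v, rfl⟩ := (h.rng A).1 hA
  refine ⟨{z | d z ⊆ d (Sum.inr v)}, ?_, ?_⟩
  · intro x y x' y' c c'
    obtain ⟨h1, h2⟩ := h.hat hX c
    obtain ⟨h1', h2'⟩ := h.hat' hX h2 c'
    exact ⟨h1.trans h1'.symm, h2'.symm⟩
  · intro i
    rw [Set.mem_setOf, h.sub_leaf, Finset.mem_coe]

theorem Rep.lc_T (h : Rep G X d) (hX : VX Finset.univ X) {T : Finset (Fin m)} (hT : T ∈ X.1) :
    LC G (T : Set (Fin m)) := by
  refine ⟨{z | d z ⊆ T}, ?_, ?_⟩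
  · apply Clo.cut1
    intro x y hxy (hx : d x ⊆ T)
    show d y ⊆ T
    obtain ⟨u, hu⟩ := hX.od.plNe (h.pl.2 ⟨x, rfl⟩)
    rcases (h.adj x y).1 hxy with ⟨h1, h2⟩ | ⟨h1, h2⟩ | ⟨h1, h2⟩
    · obtain ⟨T', hT', hs⟩ := hX.blk (Or.inl h1)
      rwa [hX.bl_eq hT hT' (hx hu) (hs ((mem_ch.1 h2).2.1.1 hu))]
    · exact (mem_ch.1 h2).2.1.1.trans hx
    · rw [← hX.bl_eq h2 hT (Finset.mem_union_left _ hu) (hx hu)]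
      exact Finset.subset_union_right
  · intro i
    rw [Set.mem_setOf, h.sub_leaf, Finset.mem_coe]

end Uniq

section Uniq2
variable {m : ℕ} {X X' : XT m} {V V' : Type} {G : SimpleGraph (Fin m ⊕ V)}
  {G' : SimpleGraph (Fin m ⊕ V')}
  {d : Fin m ⊕ V → Finset (Fin m)} {d' : Fin m ⊕ V' → Finset (Fin m)}

theorem Rep.refine_blk (h : Rep G X d) (hX : VX Finset.univ X) (h' : Rep G' X' d')
    (hX' : VX Finset.univ X') (hLC : ∀ C, LC G C → LC G' C) {T : Finset (Fin m)} (hT : T ∈ X.1)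
    {T' : Finset (Fin m)} (hT' : T' ∈ X'.1) {i : Fin m} (hi : i ∈ T) (hi' : i ∈ T') : T' ⊆ T := by
  obtain ⟨A, hA, hb⟩ := h'.lc_in hX' (hLC _ (h.lc_T hX hT))
  have hp := hX'.parity hb
  have hA0 : A = ∅ := by
    refine hA.resolve_right (fun hc => ?_)
    have h1 := hX'.od.plOdd hc
    have h2 := hX.even T hT
    rw [Nat.even_add] at hp
    exact (Nat.not_even_iff_odd.2 h1) (hp.1 h2)
  subst hA0
  rcases hb T' hT' with h1 | h1
  · simpa using (h1 i hi').1 hi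
  · intro c hc
    exact (h1 c hc).2 (by simp)

theorem Rep.blocks_sub (h : Rep G X d) (hX : VX Finset.univ X) (h' : Rep G' X' d')
    (hX' : VX Finset.univ X') (hLC : ∀ C, LC G C ↔ LC G' C) : X.1 ⊆ X'.1 := by
  intro T hT
  obtain ⟨i, hi⟩ := hX.ne T hT
  obtain ⟨T', hT', hi'⟩ := (hX'.cov i).1 (Finset.mem_univ _)
  have : T = T' := Finset.Subset.antisymm
    (h'.refine_blk hX' h hX (fun C => (hLC C).2) hT' hT hi' hi)
    (h.refine_blk hX h' hX' (fun C => (hLC C).1) hT hT' hi hi')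
  rwa [this]

theorem Rep.fam_sub (h : Rep G X d) (hX : VX Finset.univ X) (h' : Rep G' X' d')
    (hX' : VX Finset.univ X') (hLC : ∀ C, LC G C ↔ LC G' C) : X.2 ⊆ X'.2 := by
  intro A0 hA0
  obtain ⟨A, hA, hb⟩ := h'.lc_in hX' ((hLC _).1 (h.lc_C hX hA0))
  have hp := hX'.parity hb
  have hodd := hX.od.odd _ hA0
  have h3 := hX.od.three _ hA0
  have hA : Pl X'.2 A := by
    refine hA.resolve_left (fun hc => ?_)
    rw [hc, Finset.card_empty, add_zero] at hp
    exact (Nat.not_even_iff_odd.2 hodd) hp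
  obtain ⟨T, hT, ρ, hρ, hm, hs⟩ := hX.sub A0 hA0
  have hT' := h.blocks_sub hX h' hX' hLC hT
  obtain ⟨u, hu⟩ := hX.od.plNe (Or.inl hA0)
  obtain ⟨T1, hT1, hAT1⟩ := hX'.blk hA
  obtain ⟨w, hw⟩ := hX'.od.plNe hA
  have hTe : Disjoint T T1 → False := by
    intro hd
    rcases hb T hT' with h1 | h1
    · exact Finset.disjoint_left.1 hd (Finset.mem_of_mem_erase (hs hu)) (hAT1 ((h1 u (Finset.mem_of_mem_erase (hs hu))).1 hu))
    · have : ρ ∈ A0 := (h1 ρ hρ).2 (fun hc => Finset.disjoint_left.1 hd hρ (hAT1 hc))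
      exact Finset.notMem_erase ρ T (hs this)
  have hTT : T1 = T := by
    by_contra hne
    exact hTe (hX'.disj T hT' T1 hT1 (Ne.symm hne))
  subst hTT
  rcases hb T1 hT' with h1 | h1
  · have : A0 = A := by
      ext i
      constructor
      · intro hi; exact (h1 i (Finset.mem_of_mem_erase (hs hi))).1 hi
      · intro hi; exact (h1 i (hAT1 hi)).2 hi
    subst this
    rcases hA with hA | hA
    · exact hA
    · omega
  · have hρA : ρ ∈ A := by
      by_contra hc
      exact Finset.notMem_erase ρ T1 (hs ((h1 ρ hρ).2 hc))
    have hA1 : A = {ρ} := by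
      rcases hA with hA | hA
      · exact absurd hρA (hX'.rootmax hA hT' hρ hm)
      · obtain ⟨i, rfl⟩ := Finset.card_eq_one.1 hA
        rw [Finset.mem_singleton.1 hρA]
    have he : A0 = T1.erase ρ := by
      apply Finset.Subset.antisymm hs
      intro i hi
      obtain ⟨h4, h5⟩ := Finset.mem_erase.1 hi
      exact (h1 i h5).2 (by rw [hA1]; simpa using h4)
    rw [he]
    apply hX'.top T1 hT' ρ hρ hm
    rw [he, Finset.card_erase_of_mem hρ] at h3
    omega

theorem Rep.uniq (h : Rep G X d) (hX : VX Finset.univ X) (h' : Rep G' X' d')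
    (hX' : VX Finset.univ X') (hLC : ∀ C, LC G C ↔ LC G' C) : X = X' := by
  have hLC' := fun C => (hLC C).symm
  exact Prod.ext (Finset.Subset.antisymm (h.blocks_sub hX h' hX' hLC) (h'.blocks_sub hX' h hX hLC'))
    (Finset.Subset.antisymm (h.fam_sub hX h' hX' hLC) (h'.fam_sub hX' h hX hLC'))

end Uniq2
end GFM

namespace GFM
open GoodForest

/-- transporting a good forest along a permutation of the labels -/
theorem exists_renamed {k : ℕ} (H : GoodForest k) (σ : Fin k ≃ Fin k) :
    ∃ (H' : GoodForest k) (φ : H.G ≃g H'.G), ∀ c, φ (Sum.inl c) = Sum.inl (σ c) := by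
  let e : Fin k ⊕ Fin H.n ≃ Fin k ⊕ Fin H.n := Equiv.sumCongr σ (Equiv.refl _)
  let K : SimpleGraph (Fin k ⊕ Fin H.n) := H.G.comap e.symm
  let ψ : H.G ≃g K := ⟨e, by intro a b; simp [K]⟩
  have hψl : ∀ c, ψ (Sum.inl c) = Sum.inl (σ c) := fun c => rfl
  have hψr : ∀ c, ψ (Sum.inr c) = Sum.inr c := fun c => rfl
  refine ⟨⟨H.n, K, iso_acyclic ψ H.acyclic, ?_, ?_, ?_⟩, ψ, hψl⟩
  · intro i
    have := iso_ncard ψ (Sum.inl (σ.symm i))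
    rw [hψl, Equiv.apply_symm_apply] at this
    rw [this]; exact H.leaf_degree _
  · intro j
    rw [← hψr, iso_ncard]; exact H.internal_degree_even j
  · intro j
    rw [← hψr, iso_ncard]; exact H.internal_degree_ge j

theorem mobius_eq {m : ℕ} (F : GoodForest m) :
    mobiusValue F = -∏ j : Fin F.n, -((F.deg j - 2).factorial : ℤ) := by
  rw [mobiusValue, Finset.prod_neg]
  simp only [Finset.card_univ, Fintype.card_fin]
  ring

theorem iso_inr {m : ℕ} {V W : Type} {G : SimpleGraph (Fin m ⊕ V)} {G' : SimpleGraph (Fin m ⊕ W)}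
    (φ : G ≃g G') (hφ : ∀ i, φ (Sum.inl i) = Sum.inl i) :
    ∃ e : V ≃ W, ∀ v, φ (Sum.inr v) = Sum.inr (e v) := by
  have key : ∀ v, ∃ w, φ (Sum.inr v) = Sum.inr w := by
    intro v
    rcases hv : φ (Sum.inr v) with i | w
    · rw [← hφ i] at hv
      cases φ.injective hv
    · exact ⟨w, rfl⟩
  choose f hf using key
  refine ⟨Equiv.ofBijective f ⟨?_, ?_⟩, hf⟩
  · intro a b hab
    have : φ (Sum.inr a) = φ (Sum.inr b) := by rw [hf, hf, hab]
    exact Sum.inr_injective (φ.injective this)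
  · intro w
    rcases hv : φ.symm (Sum.inr w) with i | v
    · rw [RelIso.symm_apply_eq, hφ] at hv
      cases hv
    · refine ⟨v, ?_⟩
      rw [RelIso.symm_apply_eq, hf] at hv
      exact (Sum.inr_injective hv).symm

theorem mobius_comp {m : ℕ} (F F' : GoodForest m) (H : (j : Fin F.n) → GoodForest (F.deg j))
    (ε : (j : Fin F.n) → (F.G.neighborSet (Sum.inr j)) ≃ Fin (F.deg j))
    (φ : F'.G ≃g compose F H ε) (hφ : ∀ i, φ (Sum.inl i) = Sum.inl i) :
    mobiusValue F' = -∏ j, ∏ x : Fin (H j).n, -(((H j).deg x - 2).factorial : ℤ) := by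
  rw [mobius_eq]
  obtain ⟨e, he⟩ := iso_inr φ hφ
  congr 1
  rw [← Fintype.prod_sigma' (fun (j : Fin F.n) (x : Fin (H j).n) => -(((H j).deg x - 2).factorial : ℤ))]
  apply Fintype.prod_equiv e
  intro v
  have h1 : F'.deg v = (H (e v).1).deg (e v).2 := by
    rw [← comp_deg F H ε, GoodForest.deg, ← iso_ncard φ, he]
  rw [h1]

/-- `F'` is the composition of `F` with the forests encoded by `X` -/
def Q {m : ℕ} (F : GoodForest m)
    (ε : (j : Fin F.n) → (F.G.neighborSet (Sum.inr j)) ≃ Fin (F.deg j))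
    (X : (j : Fin F.n) → XT (F.deg j)) (F' : GoodForest m) : Prop :=
  ∃ H : (j : Fin F.n) → GoodForest (F.deg j), (∀ j, ∃ d, Rep (H j).G (X j) d) ∧
    ∃ φ : F'.G ≃g compose F H ε, ∀ i, φ (Sum.inl i) = Sum.inl i

section Q
variable {m : ℕ} {F : GoodForest m}
  {ε : (j : Fin F.n) → (F.G.neighborSet (Sum.inr j)) ≃ Fin (F.deg j)}

theorem Q.val {X F'} (h : Q F ε X F') (hX : ∀ j, VX Finset.univ (X j)) :
    mobiusValue F' = -∏ j, wt (X j).2 := by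
  obtain ⟨H, hH, φ, hφ⟩ := h
  rw [mobius_comp F F' H ε φ hφ]
  congr 1
  apply Finset.prod_congr rfl
  intro j _
  obtain ⟨d, hd⟩ := hH j
  rw [hd.wt (hX j)]

theorem Q.inj {X X' F'} (h : Q F ε X F') (h' : Q F ε X' F') (hX : ∀ j, VX Finset.univ (X j))
    (hX' : ∀ j, VX Finset.univ (X' j)) : X = X' := by
  obtain ⟨H, hH, φ, hφ⟩ := h
  obtain ⟨H', hH', φ', hφ'⟩ := h'
  funext j
  obtain ⟨d, hd⟩ := hH j
  obtain ⟨d', hd'⟩ := hH' j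
  apply hd.uniq (hX j) hd' (hX' j)
  intro C
  rw [LC_comp F H ε, LC_comp F H' ε, ← LC.iso_iff φ hφ, ← LC.iso_iff φ' hφ']

theorem Q.iso {X F' F''} (h : Q F ε X F') (h' : Q F ε X F'') : LabelIso F' F'' := by
  obtain ⟨H, hH, φ, hφ⟩ := h
  obtain ⟨H', hH', φ', hφ'⟩ := h'
  have key : ∀ j, ∃ ψ : (H j).G ≃g (H' j).G, ∀ i, ψ (Sum.inl i) = Sum.inl i := by
    intro j
    obtain ⟨d, hd⟩ := hH j
    obtain ⟨d', hd'⟩ := hH' j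
    exact hd.iso hd'
  choose ψ hψ using key
  obtain ⟨θ, hθ⟩ := comp_iso F H ε H' ε ψ (fun j w => hψ j _)
  refine ⟨(φ.trans θ).trans φ'.symm, fun i => ?_⟩
  simp only [RelIso.trans_apply, hφ, hθ]
  exact iso_symm_leaf φ' hφ' i

theorem Q.of_iso {X F' F''} (h : Q F ε X F') (h' : LabelIso F' F'') : Q F ε X F'' := by
  obtain ⟨H, hH, φ, hφ⟩ := h
  obtain ⟨ψ, hψ⟩ := h'
  refine ⟨H, hH, ψ.symm.trans φ, fun i => ?_⟩
  simp only [RelIso.trans_apply, iso_symm_leaf ψ hψ, hφ]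

theorem Q.le {X F'} (h : Q F ε X F') : CompLE F' F := by
  obtain ⟨H, hH, φ, hφ⟩ := h
  exact ⟨H, ε, φ, hφ⟩

theorem exists_Q {X : (j : Fin F.n) → XT (F.deg j)} (hX : ∀ j, VX Finset.univ (X j)) :
    ∃ F', Q F ε X F' := by
  have key := fun j => exists_real (hX j)
  choose H hH using key
  obtain ⟨F', φ, hφ⟩ := exists_comp F H ε
  exact ⟨F', H, hH, φ, hφ⟩

theorem exists_X {F'} (h : CompLE F' F) : ∃ X, (∀ j, VX Finset.univ (X j)) ∧ Q F ε X F' := by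
  obtain ⟨H, ε', φ, hφ⟩ := h
  have key : ∀ j, ∃ (H' : GoodForest (F.deg j)) (ψ : (H j).G ≃g H'.G),
      ∀ c, ψ (Sum.inl c) = Sum.inl (((ε' j).symm.trans (ε j)) c) :=
    fun j => exists_renamed (H j) _
  choose H' ψ hψ using key
  obtain ⟨θ, hθ⟩ := comp_iso F H ε' H' ε ψ (fun j w => by rw [hψ]; simp)
  have key2 := fun j => exists_rep (H' j)
  choose X d hX hd using key2
  refine ⟨X, hX, H', fun j => ⟨d j, hd j⟩, φ.trans θ, fun i => ?_⟩
  simp only [RelIso.trans_apply, hφ, hθ]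

end Q

theorem main (m : ℕ) (F : GoodForest m) (R : Finset (GoodForest m))
    (hmem : ∀ F' ∈ R, GoodForest.CompLE F' F)
    (hrep : ∀ F'' : GoodForest m, GoodForest.CompLE F'' F →
      ∃! F', F' ∈ R ∧ GoodForest.LabelIso F'' F') :
    (∑ F' ∈ R, GoodForest.mobiusValue F') = -1 := by
  have hε : ∀ j : Fin F.n, Nonempty ((F.G.neighborSet (Sum.inr j)) ≃ Fin (F.deg j)) := by
    intro j
    have : Nat.card (F.G.neighborSet (Sum.inr j)) = F.deg j := rfl
    rw [← this]
    exact ⟨Finite.equivFin _⟩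
  let ε : (j : Fin F.n) → (F.G.neighborSet (Sum.inr j)) ≃ Fin (F.deg j) := fun j => (hε j).some
  let P : Finset ((j : Fin F.n) → XT (F.deg j)) :=
    Fintype.piFinset (fun j => VXs (Finset.univ : Finset (Fin (F.deg j))))
  have hP : ∀ X, X ∈ P ↔ ∀ j, VX Finset.univ (X j) := by
    intro X
    rw [Fintype.mem_piFinset]
    simp only [mem_VXs]
  have ex : ∀ X ∈ P, ∃ F' ∈ R, Q F ε X F' := by
    intro X hX
    obtain ⟨F1, h1⟩ := exists_Q (ε := ε) ((hP X).1 hX)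
    obtain ⟨F', ⟨h2, h3⟩, -⟩ := hrep F1 h1.le
    exact ⟨F', h2, h1.of_iso h3⟩
  choose f hfR hfQ using ex
  have hsum : ∑ X ∈ P, -∏ j, wt (X j).2 = ∑ F' ∈ R, GoodForest.mobiusValue F' := by
    apply Finset.sum_bij f
    · exact hfR
    · intro X hX X' hX' he
      have h' := hfQ X' hX'
      rw [← he] at h'
      exact (hfQ X hX).inj h' ((hP X).1 hX) ((hP X').1 hX')
    · intro F' hF'
      obtain ⟨X, hX, hQ⟩ := exists_X (ε := ε) (hmem F' hF')
      refine ⟨X, (hP X).2 hX, ?_⟩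
      obtain ⟨F1, -, hu⟩ := hrep F' (hmem F' hF')
      rw [hu _ ⟨hfR X ((hP X).2 hX), hQ.iso (hfQ X _)⟩, hu F' ⟨hF', hQ.iso hQ⟩]
    · intro X hX
      exact ((hfQ X hX).val ((hP X).1 hX)).symm
  rw [← hsum, Finset.sum_neg_distrib]
  congr 1
  have := Finset.prod_univ_sum (fun j => VXs (Finset.univ : Finset (Fin (F.deg j))))
    (fun j Y => wt Y.2)
  rw [← this]
  apply Finset.prod_eq_one
  intro j _
  exact sL_one (F.deg j) Finset.univ (by simp) (F.internal_degree_even j)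

end GFM

/-- In the poset `F̄(m)` of good forests on `m` labelled leaves (up to
isomorphism fixing the labels) under the compositional order, with an adjoined minimum element
`⊘`, the Möbius function satisfies
`μ_{F̄}(⊘, F) = (−1)^{|V^□(F)|+1} ∏_{v ∈ V^□(F)} (deg v − 2)!` for every good forest `F`.
Via the defining recursion of the Möbius function (`μ(⊘,⊘) = 1` and
`Σ_{⊘ ≤ y ≤ F} μ(⊘, y) = 0` for `⊘ < F`), this says exactly: for every good forest `F` and
every finite set `R` containing exactly one representative of each isomorphism class of good
forests `F' ≤ F`, the claimed values sum to `−1`. -/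
theorem goodForest_mobius (m : ℕ) (F : GoodForest m) (R : Finset (GoodForest m))
    (hmem : ∀ F' ∈ R, GoodForest.CompLE F' F)
    (hrep : ∀ F'' : GoodForest m, GoodForest.CompLE F'' F →
      ∃! F', F' ∈ R ∧ GoodForest.LabelIso F'' F') :
    (∑ F' ∈ R, GoodForest.mobiusValue F') = -1 := by
  exact GFM.main m F R hmem hrep
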